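/- arXiv:1712.01929 — 11 statements merged into one kernel-verified Lean document; each statement's English description precedes it below -/
import Mathlib

section
/- For every n ≥ 1 and every k ∈ [n], the number of normalized Dumont permutations σ ∈ PD2N_n with σ(1) = 2k equals h_{n,k}, and the number of normalized Dumont permutations σ ∈ PD2N_n with σ(2n+2) = 2l+1 for l = k also equals h_{n,k}; that is, #PD2N_{n,k} = #PD2N'_{n,k} = h_{n,k}. -/
/-- `PD2N n` : the set of normalized Dumont permutations of the second kind of `[2n+2]`,
encoded as permutations of `ℕ` fixing every point outside `[1, 2n+2]`. -/
def PD2N (n : ℕ) : Set (Equiv.Perm ℕ) :=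
  {σ | (∀ x, x < 1 ∨ 2 * n + 2 < x → σ x = x) ∧
       (∀ i, 1 ≤ i → i ≤ n + 1 → 2 * i - 1 < σ (2 * i - 1) ∧ σ (2 * i) < 2 * i) ∧
       (∀ i, 1 ≤ i → i ≤ n → σ.symm (2 * i) < σ.symm (2 * i + 1))}

/-- `PD2Nfirst n k` : the σ ∈ PD2N_n with σ(1) = 2k. -/
def PD2Nfirst (n k : ℕ) : Set (Equiv.Perm ℕ) := {σ ∈ PD2N n | σ 1 = 2 * k}

/-- `PD2Nlast n l` : the σ ∈ PD2N_n with σ(2n+2) = 2l+1. -/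
def PD2Nlast (n l : ℕ) : Set (Equiv.Perm ℕ) := {σ ∈ PD2N n | σ (2 * n + 2) = 2 * l + 1}


open Equiv in
def UU (n : ℕ) : Set (Equiv.Perm ℕ) :=
  {σ | (∀ x, x = 0 ∨ 2 * n + 2 < x → σ x = x) ∧
       (∀ x, 1 ≤ x → x ≤ 2 * n + 2 → (x % 2 = 1 → x < σ x) ∧ (x % 2 = 0 → σ x < x))}

noncomputable def cc (n : ℕ) (p : Equiv.Perm ℕ → Prop) : ℕ := {σ | σ ∈ UU n ∧ p σ}.ncard

theorem UU_le {n : ℕ} {σ : Equiv.Perm ℕ} (h : σ ∈ UU n) (x : ℕ) (hx : x ≤ 2 * n + 2) :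
    σ x ≤ 2 * n + 2 := by
  by_contra hc
  have h1 := h.1 (σ x) (Or.inr (by omega))
  have := σ.injective h1
  omega

theorem UU_pos {n : ℕ} {σ : Equiv.Perm ℕ} (h : σ ∈ UU n) (x : ℕ) (hx : 1 ≤ x) :
    1 ≤ σ x := by
  by_contra hc
  have h1 := h.1 0 (Or.inl rfl)
  have : σ x = σ 0 := by omega
  have := σ.injective this
  omega

theorem UU_fin (n : ℕ) : (UU n).Finite := by
  have hf : ({f : Fin (2 * n + 3) → ℕ | ∀ i, f i ∈ Set.Iic (2 * n + 2)}).Finite :=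
    Set.Finite.pi' (fun i => Set.finite_Iic _)
  refine Set.Finite.of_finite_image (f := fun σ : Equiv.Perm ℕ => fun i : Fin (2 * n + 3) => σ i)
    (hf.subset ?_) ?_
  · rintro _ ⟨σ, hσ, rfl⟩ i
    exact UU_le hσ _ (by have := i.2; omega)
  · intro σ hσ τ hτ h
    ext x
    by_cases hx : x < 2 * n + 3
    · exact congrFun h ⟨x, hx⟩
    · rw [hσ.1 x (by omega), hτ.1 x (by omega)]

theorem cc_fin (n : ℕ) (p : Equiv.Perm ℕ → Prop) : {σ | σ ∈ UU n ∧ p σ}.Finite :=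
  (UU_fin n).subset (fun _ h => h.1)

theorem cc_split (n : ℕ) (p q : Equiv.Perm ℕ → Prop) :
    cc n p = cc n (fun σ => p σ ∧ q σ) + cc n (fun σ => p σ ∧ ¬ q σ) := by
  unfold cc
  rw [← Set.ncard_union_eq _ (cc_fin _ _) (cc_fin _ _)]
  · congr 1
    ext σ
    simp only [Set.mem_ofPred_eq, Set.mem_union]
    tauto
  · rw [Set.disjoint_left]
    rintro σ h1 h2
    exact h2.2.2 h1.2.2

theorem cc_congr (n : ℕ) (p q : Equiv.Perm ℕ → Prop) (h : ∀ σ ∈ UU n, (p σ ↔ q σ)) :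
    cc n p = cc n q := by
  unfold cc
  congr 1
  ext σ
  constructor
  · rintro ⟨a, b⟩; exact ⟨a, (h σ a).1 b⟩
  · rintro ⟨a, b⟩; exact ⟨a, (h σ a).2 b⟩

theorem cc_mul (n : ℕ) (p q : Equiv.Perm ℕ → Prop) (s t : Equiv.Perm ℕ)
    (h1 : ∀ σ ∈ UU n, p σ → (s * σ * t) ∈ UU n ∧ q (s * σ * t))
    (h2 : ∀ σ ∈ UU n, q σ → (s * σ * t) ∈ UU n ∧ p (s * σ * t)) : cc n p = cc n q := by
  have inj : Function.Injective (fun σ : Equiv.Perm ℕ => s * σ * t) := by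
    intro a b h
    simpa using h
  apply le_antisymm
  · exact Set.ncard_le_ncard_of_injOn _ (fun σ h => h1 σ h.1 h.2) inj.injOn (cc_fin _ _)
  · exact Set.ncard_le_ncard_of_injOn _ (fun σ h => h2 σ h.1 h.2) inj.injOn (cc_fin _ _)

theorem cc_lmul (n : ℕ) (p q : Equiv.Perm ℕ → Prop) (s : Equiv.Perm ℕ)
    (h1 : ∀ σ ∈ UU n, p σ → (s * σ) ∈ UU n ∧ q (s * σ))
    (h2 : ∀ σ ∈ UU n, q σ → (s * σ) ∈ UU n ∧ p (s * σ)) : cc n p = cc n q :=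
  cc_mul n p q s 1 (by simpa using h1) (by simpa using h2)

/-- left swap membership -/
theorem UU_swap {n : ℕ} {σ : Equiv.Perm ℕ} (h : σ ∈ UU n) (a b : ℕ) (ha : 1 ≤ a) (hab : a < b)
    (hb : b ≤ 2 * n + 2)
    (hA : ∀ x, 1 ≤ x → x ≤ 2 * n + 2 → σ x = a → (x % 2 = 0 → b < x))
    (hB : ∀ x, 1 ≤ x → x ≤ 2 * n + 2 → σ x = b → (x % 2 = 1 → x < a)) :
    Equiv.swap a b * σ ∈ UU n := by
  refine ⟨fun x hx => ?_, fun x h1 h2 => ?_⟩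
  · have := h.1 x hx
    simp only [Equiv.Perm.mul_apply, Equiv.swap_apply_def]
    split_ifs <;> omega
  · have h3 := h.2 x h1 h2
    have h4 := hA x h1 h2
    have h5 := hB x h1 h2
    simp only [Equiv.Perm.mul_apply, Equiv.swap_apply_def]
    split_ifs <;> constructor <;> intro h6 <;> omega

theorem step1 (n k : ℕ) (hk : 1 ≤ k) (hkn : k + 1 ≤ n) :
    cc n (fun σ => σ 1 = 2 * k ∧ ¬ σ (2 * k + 1) = 2 * k + 2) =
    cc n (fun σ => σ 1 = 2 * k + 2 ∧ ¬ σ (2 * k + 2) = 2 * k) := by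
  apply cc_lmul n _ _ (Equiv.swap (2 * k) (2 * k + 2))
  · rintro σ h ⟨h1, h2⟩
    refine ⟨UU_swap h _ _ (by omega) (by omega) (by omega) ?_ ?_, ?_, ?_⟩
    · intro x hx hx' hx2
      have := (σ.injective.eq_iff (a := x) (b := 1)).1 (by omega)
      omega
    · intro x hx hx' hx2 hx3
      have := h.2 x hx hx'
      have : x ≠ 2 * k + 1 := by rintro rfl; omega
      omega
    · simp [h1]
    · simp only [Equiv.Perm.mul_apply, Equiv.swap_apply_def]
      have := h.2 (2 * k + 2) (by omega) (by omega)
      split_ifs <;> omega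
  · rintro σ h ⟨h1, h2⟩
    refine ⟨UU_swap h _ _ (by omega) (by omega) (by omega) ?_ ?_, ?_, ?_⟩
    · intro x hx hx' hx2 hx3
      have := h.2 x hx hx'
      have : x ≠ 2 * k + 2 := by rintro rfl; omega
      omega
    · intro x hx hx' hx2
      have := (σ.injective.eq_iff (a := x) (b := 1)).1 (by omega)
      omega
    · simp [h1]
    · simp only [Equiv.Perm.mul_apply, Equiv.swap_apply_def]
      have := h.2 (2 * k + 1) (by omega) (by omega)
      split_ifs <;> omega
theorem facts1 {n : ℕ} {σ : Equiv.Perm ℕ} (h : σ ∈ UU n) (k x : ℕ) (hx : 1 ≤ x)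
    (hx' : x ≤ 2 * n + 2) : ((x % 2 = 1 → x < σ x) ∧ (x % 2 = 0 → σ x < x)) ∧
    (σ x = σ 1 ↔ x = 1) ∧ (σ x = σ (2 * k + 1) ↔ x = 2 * k + 1) ∧
    (σ x = σ (2 * k + 2) ↔ x = 2 * k + 2) :=
  ⟨h.2 x hx hx', σ.injective.eq_iff, σ.injective.eq_iff, σ.injective.eq_iff⟩

theorem step2 (n k : ℕ) (hk : 1 ≤ k) (hkn : k + 1 ≤ n) :
    cc n (fun σ => σ 1 = 2 * k + 2 ∧ σ (2 * k + 2) = 2 * k) =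
    cc n (fun σ => σ 1 = 2 * k + 1 ∧ σ (2 * k + 2) = 2 * k ∧ ¬ σ (2 * k + 1) = 2 * k + 2) := by
  apply cc_lmul n _ _ (Equiv.swap (2 * k + 1) (2 * k + 2))
  · rintro σ h ⟨e0, e1⟩
    refine ⟨UU_swap h _ _ (by omega) (by omega) (by omega) ?_ ?_, ?_, ?_, ?_⟩
    · intro x hx hx' hx2 hx3
      have i0 := facts1 h k x hx hx'
      omega
    · intro x hx hx' hx2 hx3
      have i0 := facts1 h k x hx hx'
      omega
    all_goals
      simp only [Equiv.Perm.mul_apply, Equiv.swap_apply_def]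
      have j1 := facts1 h k (2 * k + 1) (by omega) (by omega)
      have j2 := facts1 h k (2 * k + 2) (by omega) (by omega)
      split_ifs <;> omega
  · rintro σ h ⟨e0, e1, e2⟩
    refine ⟨UU_swap h _ _ (by omega) (by omega) (by omega) ?_ ?_, ?_, ?_⟩
    · intro x hx hx' hx2 hx3
      have i0 := facts1 h k x hx hx'
      omega
    · intro x hx hx' hx2 hx3
      have i0 := facts1 h k x hx hx'
      omega
    all_goals
      simp only [Equiv.Perm.mul_apply, Equiv.swap_apply_def]
      have j1 := facts1 h k (2 * k + 1) (by omega) (by omega)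
      have j2 := facts1 h k (2 * k + 2) (by omega) (by omega)
      split_ifs <;> omega

theorem step3 (n k : ℕ) (hk : 1 ≤ k) (hkn : k + 1 ≤ n) :
    cc n (fun σ => σ 1 = 2 * k ∧ σ (2 * k + 1) = 2 * k + 2) =
    cc n (fun σ => σ 1 = 2 * k + 3 ∧ σ (2 * k + 1) = 2 * k + 2 ∧ ¬ σ (2 * k + 2) = 2 * k) := by
  apply cc_lmul n _ _ (Equiv.swap (2 * k) (2 * k + 3))
  · rintro σ h ⟨e0, e1⟩
    refine ⟨UU_swap h _ _ (by omega) (by omega) (by omega) ?_ ?_, ?_, ?_, ?_⟩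
    · intro x hx hx' hx2 hx3
      have i0 := facts1 h k x hx hx'
      omega
    · intro x hx hx' hx2 hx3
      have i0 := facts1 h k x hx hx'
      omega
    all_goals
      simp only [Equiv.Perm.mul_apply, Equiv.swap_apply_def]
      have j1 := facts1 h k (2 * k + 1) (by omega) (by omega)
      have j2 := facts1 h k (2 * k + 2) (by omega) (by omega)
      split_ifs <;> omega
  · rintro σ h ⟨e0, e1, e2⟩
    refine ⟨UU_swap h _ _ (by omega) (by omega) (by omega) ?_ ?_, ?_, ?_⟩
    · intro x hx hx' hx2 hx3
      have i0 := facts1 h k x hx hx'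
      omega
    · intro x hx hx' hx2 hx3
      have i0 := facts1 h k x hx hx'
      omega
    all_goals
      simp only [Equiv.Perm.mul_apply, Equiv.swap_apply_def]
      have j1 := facts1 h k (2 * k + 1) (by omega) (by omega)
      have j2 := facts1 h k (2 * k + 2) (by omega) (by omega)
      split_ifs <;> omega

theorem stepEF (n k : ℕ) (hk : 1 ≤ k) (hkn : k + 1 ≤ n) :
    cc n (fun σ => σ 1 = 2 * k + 1 ∧ σ (2 * k + 2) = 2 * k ∧ σ (2 * k + 1) = 2 * k + 2) =
    cc n (fun σ => σ 1 = 2 * k + 3 ∧ σ (2 * k + 1) = 2 * k + 2 ∧ σ (2 * k + 2) = 2 * k) := by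
  apply cc_lmul n _ _ (Equiv.swap (2 * k + 1) (2 * k + 3))
  · rintro σ h ⟨e0, e1, e2⟩
    refine ⟨UU_swap h _ _ (by omega) (by omega) (by omega) ?_ ?_, ?_, ?_, ?_⟩
    · intro x hx hx' hx2 hx3
      have i0 := facts1 h k x hx hx'
      omega
    · intro x hx hx' hx2 hx3
      have i0 := facts1 h k x hx hx'
      omega
    all_goals
      simp only [Equiv.Perm.mul_apply, Equiv.swap_apply_def]
      have j1 := facts1 h k (2 * k + 1) (by omega) (by omega)
      have j2 := facts1 h k (2 * k + 2) (by omega) (by omega)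
      split_ifs <;> omega
  · rintro σ h ⟨e0, e1, e2⟩
    refine ⟨UU_swap h _ _ (by omega) (by omega) (by omega) ?_ ?_, ?_, ?_, ?_⟩
    · intro x hx hx' hx2 hx3
      have i0 := facts1 h k x hx hx'
      omega
    · intro x hx hx' hx2 hx3
      have i0 := facts1 h k x hx hx'
      omega
    all_goals
      simp only [Equiv.Perm.mul_apply, Equiv.swap_apply_def]
      have j1 := facts1 h k (2 * k + 1) (by omega) (by omega)
      have j2 := facts1 h k (2 * k + 2) (by omega) (by omega)
      split_ifs <;> omega

theorem stepE' (n k : ℕ) (hk : 1 ≤ k) (hkn : k + 1 ≤ n) :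
    cc n (fun σ => σ 1 = 2 * k + 1 ∧ σ (2 * k + 2) = 2 * k ∧ σ (2 * k + 1) = 2 * k + 2) =
    cc n (fun σ => σ 1 = 2 * k + 1 ∧ σ (2 * k + 2) = 2 * k ∧ σ (2 * k + 1) = 2 * k + 3) := by
  apply cc_lmul n _ _ (Equiv.swap (2 * k + 2) (2 * k + 3))
  · rintro σ h ⟨e0, e1, e2⟩
    refine ⟨UU_swap h _ _ (by omega) (by omega) (by omega) ?_ ?_, ?_, ?_, ?_⟩
    · intro x hx hx' hx2 hx3
      have i0 := facts1 h k x hx hx'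
      omega
    · intro x hx hx' hx2 hx3
      have i0 := facts1 h k x hx hx'
      omega
    all_goals
      simp only [Equiv.Perm.mul_apply, Equiv.swap_apply_def]
      have j1 := facts1 h k (2 * k + 1) (by omega) (by omega)
      have j2 := facts1 h k (2 * k + 2) (by omega) (by omega)
      split_ifs <;> omega
  · rintro σ h ⟨e0, e1, e2⟩
    refine ⟨UU_swap h _ _ (by omega) (by omega) (by omega) ?_ ?_, ?_, ?_, ?_⟩
    · intro x hx hx' hx2 hx3
      have i0 := facts1 h k x hx hx'
      omega
    · intro x hx hx' hx2 hx3
      have i0 := facts1 h k x hx hx'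
      omega
    all_goals
      simp only [Equiv.Perm.mul_apply, Equiv.swap_apply_def]
      have j1 := facts1 h k (2 * k + 1) (by omega) (by omega)
      have j2 := facts1 h k (2 * k + 2) (by omega) (by omega)
      split_ifs <;> omega

theorem stepF' (n k : ℕ) (hk : 1 ≤ k) (hkn : k + 1 ≤ n) :
    cc n (fun σ => σ 1 = 2 * k + 3 ∧ σ (2 * k + 1) = 2 * k + 2 ∧ σ (2 * k + 2) = 2 * k) =
    cc n (fun σ => σ 1 = 2 * k + 3 ∧ σ (2 * k + 1) = 2 * k + 2 ∧ σ (2 * k + 2) = 2 * k + 1) := by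
  apply cc_lmul n _ _ (Equiv.swap (2 * k) (2 * k + 1))
  · rintro σ h ⟨e0, e1, e2⟩
    refine ⟨UU_swap h _ _ (by omega) (by omega) (by omega) ?_ ?_, ?_, ?_, ?_⟩
    · intro x hx hx' hx2 hx3
      have i0 := facts1 h k x hx hx'
      omega
    · intro x hx hx' hx2 hx3
      have i0 := facts1 h k x hx hx'
      omega
    all_goals
      simp only [Equiv.Perm.mul_apply, Equiv.swap_apply_def]
      have j1 := facts1 h k (2 * k + 1) (by omega) (by omega)
      have j2 := facts1 h k (2 * k + 2) (by omega) (by omega)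
      split_ifs <;> omega
  · rintro σ h ⟨e0, e1, e2⟩
    refine ⟨UU_swap h _ _ (by omega) (by omega) (by omega) ?_ ?_, ?_, ?_, ?_⟩
    · intro x hx hx' hx2 hx3
      have i0 := facts1 h k x hx hx'
      omega
    · intro x hx hx' hx2 hx3
      have i0 := facts1 h k x hx hx'
      omega
    all_goals
      simp only [Equiv.Perm.mul_apply, Equiv.swap_apply_def]
      have j1 := facts1 h k (2 * k + 1) (by omega) (by omega)
      have j2 := facts1 h k (2 * k + 2) (by omega) (by omega)
      split_ifs <;> omega

theorem stepG (n k : ℕ) (hk : 1 ≤ k) (hkn : k + 1 ≤ n) :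
    cc n (fun σ => σ 1 = 2 * k + 1 ∧ σ (2 * k + 2) = 2 * k ∧ σ (2 * k + 1) = 2 * k + 2) =
    cc n (fun σ => σ 1 = 2 * k ∧ σ (2 * k + 2) = 2 * k + 1 ∧ σ (2 * k + 1) = 2 * k + 2) := by
  apply cc_lmul n _ _ (Equiv.swap (2 * k) (2 * k + 1))
  · rintro σ h ⟨e0, e1, e2⟩
    refine ⟨UU_swap h _ _ (by omega) (by omega) (by omega) ?_ ?_, ?_, ?_, ?_⟩
    · intro x hx hx' hx2 hx3
      have i0 := facts1 h k x hx hx'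
      omega
    · intro x hx hx' hx2 hx3
      have i0 := facts1 h k x hx hx'
      omega
    all_goals
      simp only [Equiv.Perm.mul_apply, Equiv.swap_apply_def]
      have j1 := facts1 h k (2 * k + 1) (by omega) (by omega)
      have j2 := facts1 h k (2 * k + 2) (by omega) (by omega)
      split_ifs <;> omega
  · rintro σ h ⟨e0, e1, e2⟩
    refine ⟨UU_swap h _ _ (by omega) (by omega) (by omega) ?_ ?_, ?_, ?_, ?_⟩
    · intro x hx hx' hx2 hx3
      have i0 := facts1 h k x hx hx'
      omega
    · intro x hx hx' hx2 hx3
      have i0 := facts1 h k x hx hx'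
      omega
    all_goals
      simp only [Equiv.Perm.mul_apply, Equiv.swap_apply_def]
      have j1 := facts1 h k (2 * k + 1) (by omega) (by omega)
      have j2 := facts1 h k (2 * k + 2) (by omega) (by omega)
      split_ifs <;> omega

theorem stepOdd (n k : ℕ) (hk : 1 ≤ k) (hkn : k ≤ n) :
    cc n (fun σ => σ 1 = 2 * k ∧ σ 0 = 0) =
    cc n (fun σ => σ 1 = 2 * k + 1 ∧ σ 0 = 0) := by
  apply cc_lmul n _ _ (Equiv.swap (2 * k) (2 * k + 1))
  · rintro σ h ⟨e0, e1⟩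
    refine ⟨UU_swap h _ _ (by omega) (by omega) (by omega) ?_ ?_, ?_, ?_⟩
    · intro x hx hx' hx2 hx3
      have i0 := facts1 h k x hx hx'
      omega
    · intro x hx hx' hx2 hx3
      have i0 := facts1 h k x hx hx'
      omega
    all_goals
      simp only [Equiv.Perm.mul_apply, Equiv.swap_apply_def]
      have j1 := facts1 h k (2 * k + 1) (by omega) (by omega)
      have j2 := facts1 h k (2 * k + 2) (by omega) (by omega)
      split_ifs <;> omega
  · rintro σ h ⟨e0, e1⟩
    refine ⟨UU_swap h _ _ (by omega) (by omega) (by omega) ?_ ?_, ?_, ?_⟩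
    · intro x hx hx' hx2 hx3
      have i0 := facts1 h k x hx hx'
      omega
    · intro x hx hx' hx2 hx3
      have i0 := facts1 h k x hx hx'
      omega
    all_goals
      simp only [Equiv.Perm.mul_apply, Equiv.swap_apply_def]
      have j1 := facts1 h k (2 * k + 1) (by omega) (by omega)
      have j2 := facts1 h k (2 * k + 2) (by omega) (by omega)
      split_ifs <;> omega

theorem swap2_apply (k x : ℕ) :
    (Equiv.swap (2 * k) (2 * k + 2) * Equiv.swap (2 * k + 1) (2 * k + 3)) x =
    if x = 2 * k then 2 * k + 2 else if x = 2 * k + 1 then 2 * k + 3 else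
    if x = 2 * k + 2 then 2 * k else if x = 2 * k + 3 then 2 * k + 1 else x := by
  simp only [Equiv.Perm.mul_apply, Equiv.swap_apply_def]
  split_ifs <;> omega

set_option maxHeartbeats 2000000 in
theorem stepP (n k : ℕ) (hk : 1 ≤ k) (hkn : k + 1 ≤ n) :
    cc n (fun σ => σ 1 = 2 * k + 1 ∧ σ (2 * k + 2) = 2 * k ∧ ¬ σ (2 * k + 1) = 2 * k + 2
      ∧ ¬ σ (2 * k + 1) = 2 * k + 3) =
    cc n (fun σ => σ 1 = 2 * (k + 1) + 1 ∧ σ (2 * (k + 1) + 2) = 2 * (k + 1)) := by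
  have t1 : Equiv.swap (2 * k + 2) (2 * k + 4) 1 = 1 := by
    simp only [Equiv.swap_apply_def]; split_ifs <;> omega
  have t2 : Equiv.swap (2 * k + 2) (2 * k + 4) (2 * k + 1) = 2 * k + 1 := by
    simp only [Equiv.swap_apply_def]; split_ifs <;> omega
  have t3 : Equiv.swap (2 * k + 2) (2 * k + 4) (2 * (k + 1) + 2) = 2 * k + 2 := by
    simp only [Equiv.swap_apply_def]; split_ifs <;> omega
  have t4 : Equiv.swap (2 * k + 2) (2 * k + 4) (2 * k + 2) = 2 * k + 4 := by simp
  apply cc_mul n _ _ (Equiv.swap (2 * k) (2 * k + 2) * Equiv.swap (2 * k + 1) (2 * k + 3))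
    (Equiv.swap (2 * k + 2) (2 * k + 4))
  · rintro σ h ⟨e1, e2, e3, e4⟩
    refine ⟨⟨fun x hx => ?_, fun x h1 h2 => ?_⟩, ?_, ?_⟩
    · rw [Equiv.Perm.mul_apply, Equiv.Perm.mul_apply, swap2_apply, Equiv.swap_apply_of_ne_of_ne (by omega) (by omega), h.1 x hx]
      split_ifs <;> omega
    · rw [Equiv.Perm.mul_apply, Equiv.Perm.mul_apply, swap2_apply, Equiv.swap_apply_def]
      have i0 := h.2 x h1 h2
      have i1 := σ.injective.eq_iff (a := x) (b := 1)
      have i3 := σ.injective.eq_iff (a := x) (b := 2 * k + 2)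
      have j1 := h.2 (2 * k + 4) (by omega) (by omega)
      have j2 := σ.injective.eq_iff (a := 2 * k + 4) (b := 1)
      have j3 := σ.injective.eq_iff (a := 2 * k + 4) (b := 2 * k + 2)
      have i5 : x = 2 * k + 1 → σ x = σ (2 * k + 1) := by rintro rfl; rfl
      by_cases c1 : x = 2 * k + 2
      · simp only [if_pos c1]; split_ifs <;> omega
      · by_cases c2 : x = 2 * k + 4
        · simp only [if_neg c1, if_pos c2]; split_ifs <;> omega
        · simp only [if_neg c1, if_neg c2]; split_ifs <;> omega
    · rw [Equiv.Perm.mul_apply, Equiv.Perm.mul_apply, swap2_apply, t1]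
      split_ifs <;> omega
    · rw [Equiv.Perm.mul_apply, Equiv.Perm.mul_apply, swap2_apply, t3]
      split_ifs <;> omega
  · rintro σ h ⟨e1, e2⟩
    rw [show 2 * (k + 1) + 2 = 2 * k + 4 by ring] at e2
    have j1 := h.2 (2 * k + 2) (by omega) (by omega)
    have j2 := σ.injective.eq_iff (a := 2 * k + 2) (b := 1)
    have j3 := σ.injective.eq_iff (a := 2 * k + 2) (b := 2 * k + 4)
    have j4 := h.2 (2 * k + 1) (by omega) (by omega)
    have j5 := σ.injective.eq_iff (a := 2 * k + 1) (b := 1)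
    have j6 := σ.injective.eq_iff (a := 2 * k + 1) (b := 2 * k + 4)
    refine ⟨⟨fun x hx => ?_, fun x h1 h2 => ?_⟩, ?_, ?_, ?_, ?_⟩
    · rw [Equiv.Perm.mul_apply, Equiv.Perm.mul_apply, swap2_apply, Equiv.swap_apply_of_ne_of_ne (by omega) (by omega), h.1 x hx]
      split_ifs <;> omega
    · rw [Equiv.Perm.mul_apply, Equiv.Perm.mul_apply, swap2_apply, Equiv.swap_apply_def]
      have i0 := h.2 x h1 h2
      have i1 := σ.injective.eq_iff (a := x) (b := 1)
      have i3 := σ.injective.eq_iff (a := x) (b := 2 * k + 4)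
      have i4 := σ.injective.eq_iff (a := x) (b := 2 * k + 2)
      by_cases c1 : x = 2 * k + 2
      · simp only [if_pos c1]; split_ifs <;> omega
      · by_cases c2 : x = 2 * k + 4
        · simp only [if_neg c1, if_pos c2]; split_ifs <;> omega
        · simp only [if_neg c1, if_neg c2]; split_ifs <;> omega
    · rw [Equiv.Perm.mul_apply, Equiv.Perm.mul_apply, swap2_apply, t1]
      split_ifs <;> omega
    · rw [Equiv.Perm.mul_apply, Equiv.Perm.mul_apply, swap2_apply, t4]
      split_ifs <;> omega
    · rw [Equiv.Perm.mul_apply, Equiv.Perm.mul_apply, swap2_apply, t2]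
      split_ifs <;> omega
    · rw [Equiv.Perm.mul_apply, Equiv.Perm.mul_apply, swap2_apply, t2]
      split_ifs <;> omega

set_option maxHeartbeats 2000000 in
theorem stepQ (n k : ℕ) (hk : 2 ≤ k) (hkn : k + 1 ≤ n) :
    cc n (fun σ => σ 1 = 2 * k + 3 ∧ σ (2 * k + 1) = 2 * k + 2 ∧ ¬ σ (2 * k + 2) = 2 * k
      ∧ ¬ σ (2 * k + 2) = 2 * k + 1) =
    cc n (fun σ => σ 1 = 2 * (k - 1) + 3 ∧ σ (2 * (k - 1) + 1) = 2 * (k - 1) + 2) := by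
  rw [show 2 * (k - 1) + 3 = 2 * k + 1 by omega, show 2 * (k - 1) + 1 = 2 * k - 1 by omega,
    show 2 * (k - 1) + 2 = 2 * k by omega]
  have t1 : Equiv.swap (2 * k - 1) (2 * k + 1) 1 = 1 := by
    simp only [Equiv.swap_apply_def]; split_ifs <;> omega
  have t2 : Equiv.swap (2 * k - 1) (2 * k + 1) (2 * k + 2) = 2 * k + 2 := by
    simp only [Equiv.swap_apply_def]; split_ifs <;> omega
  have t3 : Equiv.swap (2 * k - 1) (2 * k + 1) (2 * k - 1) = 2 * k + 1 := by simp
  have t4 : Equiv.swap (2 * k - 1) (2 * k + 1) (2 * k + 1) = 2 * k - 1 := by simp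
  apply cc_mul n _ _ (Equiv.swap (2 * k) (2 * k + 2) * Equiv.swap (2 * k + 1) (2 * k + 3))
    (Equiv.swap (2 * k - 1) (2 * k + 1))
  · rintro σ h ⟨e1, e2, e3, e4⟩
    refine ⟨⟨fun x hx => ?_, fun x h1 h2 => ?_⟩, ?_, ?_⟩
    · rw [Equiv.Perm.mul_apply, Equiv.Perm.mul_apply, swap2_apply, Equiv.swap_apply_of_ne_of_ne (by omega) (by omega), h.1 x hx]
      split_ifs <;> omega
    · rw [Equiv.Perm.mul_apply, Equiv.Perm.mul_apply, swap2_apply, Equiv.swap_apply_def]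
      have i0 := h.2 x h1 h2
      have i1 := σ.injective.eq_iff (a := x) (b := 1)
      have i3 := σ.injective.eq_iff (a := x) (b := 2 * k + 1)
      have j1 := h.2 (2 * k - 1) (by omega) (by omega)
      have j2 := σ.injective.eq_iff (a := 2 * k - 1) (b := 1)
      have j3 := σ.injective.eq_iff (a := 2 * k - 1) (b := 2 * k + 1)
      have i5 : x = 2 * k + 2 → σ x = σ (2 * k + 2) := by rintro rfl; rfl
      by_cases c1 : x = 2 * k - 1
      · simp only [if_pos c1]; split_ifs <;> omega
      · by_cases c2 : x = 2 * k + 1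
        · simp only [if_neg c1, if_pos c2]; split_ifs <;> omega
        · simp only [if_neg c1, if_neg c2]; split_ifs <;> omega
    · rw [Equiv.Perm.mul_apply, Equiv.Perm.mul_apply, swap2_apply, t1]
      split_ifs <;> omega
    · rw [Equiv.Perm.mul_apply, Equiv.Perm.mul_apply, swap2_apply, t3]
      split_ifs <;> omega
  · rintro σ h ⟨e1, e2⟩
    have j1 := h.2 (2 * k + 2) (by omega) (by omega)
    have j2 := σ.injective.eq_iff (a := 2 * k + 2) (b := 1)
    have j3 := σ.injective.eq_iff (a := 2 * k + 2) (b := 2 * k - 1)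
    have j4 := h.2 (2 * k + 1) (by omega) (by omega)
    have j5 := σ.injective.eq_iff (a := 2 * k + 1) (b := 1)
    have j6 := σ.injective.eq_iff (a := 2 * k + 1) (b := 2 * k - 1)
    refine ⟨⟨fun x hx => ?_, fun x h1 h2 => ?_⟩, ?_, ?_, ?_, ?_⟩
    · rw [Equiv.Perm.mul_apply, Equiv.Perm.mul_apply, swap2_apply, Equiv.swap_apply_of_ne_of_ne (by omega) (by omega), h.1 x hx]
      split_ifs <;> omega
    · rw [Equiv.Perm.mul_apply, Equiv.Perm.mul_apply, swap2_apply, Equiv.swap_apply_def]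
      have i0 := h.2 x h1 h2
      have i1 := σ.injective.eq_iff (a := x) (b := 1)
      have i3 := σ.injective.eq_iff (a := x) (b := 2 * k - 1)
      have i4 := σ.injective.eq_iff (a := x) (b := 2 * k + 1)
      by_cases c1 : x = 2 * k - 1
      · simp only [if_pos c1]; split_ifs <;> omega
      · by_cases c2 : x = 2 * k + 1
        · simp only [if_neg c1, if_pos c2]; split_ifs <;> omega
        · simp only [if_neg c1, if_neg c2]; split_ifs <;> omega
    · rw [Equiv.Perm.mul_apply, Equiv.Perm.mul_apply, swap2_apply, t1]
      split_ifs <;> omega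
    · rw [Equiv.Perm.mul_apply, Equiv.Perm.mul_apply, swap2_apply, t4]
      split_ifs <;> omega
    · rw [Equiv.Perm.mul_apply, Equiv.Perm.mul_apply, swap2_apply, t2]
      split_ifs <;> omega
    · rw [Equiv.Perm.mul_apply, Equiv.Perm.mul_apply, swap2_apply, t2]
      split_ifs <;> omega

def eE (k x : ℕ) : ℕ := if x ≤ 2 * k then x else x + 2
def dD (k x : ℕ) : ℕ := if x ≤ 2 * k then x else x - 2

def fF (k : ℕ) : ℕ ≃ {x : ℕ // x ≠ 2 * k + 1 ∧ x ≠ 2 * k + 2} where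
  toFun x := ⟨eE k x, by unfold eE; split_ifs <;> omega⟩
  invFun y := dD k y.1
  left_inv x := by
    show dD k (eE k x) = x
    unfold dD eE; split_ifs <;> omega
  right_inv y := by
    obtain ⟨y, h1, h2⟩ := y
    apply Subtype.ext
    show eE k (dD k y) = y
    unfold dD eE; split_ifs <;> omega

def Phi (k : ℕ) (τ : Equiv.Perm ℕ) : Equiv.Perm ℕ :=
  τ.extendDomain (fF k) * Equiv.swap (2 * k + 1) (2 * k + 2)

theorem Phi_1 (k : ℕ) (τ : Equiv.Perm ℕ) : Phi k τ (2 * k + 1) = 2 * k + 2 := by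
  simp only [Phi, Equiv.Perm.mul_apply, Equiv.swap_apply_left]
  exact Equiv.Perm.extendDomain_apply_not_subtype _ _ (by simp)

theorem Phi_2 (k : ℕ) (τ : Equiv.Perm ℕ) : Phi k τ (2 * k + 2) = 2 * k + 1 := by
  simp only [Phi, Equiv.Perm.mul_apply, Equiv.swap_apply_right]
  exact Equiv.Perm.extendDomain_apply_not_subtype _ _ (by simp)

theorem Phi_e (k : ℕ) (τ : Equiv.Perm ℕ) (x : ℕ) : Phi k τ (eE k x) = eE k (τ x) := by
  have h : eE k x ≠ 2 * k + 1 ∧ eE k x ≠ 2 * k + 2 := (fF k x).2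
  simp only [Phi, Equiv.Perm.mul_apply, Equiv.swap_apply_of_ne_of_ne h.1 h.2]
  exact Equiv.Perm.extendDomain_apply_image τ (fF k) x

theorem Phi_inj (k : ℕ) : Function.Injective (Phi k) := by
  intro a b h
  have h' : a.extendDomain (fF k) = b.extendDomain (fF k) := mul_right_cancel h
  exact Equiv.Perm.extendDomainHom_injective (fF k) h'

theorem e_surj (k y : ℕ) (h1 : y ≠ 2 * k + 1) (h2 : y ≠ 2 * k + 2) : ∃ x, y = eE k x :=
  ⟨dD k y, by unfold dD eE; split_ifs <;> omega⟩

theorem Phi_surj (k : ℕ) (σ : Equiv.Perm ℕ) (h1 : σ (2 * k + 1) = 2 * k + 2)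
    (h2 : σ (2 * k + 2) = 2 * k + 1) : ∃ τ, Phi k τ = σ := by
  have hne : ∀ (ρ : Equiv.Perm ℕ), ρ (2 * k + 1) = 2 * k + 2 → ρ (2 * k + 2) = 2 * k + 1 →
      ∀ x, eE k (dD k (ρ (eE k x))) = ρ (eE k x) := by
    intro ρ h1 h2 x
    have h := (fF k x).2
    change eE k x ≠ 2 * k + 1 ∧ eE k x ≠ 2 * k + 2 at h
    have i1 := ρ.injective.eq_iff (a := eE k x) (b := 2 * k + 1)
    have i2 := ρ.injective.eq_iff (a := eE k x) (b := 2 * k + 2)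
    obtain ⟨y, hy⟩ := e_surj k (ρ (eE k x)) (by omega) (by omega)
    rw [hy]
    exact congrArg (eE k) ((fF k).left_inv y)
  have hd : ∀ x, dD k (eE k x) = x := (fF k).left_inv
  have s1 : σ.symm (2 * k + 1) = 2 * k + 2 := by rw [Equiv.symm_apply_eq, h2]
  have s2 : σ.symm (2 * k + 2) = 2 * k + 1 := by rw [Equiv.symm_apply_eq, h1]
  refine ⟨⟨fun x => dD k (σ (eE k x)), fun x => dD k (σ.symm (eE k x)), fun x => ?_, fun x => ?_⟩, ?_⟩
  · show dD k (σ.symm (eE k (dD k (σ (eE k x))))) = x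
    rw [hne σ h1 h2]; simp [hd]
  · show dD k (σ (eE k (dD k (σ.symm (eE k x))))) = x
    rw [hne σ.symm s1 s2]; simp [hd]
  · ext x
    by_cases c1 : x = 2 * k + 1
    · rw [c1, Phi_1, h1]
    by_cases c2 : x = 2 * k + 2
    · rw [c2, Phi_2, h2]
    obtain ⟨y, rfl⟩ := e_surj k x c1 c2
    rw [Phi_e]
    exact hne σ h1 h2 y

theorem Phi_mem (n k : ℕ) (hk : k ≤ n + 1) (τ : Equiv.Perm ℕ) : Phi k τ ∈ UU (n + 1) ↔ τ ∈ UU n := by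
  constructor
  · intro h
    refine ⟨fun x hx => ?_, fun x h1 h2 => ?_⟩
    · have := h.1 (eE k x) (by unfold eE; split_ifs <;> omega)
      rw [Phi_e] at this
      revert this
      unfold eE; split_ifs <;> omega
    · have := h.2 (eE k x) (by unfold eE; split_ifs <;> omega) (by unfold eE; split_ifs <;> omega)
      rw [Phi_e] at this
      revert this
      unfold eE; split_ifs <;> omega
  · intro h
    refine ⟨fun x hx => ?_, fun x h1 h2 => ?_⟩
    · obtain ⟨y, rfl⟩ := e_surj k x (by omega) (by omega)
      have hy : y = 0 ∨ 2 * n + 2 < y := by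
        have : (eE k y = y ∧ y ≤ 2 * k) ∨ (eE k y = y + 2 ∧ 2 * k < y) := by
          unfold eE; split_ifs <;> omega
        omega
      rw [Phi_e, h.1 y hy]
    · by_cases c1 : x = 2 * k + 1
      · rw [c1, Phi_1]; omega
      by_cases c2 : x = 2 * k + 2
      · rw [c2, Phi_2]; omega
      obtain ⟨y, rfl⟩ := e_surj k x c1 c2
      rw [Phi_e]
      have := h.2 y
      revert this h1 h2 
      unfold eE; split_ifs <;> omega

theorem compress (n k : ℕ) (hk : k ≤ n + 1) (p q : Equiv.Perm ℕ → Prop)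
    (hpq : ∀ τ, p (Phi k τ) ↔ q τ) :
    cc (n + 1) (fun σ => σ (2 * k + 1) = 2 * k + 2 ∧ σ (2 * k + 2) = 2 * k + 1 ∧ p σ) = cc n q := by
  unfold cc
  rw [← Set.ncard_image_of_injective {τ | τ ∈ UU n ∧ q τ} (Phi_inj k)]
  congr 1
  ext σ
  constructor
  · rintro ⟨h, h1, h2, h3⟩
    obtain ⟨τ, rfl⟩ := Phi_surj k σ h1 h2
    exact ⟨τ, ⟨(Phi_mem n k hk τ).1 h, (hpq τ).1 h3⟩, rfl⟩
  · rintro ⟨τ, ⟨h, h1⟩, rfl⟩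
    exact ⟨(Phi_mem n k hk τ).2 h, Phi_1 k τ, Phi_2 k τ, (hpq τ).2 h1⟩

/-- removal, k ≥ 1 -/
theorem compress_k (n k : ℕ) (hk : 1 ≤ k) (hkn : k ≤ n) :
    cc (n + 1) (fun σ => σ 1 = 2 * k ∧ σ (2 * k + 2) = 2 * k + 1 ∧ σ (2 * k + 1) = 2 * k + 2) =
    cc n (fun σ => σ 1 = 2 * k) := by
  rw [← compress n k (by omega) (fun σ => σ 1 = 2 * k)]
  · apply cc_congr
    intro σ _
    tauto
  · intro τ
    have h1 : eE k 1 = 1 := by unfold eE; split_ifs <;> omega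
    have := Phi_e k τ 1
    rw [h1] at this
    rw [this]
    unfold eE; split_ifs <;> omega

theorem compress_0 (n : ℕ) :
    cc (n + 1) (fun σ => σ 1 = 2 * 1) = cc n (fun _ => True) := by
  rw [← compress n 0 (by omega) (fun σ => True) _ (fun _ => Iff.rfl)]
  apply cc_congr
  intro σ h
  have h1 := h.2 2 (by omega) (by omega)
  have h2 := UU_pos h 2 (by omega)
  simp
  omega

/-- total -/
theorem total (n : ℕ) (hn : 1 ≤ n) :
    cc n (fun _ => True) = ∑ k ∈ Finset.Icc 1 n, 2 * cc n (fun σ => σ 1 = 2 * k) := by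
  have key : ∀ m, m ≤ n → cc n (fun σ => σ 1 < 2 * m + 2) =
      ∑ k ∈ Finset.Icc 1 m, 2 * cc n (fun σ => σ 1 = 2 * k) := by
    intro m
    induction m with
    | zero =>
      intro _
      rw [Finset.Icc_eq_empty (by omega), Finset.sum_empty]
      unfold cc
      rw [Set.ncard_eq_zero (cc_fin _ _)]
      rw [Set.eq_empty_iff_forall_notMem]
      rintro σ ⟨h, h1⟩
      have := h.2 1 (by omega) (by omega)
      omega
    | succ m ih =>
      intro hm
      rw [Finset.sum_Icc_succ_top (by omega), ← ih (by omega),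
        cc_split n _ (fun σ => σ 1 < 2 * m + 2), cc_split n (fun σ => _ ∧ ¬ _) (fun σ => σ 1 = 2 * (m + 1))]
      have o := stepOdd n (m + 1) (by omega) hm
      have e1 : cc n (fun σ => σ 1 = 2 * (m + 1) ∧ σ 0 = 0) = cc n (fun σ => σ 1 = 2 * (m + 1)) := by
        apply cc_congr
        intro σ h
        have := h.1 0 (Or.inl rfl)
        tauto
      rw [cc_congr n _ (fun σ => σ 1 < 2 * m + 2), cc_congr n (fun σ => (_ ∧ _) ∧ _) (fun σ => σ 1 = 2 * (m + 1) ∧ σ 0 = 0),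
        cc_congr n (fun σ => (_ ∧ _) ∧ _) (fun σ => σ 1 = 2 * (m + 1) + 1 ∧ σ 0 = 0)]
      · omega
      · intro σ h
        have := h.1 0 (Or.inl rfl)
        omega
      · intro σ h
        have := h.1 0 (Or.inl rfl)
        omega
      · intro σ h
        omega
  rw [← key n le_rfl]
  apply cc_congr
  intro σ h
  have h1 := UU_le h 1 (by omega)
  have h2 := UU_le h (2 * n + 1) (by omega)
  have h3 := h.2 (2 * n + 1) (by omega) (by omega)
  have h4 := σ.injective.eq_iff (a := 1) (b := 2 * n + 1)
  simp
  omega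

theorem diff1 (n k : ℕ) (hk : 1 ≤ k) (hkn : k + 1 ≤ n) :
    cc n (fun σ => σ 1 = 2 * (k + 1)) + cc n (fun σ => σ 1 = 2 * k + 3 ∧ σ (2 * k + 1) = 2 * k + 2) =
    cc n (fun σ => σ 1 = 2 * k) + cc n (fun σ => σ 1 = 2 * k + 1 ∧ σ (2 * k + 2) = 2 * k) := by
  have a1 := cc_split n (fun σ => σ 1 = 2 * k) (fun σ => σ (2 * k + 1) = 2 * k + 2)
  have a2 := cc_split n (fun σ => σ 1 = 2 * k + 2) (fun σ => σ (2 * k + 2) = 2 * k)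
  have a3 := cc_split n (fun σ => σ 1 = 2 * k + 1 ∧ σ (2 * k + 2) = 2 * k)
    (fun σ => σ (2 * k + 1) = 2 * k + 2)
  have a4 := cc_split n (fun σ => σ 1 = 2 * k + 3 ∧ σ (2 * k + 1) = 2 * k + 2)
    (fun σ => σ (2 * k + 2) = 2 * k)
  simp only [and_assoc] at a3 a4
  have b1 := step1 n k hk hkn
  have b2 := step2 n k hk hkn
  have b3 := step3 n k hk hkn
  have b4 := stepEF n k hk hkn
  rw [show 2 * (k + 1) = 2 * k + 2 by ring]
  omega

theorem diffP (n k : ℕ) (hk : 1 ≤ k) (hkn : k ≤ n) :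
    cc (n + 1) (fun σ => σ 1 = 2 * k + 1 ∧ σ (2 * k + 2) = 2 * k) =
    cc (n + 1) (fun σ => σ 1 = 2 * (k + 1) + 1 ∧ σ (2 * (k + 1) + 2) = 2 * (k + 1)) +
      2 * cc n (fun σ => σ 1 = 2 * k) := by
  have a3 := cc_split (n + 1) (fun σ => σ 1 = 2 * k + 1 ∧ σ (2 * k + 2) = 2 * k)
    (fun σ => σ (2 * k + 1) = 2 * k + 2)
  have a4 := cc_split (n + 1) (fun σ => (σ 1 = 2 * k + 1 ∧ σ (2 * k + 2) = 2 * k) ∧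
     ¬ σ (2 * k + 1) = 2 * k + 2) (fun σ => σ (2 * k + 1) = 2 * k + 3)
  have a5 : cc (n + 1) (fun σ => ((σ 1 = 2 * k + 1 ∧ σ (2 * k + 2) = 2 * k) ∧
     ¬ σ (2 * k + 1) = 2 * k + 2) ∧ σ (2 * k + 1) = 2 * k + 3) =
     cc (n + 1) (fun σ => σ 1 = 2 * k + 1 ∧ σ (2 * k + 2) = 2 * k ∧ σ (2 * k + 1) = 2 * k + 3) := by
    apply cc_congr
    intro σ _
    omega
  simp only [and_assoc] at a3 a4 a5
  have b1 := stepP (n + 1) k hk (by omega)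
  have b2 := stepE' (n + 1) k hk (by omega)
  have b3 := stepG (n + 1) k hk (by omega)
  have b4 := compress_k n k hk hkn
  omega

theorem diffQ0 (n k : ℕ) (hk : 1 ≤ k) (hkn : k ≤ n) :
    cc (n + 1) (fun σ => σ 1 = 2 * k + 3 ∧ σ (2 * k + 1) = 2 * k + 2) =
    cc (n + 1) (fun σ => σ 1 = 2 * k + 3 ∧ σ (2 * k + 1) = 2 * k + 2 ∧ ¬ σ (2 * k + 2) = 2 * k
      ∧ ¬ σ (2 * k + 2) = 2 * k + 1) +
      2 * cc n (fun σ => σ 1 = 2 * k) := by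
  have a3 := cc_split (n + 1) (fun σ => σ 1 = 2 * k + 3 ∧ σ (2 * k + 1) = 2 * k + 2)
    (fun σ => σ (2 * k + 2) = 2 * k)
  have a4 := cc_split (n + 1) (fun σ => (σ 1 = 2 * k + 3 ∧ σ (2 * k + 1) = 2 * k + 2) ∧
     ¬ σ (2 * k + 2) = 2 * k) (fun σ => σ (2 * k + 2) = 2 * k + 1)
  have a5 : cc (n + 1) (fun σ => ((σ 1 = 2 * k + 3 ∧ σ (2 * k + 1) = 2 * k + 2) ∧
     ¬ σ (2 * k + 2) = 2 * k) ∧ σ (2 * k + 2) = 2 * k + 1) =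
     cc (n + 1) (fun σ => σ 1 = 2 * k + 3 ∧ σ (2 * k + 1) = 2 * k + 2 ∧ σ (2 * k + 2) = 2 * k + 1) := by
    apply cc_congr
    intro σ _
    omega
  simp only [and_assoc] at a3 a4 a5
  have b2 := stepF' (n + 1) k hk (by omega)
  have b3 := stepG (n + 1) k hk (by omega)
  have b5 := stepEF (n + 1) k hk (by omega)
  have b4 := compress_k n k hk hkn
  omega

theorem cc_zero (n : ℕ) (p : Equiv.Perm ℕ → Prop) (h : ∀ σ ∈ UU n, ¬ p σ) : cc n p = 0 := by
  unfold cc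
  rw [Set.ncard_eq_zero (cc_fin _ _), Set.eq_empty_iff_forall_notMem]
  rintro σ ⟨h1, h2⟩
  exact h σ h1 h2

noncomputable def DD (n k : ℕ) : ℤ := cc n (fun σ => σ 1 = 2 * k)
noncomputable def PP (n k : ℕ) : ℤ := cc n (fun σ => σ 1 = 2 * k + 1 ∧ σ (2 * k + 2) = 2 * k)
/-- shifted: `QQ n k` is Q(k+1) -/
noncomputable def QQ (n k : ℕ) : ℤ := if k = 0 then 0 else
  cc n (fun σ => σ 1 = 2 * k + 3 ∧ σ (2 * k + 1) = 2 * k + 2)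

theorem R1 (n k : ℕ) (hk : 1 ≤ k) (hkn : k + 1 ≤ n) :
    DD n (k + 1) - DD n k = PP n k - QQ n k := by
  have := diff1 n k hk hkn
  unfold DD PP QQ
  rw [if_neg (by omega)]
  omega

theorem R2 (n k : ℕ) (hk : 1 ≤ k) (hkn : k ≤ n) :
    PP (n + 1) k - PP (n + 1) (k + 1) = 2 * DD n k := by
  have := diffP n k hk hkn
  unfold DD PP
  omega

theorem R3 (n k : ℕ) (hk : 1 ≤ k) (hkn : k ≤ n) :
    QQ (n + 1) k - QQ (n + 1) (k - 1) = 2 * DD n k := by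
  have := diffQ0 n k hk hkn
  unfold DD QQ
  rw [if_neg (by omega)]
  by_cases h : k = 1
  · subst h
    rw [if_pos (by omega)]
    rw [cc_zero (n + 1) (fun σ => _ ∧ _ ∧ _ ∧ _)] at this
    · push_cast [this]; ring
    · intro σ h
      have h1 := h.2 2 (by omega) (by omega)
      have h2 := h.2 4 (by omega) (by omega)
      have h3 := UU_pos h 2 (by omega)
      have h4 := UU_pos h 4 (by omega)
      have h5 := σ.injective.eq_iff (a := 4) (b := 2)
      simp only [Nat.mul_one, Nat.reduceAdd]
      omega
  · rw [if_neg (by omega)]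
    have q := stepQ (n + 1) k (by omega) (by omega)
    rw [q] at this
    push_cast [this]; ring

theorem R0 (n : ℕ) (hn : 1 ≤ n) : DD (n + 1) 1 = ∑ i ∈ Finset.Icc 1 n, 2 * DD n i := by
  unfold DD
  rw [compress_0, total n hn]
  push_cast
  rfl

theorem RP1 (n : ℕ) (hn : 1 ≤ n) : PP n 1 = DD n 1 := by
  unfold PP DD
  have o := stepOdd n 1 le_rfl hn
  rw [cc_congr n (fun σ => σ 1 = 2 * 1) (fun σ => σ 1 = 2 * 1 ∧ σ 0 = 0), o]
  · congr 1
    apply cc_congr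
    intro σ h
    have h0 := h.1 0 (Or.inl rfl)
    have h1 := h.2 2 (by omega) (by omega)
    have h2 := h.2 4 (by omega) (by omega)
    have h3 := UU_pos h 2 (by omega)
    have h4 := UU_pos h 4 (by omega)
    have h5 := σ.injective.eq_iff (a := 4) (b := 2)
    have h6 := σ.injective.eq_iff (a := 4) (b := 1)
    simp only [Nat.mul_one, Nat.reduceAdd]
    omega
  · intro σ h
    have := h.1 0 (Or.inl rfl)
    tauto

theorem RQtop (n : ℕ) (hn : 1 ≤ n) : DD (n + 1) (n + 1) = QQ (n + 1) n := by
  unfold QQ DD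
  rw [if_neg (by omega)]
  have o := stepOdd (n + 1) (n + 1) (by omega) le_rfl
  rw [cc_congr (n + 1) (fun σ => σ 1 = 2 * (n + 1)) (fun σ => σ 1 = 2 * (n + 1) ∧ σ 0 = 0), o]
  · congr 1
    apply cc_congr
    intro σ h
    have h0 := h.1 0 (Or.inl rfl)
    have h1 := h.2 (2 * n + 1) (by omega) (by omega)
    have h2 := h.2 (2 * n + 3) (by omega) (by omega)
    have h3 := UU_le h (2 * n + 1) (by omega)
    have h4 := UU_le h (2 * n + 3) (by omega)
    have h5 := σ.injective.eq_iff (a := 2 * n + 1) (b := 2 * n + 3)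
    have h6 := σ.injective.eq_iff (a := 2 * n + 1) (b := 1)
    omega
  · intro σ h
    have := h.1 0 (Or.inl rfl)
    tauto

theorem QQsum (n : ℕ) (k : ℕ) (hk : k ≤ n) :
    QQ (n + 1) k = ∑ i ∈ Finset.Icc 1 k, 2 * DD n i := by
  induction k with
  | zero => simp [QQ]
  | succ k ih =>
    rw [Finset.sum_Icc_succ_top (by omega), ← ih (by omega)]
    have := R3 n (k + 1) (by omega) hk
    rw [Nat.add_sub_cancel] at this
    linarith

theorem PPsum (n : ℕ) (k : ℕ) (hk : k ≤ n) :
    PP (n + 1) (k + 1) = DD (n + 1) 1 - ∑ i ∈ Finset.Icc 1 k, 2 * DD n i := by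
  induction k with
  | zero => simp [RP1]
  | succ k ih =>
    rw [Finset.sum_Icc_succ_top (by omega)]
    have := R2 n (k + 1) (by omega) hk
    have := ih (by omega)
    linarith

theorem DDrec (n k : ℕ) (hk : 1 ≤ k) (hkn : k + 1 ≤ n) :
    DD (n + 1) (k + 2) = 2 * DD (n + 1) (k + 1) - DD (n + 1) k - 2 * DD n (k + 1) - 2 * DD n k := by
  have a1 := R1 (n + 1) (k + 1) (by omega) (by omega)
  have a2 := R1 (n + 1) k (by omega) (by omega)
  have a3 := R2 n k hk (by omega)
  have a4 := R3 n (k + 1) (by omega) (by omega)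
  rw [Nat.add_sub_cancel] at a4
  rw [show k + 1 + 1 = k + 2 by ring] at a1
  linarith

theorem DD11 : DD 1 1 = 1 := by
  unfold DD
  rw [compress_0 0]
  unfold cc
  have : {σ : Equiv.Perm ℕ | σ ∈ UU 0 ∧ True} = {Equiv.swap 1 2} := by
    ext σ
    constructor
    · rintro ⟨h, _⟩
      have h1 := h.2 1 (by omega) (by omega)
      have h2 := h.2 2 (by omega) (by omega)
      have h3 := UU_pos h 2 (by omega)
      have h4 := UU_le h 1 (by omega)
      apply Equiv.ext
      intro x
      have h5 := h.1 x
      rw [Equiv.swap_apply_def]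
      split_ifs with c1 c2
      · subst c1; omega
      · subst c2; omega
      · omega
    · intro h
      have h : σ = Equiv.swap 1 2 := h
      subst h
      refine ⟨⟨fun x hx => ?_, fun x h1 h2 => ?_⟩, trivial⟩
      · exact Equiv.swap_apply_of_ne_of_ne (by omega) (by omega)
      · rw [Equiv.swap_apply_def]; split_ifs <;> omega
  rw [this, Set.ncard_singleton]
  rfl

theorem uniq (h : ℕ → ℕ → ℤ)
    (h11 : h 1 1 = 1)
    (hrow1 : ∀ m, 2 ≤ m → h m 1 = ∑ i ∈ Finset.Icc 1 (m - 1), h (m - 1) i)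
    (hrow2 : ∀ m, 2 ≤ m → h m 2 = 2 * h m 1 - h (m - 1) 1)
    (hrec : ∀ m k, 2 ≤ m → 3 ≤ k → k ≤ m →
      h m k = 2 * h m (k - 1) - h m (k - 2) - h (m - 1) (k - 1) - h (m - 1) (k - 2))
    (D : ℕ → ℕ → ℤ) (d11 : D 1 1 = 1)
    (d1 : ∀ n, 1 ≤ n → D (n + 1) 1 = ∑ i ∈ Finset.Icc 1 n, 2 * D n i)
    (d2 : ∀ n, 1 ≤ n → D (n + 1) 2 = 2 * D (n + 1) 1 - 2 * D n 1)
    (d3 : ∀ n k, 1 ≤ k → k + 1 ≤ n → D (n + 1) (k + 2) =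
      2 * D (n + 1) (k + 1) - D (n + 1) k - 2 * D n (k + 1) - 2 * D n k) (n : ℕ) :
    ∀ k, 1 ≤ k → k ≤ n + 1 → D (n + 1) k = 2 ^ n * h (n + 1) k := by
  induction n with
  | zero =>
    intro k h1 h2
    obtain rfl : k = 1 := by omega
    simp [d11, h11]
  | succ n ih =>
    have e1 : D (n + 1 + 1) 1 = 2 ^ (n + 1) * h (n + 1 + 1) 1 := by
      rw [d1 (n + 1) (by omega), hrow1 (n + 1 + 1) (by omega), Nat.add_sub_cancel, Finset.mul_sum]
      apply Finset.sum_congr rfl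
      intro i hi
      rw [Finset.mem_Icc] at hi
      rw [ih i hi.1 hi.2]; ring
    intro k
    induction k using Nat.strong_induction_on with
    | _ k ihk =>
      intro h1 h2
      match k, h1, h2, ihk with
      | 1, _, _, _ => exact e1
      | 2, _, _, _ =>
        rw [d2 (n + 1) (by omega), hrow2 (n + 1 + 1) (by omega), Nat.add_sub_cancel, e1,
          ih 1 (by omega) (by omega)]
        ring
      | k + 3, _, h2, ihk =>
        have r := d3 (n + 1) (k + 1) (by omega) (by omega)
        have s := hrec (n + 1 + 1) (k + 3) (by omega) (by omega) (by omega)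
        rw [show k + 3 - 1 = k + 2 by omega, show k + 3 - 2 = k + 1 by omega, Nat.add_sub_cancel] at s
        rw [show k + 1 + 2 = k + 3 by ring, show k + 1 + 1 = k + 2 by ring,
          ihk (k + 2) (by omega) (by omega) (by omega), ihk (k + 1) (by omega) (by omega) (by omega),
          ih (k + 2) (by omega) (by omega), ih (k + 1) (by omega) (by omega)] at r
        rw [r, s]; ring

/-- normalization -/
def NN (n k m : ℕ) (σ : Equiv.Perm ℕ) : Prop :=
  σ 1 = 2 * k ∧ ∀ i, 1 ≤ i → i ≤ m → σ.symm (2 * i) < σ.symm (2 * i + 1)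

theorem UU_symm {n : ℕ} {σ : Equiv.Perm ℕ} (h : σ ∈ UU n) (y : ℕ) (h1 : 1 ≤ y) (h2 : y ≤ 2 * n + 2) :
    1 ≤ σ.symm y ∧ σ.symm y ≤ 2 * n + 2 := by
  constructor
  · by_contra hc
    have : σ.symm y = 0 := by omega
    rw [Equiv.symm_apply_eq, h.1 0 (Or.inl rfl)] at this
    omega
  · by_contra hc
    have := h.1 (σ.symm y) (by omega)
    rw [Equiv.apply_symm_apply] at this
    omega

theorem UU_swap' {n i : ℕ} {σ : Equiv.Perm ℕ} (h : σ ∈ UU n) (hi : 1 ≤ i) (hin : i ≤ n) :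
    Equiv.swap (2 * i) (2 * i + 1) * σ ∈ UU n := by
  apply UU_swap h _ _ (by omega) (by omega) (by omega)
  · intro x h1 h2 h3 h4
    have := h.2 x h1 h2
    omega
  · intro x h1 h2 h3 h4
    have := h.2 x h1 h2
    omega

theorem swap_symm_apply (i y : ℕ) (σ : Equiv.Perm ℕ) :
    (Equiv.swap (2 * i) (2 * i + 1) * σ).symm y = σ.symm (Equiv.swap (2 * i) (2 * i + 1) y) := by
  rw [Equiv.symm_apply_eq]
  simp

theorem NN_step (n k m : ℕ) (hm : m + 1 ≤ n) (hk : 1 ≤ k) :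
    cc n (NN n k m) = (if m + 1 = k then 1 else 2) * cc n (NN n k (m + 1)) := by
  split_ifs with hmk
  · subst hmk
    rw [one_mul]
    apply cc_congr
    intro σ h
    constructor
    · rintro ⟨h1, h2⟩
      refine ⟨h1, fun i hi hi' => ?_⟩
      by_cases c : i ≤ m
      · exact h2 i hi c
      · obtain rfl : i = m + 1 := by omega
        have h3 : σ.symm (2 * (m + 1)) = 1 := by rw [Equiv.symm_apply_eq, h1]
        have h4 := UU_symm h (2 * (m + 1) + 1) (by omega) (by omega)
        have h5 := σ.symm.injective.eq_iff (a := 2 * (m + 1)) (b := 2 * (m + 1) + 1)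
        omega
    · rintro ⟨h1, h2⟩
      exact ⟨h1, fun i hi hi' => h2 i hi (by omega)⟩
  · rw [cc_split n (NN n k m) (fun σ => σ.symm (2 * (m + 1)) < σ.symm (2 * (m + 1) + 1)), two_mul (cc n (NN n k (m + 1)))]
    have hiff : ∀ σ : Equiv.Perm ℕ,
        (NN n k m σ ∧ σ.symm (2 * (m + 1)) < σ.symm (2 * (m + 1) + 1)) ↔ NN n k (m + 1) σ := by
      intro σ
      constructor
      · rintro ⟨⟨h1, h2⟩, h3⟩
        refine ⟨h1, fun i hi hi' => ?_⟩
        by_cases c : i ≤ m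
        · exact h2 i hi c
        · obtain rfl : i = m + 1 := by omega
          exact h3
      · rintro ⟨h1, h2⟩
        exact ⟨⟨h1, fun i hi hi' => h2 i hi (by omega)⟩, h2 (m + 1) (by omega) le_rfl⟩
    have hsw : ∀ σ : Equiv.Perm ℕ, NN n k m σ →
        NN n k m (Equiv.swap (2 * (m + 1)) (2 * (m + 1) + 1) * σ) := by
      rintro σ ⟨h1, h2⟩
      refine ⟨?_, fun i hi hi' => ?_⟩
      · rw [Equiv.Perm.mul_apply, h1, Equiv.swap_apply_of_ne_of_ne (by omega) (by omega)]
      · rw [swap_symm_apply, swap_symm_apply, Equiv.swap_apply_of_ne_of_ne (by omega) (by omega),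
          Equiv.swap_apply_of_ne_of_ne (by omega) (by omega)]
        exact h2 i hi hi'
    rw [cc_congr n _ (NN n k (m + 1)) (fun σ _ => hiff σ)]
    congr 1
    rw [← cc_congr n _ (NN n k (m + 1)) (fun σ _ => hiff σ)]
    apply cc_lmul n _ _ (Equiv.swap (2 * (m + 1)) (2 * (m + 1) + 1))
    · rintro σ h ⟨h1, h2⟩
      refine ⟨UU_swap' h (by omega) hm, hsw σ h1, ?_⟩
      rw [swap_symm_apply, swap_symm_apply, Equiv.swap_apply_left, Equiv.swap_apply_right]
      have h5 := σ.symm.injective.eq_iff (a := 2 * (m + 1)) (b := 2 * (m + 1) + 1)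
      omega
    · rintro σ h ⟨h1, h2⟩
      refine ⟨UU_swap' h (by omega) hm, hsw σ h1, ?_⟩
      rw [swap_symm_apply, swap_symm_apply, Equiv.swap_apply_left, Equiv.swap_apply_right]
      omega

theorem NN_all (n k m : ℕ) (hm : m ≤ n) (hk : 1 ≤ k) :
    cc n (fun σ => σ 1 = 2 * k) = 2 ^ (if k ≤ m then m - 1 else m) * cc n (NN n k m) := by
  induction m with
  | zero =>
    rw [if_neg (by omega), pow_zero, one_mul]
    apply cc_congr
    intro σ _
    constructor
    · intro h; exact ⟨h, fun i h1 h2 => by omega⟩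
    · exact fun h => h.1
  | succ m ih =>
    rw [ih (by omega), NN_step n k m hm hk]
    by_cases c1 : k ≤ m
    · rw [if_pos c1, if_pos (show k ≤ m + 1 by omega), if_neg (show ¬ m + 1 = k by omega), show m + 1 - 1 = (m - 1) + 1 by omega]
      ring
    · by_cases c2 : k = m + 1
      · rw [if_neg c1, if_pos (show k ≤ m + 1 by omega), if_pos (show m + 1 = k by omega), Nat.add_sub_cancel]
        ring
      · rw [if_neg c1, if_neg (show ¬ k ≤ m + 1 by omega), if_neg (show ¬ m + 1 = k by omega)]
        ring

theorem PD2N_iff (n : ℕ) (σ : Equiv.Perm ℕ) : σ ∈ PD2N n ↔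
    σ ∈ UU n ∧ ∀ i, 1 ≤ i → i ≤ n → σ.symm (2 * i) < σ.symm (2 * i + 1) := by
  constructor
  · rintro ⟨h1, h2, h3⟩
    refine ⟨⟨fun x hx => h1 x (by omega), fun x hx hx' => ⟨fun c => ?_, fun c => ?_⟩⟩, h3⟩
    · have := (h2 ((x + 1) / 2) (by omega) (by omega)).1
      rwa [show 2 * ((x + 1) / 2) - 1 = x by omega] at this
    · have := (h2 (x / 2) (by omega) (by omega)).2
      rwa [show 2 * (x / 2) = x by omega] at this
  · rintro ⟨⟨h1, h2⟩, h3⟩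
    refine ⟨fun x hx => h1 x (by omega), fun i hi hi' => ⟨?_, ?_⟩, h3⟩
    · exact (h2 (2 * i - 1) (by omega) (by omega)).1 (by omega)
    · exact (h2 (2 * i) (by omega) (by omega)).2 (by omega)

theorem first_card (n k : ℕ) (hk : 1 ≤ k) (hkn : k ≤ n) :
    DD n k = 2 ^ (n - 1) * ((PD2Nfirst n k).ncard : ℤ) := by
  unfold DD
  rw [NN_all n k n le_rfl hk, if_pos hkn]
  push_cast
  congr 2
  unfold cc
  congr 1
  ext σ
  constructor
  · rintro ⟨h1, h2, h3⟩
    exact ⟨(PD2N_iff n σ).2 ⟨h1, h3⟩, h2⟩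
  · rintro ⟨h1, h2⟩
    have := (PD2N_iff n σ).1 h1
    exact ⟨this.1, h2, this.2⟩

def rho (n x : ℕ) : ℕ := if x = 0 ∨ 2 * n + 2 < x then x else 2 * n + 3 - x

theorem rho_rho (n x : ℕ) : rho n (rho n x) = x := by
  unfold rho; split_ifs <;> omega

def rr (n : ℕ) : Equiv.Perm ℕ := ⟨rho n, rho n, rho_rho n, rho_rho n⟩

theorem rr_apply (n x : ℕ) (h1 : 1 ≤ x) (h2 : x ≤ 2 * n + 2) : rr n x = 2 * n + 3 - x := by
  show rho n x = _
  unfold rho; split_ifs <;> omega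

theorem rr_apply' (n x : ℕ) (h : x = 0 ∨ 2 * n + 2 < x) : rr n x = x := by
  show rho n x = _
  unfold rho; split_ifs; rfl

theorem rr_symm (n : ℕ) : (rr n).symm = rr n := rfl

theorem rr_mem (n : ℕ) (σ : Equiv.Perm ℕ) (h : σ ∈ PD2N n) : rr n * σ * rr n ∈ PD2N n := by
  rw [PD2N_iff] at h ⊢
  obtain ⟨h, h3⟩ := h
  refine ⟨⟨fun x hx => ?_, fun x h1 h2 => ?_⟩, fun i hi hi' => ?_⟩
  · simp only [Equiv.Perm.mul_apply]
    rw [rr_apply' n x hx, h.1 x hx, rr_apply' n x hx]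
  · simp only [Equiv.Perm.mul_apply]
    rw [rr_apply n x h1 h2]
    have a := h.2 (2 * n + 3 - x) (by omega) (by omega)
    have b := UU_pos h (2 * n + 3 - x) (by omega)
    have c := UU_le h (2 * n + 3 - x) (by omega)
    rw [rr_apply n _ b c]
    omega
  · have e : ∀ y, (rr n * σ * rr n).symm y = rr n (σ.symm (rr n y)) := fun y => rfl
    rw [e, e, rr_apply n (2 * i) (by omega) (by omega), rr_apply n (2 * i + 1) (by omega) (by omega)]
    have a := UU_symm h (2 * n + 3 - 2 * i) (by omega) (by omega)
    have b := UU_symm h (2 * n + 3 - (2 * i + 1)) (by omega) (by omega)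
    rw [rr_apply n _ a.1 a.2, rr_apply n _ b.1 b.2]
    have c := h3 (n + 1 - i) (by omega) (by omega)
    rw [show 2 * (n + 1 - i) + 1 = 2 * n + 3 - 2 * i by omega,
      show 2 * (n + 1 - i) = 2 * n + 3 - (2 * i + 1) by omega] at c
    omega

theorem last_card (n k : ℕ) (hk : 1 ≤ k) (hkn : k ≤ n) :
    (PD2Nlast n k).ncard = (PD2Nfirst n (n + 1 - k)).ncard := by
  have fin : (PD2N n).Finite := (UU_fin n).subset (fun σ h => ((PD2N_iff n σ).1 h).1)
  have inj : Function.Injective (fun σ : Equiv.Perm ℕ => rr n * σ * rr n) := by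
    intro a b h
    simpa using h
  apply le_antisymm
  · refine Set.ncard_le_ncard_of_injOn _ (fun σ h => ?_) inj.injOn (fin.subset fun σ h => h.1)
    refine ⟨rr_mem n σ h.1, ?_⟩
    have e : σ (2 * n + 2) = 2 * k + 1 := h.2
    simp only [Equiv.Perm.mul_apply]
    rw [rr_apply n 1 (by omega) (by omega), show 2 * n + 3 - 1 = 2 * n + 2 by omega, e,
      rr_apply n _ (by omega) (by omega)]
    omega
  · refine Set.ncard_le_ncard_of_injOn _ (fun σ h => ?_) inj.injOn (fin.subset fun σ h => h.1)
    refine ⟨rr_mem n σ h.1, ?_⟩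
    have e : σ 1 = 2 * (n + 1 - k) := h.2
    simp only [Equiv.Perm.mul_apply]
    rw [rr_apply n (2 * n + 2) (by omega) (by omega), show 2 * n + 3 - (2 * n + 2) = 1 by omega, e,
      rr_apply n _ (by omega) (by omega)]
    omega

theorem sum_refl (n : ℕ) (f : ℕ → ℤ) :
    ∑ i ∈ Finset.Icc 1 n, f (n + 1 - i) = ∑ i ∈ Finset.Icc 1 n, f i := by
  apply Finset.sum_nbij' (fun i => n + 1 - i) (fun i => n + 1 - i)
  all_goals
    intro i hi
    simp only [Finset.mem_Icc] at hi ⊢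
    try omega

theorem stmt0
    (h : ℕ → ℕ → ℤ)
    (h11 : h 1 1 = 1)
    (hrow1 : ∀ m, 2 ≤ m → h m 1 = ∑ i ∈ Finset.Icc 1 (m - 1), h (m - 1) i)
    (hrow2 : ∀ m, 2 ≤ m → h m 2 = 2 * h m 1 - h (m - 1) 1)
    (hrec : ∀ m k, 2 ≤ m → 3 ≤ k → k ≤ m →
      h m k = 2 * h m (k - 1) - h m (k - 2) - h (m - 1) (k - 1) - h (m - 1) (k - 2))
    (n k : ℕ) (hn : 1 ≤ n) (hk : 1 ≤ k) (hkn : k ≤ n) :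
    ((PD2Nfirst n k).ncard : ℤ) = h n k ∧ ((PD2Nlast n k).ncard : ℤ) = h n k := by
  obtain ⟨n, rfl⟩ : ∃ m, n = m + 1 := ⟨n - 1, by omega⟩
  have p2 : (2 : ℤ) ^ n ≠ 0 := by positivity
  constructor
  · have a := uniq h h11 hrow1 hrow2 hrec DD DD11 R0 (fun n hn => by
      have a := R1 (n + 1) 1 le_rfl (by omega)
      have b := QQsum n 1 hn
      rw [RP1 (n + 1) (by omega), b] at a
      simp at a
      linarith) DDrec n k hk hkn
    rw [first_card (n + 1) k hk hkn, Nat.add_sub_cancel] at a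
    exact mul_left_cancel₀ p2 a
  · have a := uniq h h11 hrow1 hrow2 hrec (fun n k => DD n (n + 1 - k)) DD11 (fun n hn => by
      show DD (n + 1) (n + 1) = _
      rw [RQtop n hn, QQsum n n le_rfl]
      exact (sum_refl n (fun i => 2 * DD n i)).symm) (fun n hn => by
      show DD (n + 1) n = 2 * DD (n + 1) (n + 1) - 2 * DD n n
      have a := R1 (n + 1) n hn le_rfl
      have b := R2 n n hn le_rfl
      have c := PPsum n n le_rfl
      rw [R0 n hn] at c
      rw [← RQtop n hn] at a
      linarith) (fun n k h1 h2 => by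
      show DD (n + 1) (n + 1 + 1 - (k + 2)) = 2 * DD (n + 1) (n + 1 + 1 - (k + 1)) -
        DD (n + 1) (n + 1 + 1 - k) - 2 * DD n (n + 1 - (k + 1)) - 2 * DD n (n + 1 - k)
      have a := DDrec n (n - k) (by omega) (by omega)
      rw [show n + 1 + 1 - (k + 2) = n - k by omega, show n + 1 + 1 - (k + 1) = n - k + 1 by omega,
        show n + 1 + 1 - k = n - k + 2 by omega, show n + 1 - (k + 1) = n - k by omega,
        show n + 1 - k = n - k + 1 by omega]
      linarith) n k hk hkn
    rw [last_card (n + 1) k hk hkn]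
    change DD (n + 1) (n + 1 + 1 - k) = _ at a
    rw [first_card (n + 1) (n + 1 + 1 - k) (by omega) (by omega), Nat.add_sub_cancel] at a
    exact mul_left_cancel₀ p2 a
end

section
/- For every n ≥ 2, the map sending σ ∈ PD2N'_{n,n} to its restriction to [2n] is a bijection from PD2N'_{n,n} onto PD2N_{n−1}; in particular #PD2N'_{n,n} = #PD2N_{n−1}. -/
/-- The restriction to `[2n]` of a permutation `σ ∈ PD2N'_{n,n}` (which exchanges
`2n+1` and `2n+2`), encoded as a permutation of `ℕ`. -/
def restrictMap (n : ℕ) (σ : Equiv.Perm ℕ) : Equiv.Perm ℕ :=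
  σ * Equiv.swap (2 * n + 1) (2 * n + 2)

theorem aux_le (N : ℕ) (σ : Equiv.Perm ℕ) (h : ∀ x, x < 1 ∨ N < x → σ x = x) (x : ℕ) (hx : x ≤ N) :
    σ x ≤ N := by
  by_contra hc
  have h1 := h (σ x) (by omega)
  have := σ.injective h1
  omega

theorem aux_le_symm (N : ℕ) (σ : Equiv.Perm ℕ) (h : ∀ x, x < 1 ∨ N < x → σ x = x) (x : ℕ)
    (hx : x ≤ N) : σ.symm x ≤ N := by
  apply aux_le N σ.symm _ x hx
  intro y hy
  rw [Equiv.symm_apply_eq, h y hy]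

theorem aux_top (n : ℕ) (σ : Equiv.Perm ℕ) (h : σ ∈ PD2Nlast n n) : σ (2 * n + 1) = 2 * n + 2 := by
  obtain ⟨⟨h1, h2, h3⟩, h4⟩ := h
  have := aux_le (2 * n + 2) σ h1 (2 * n + 1) (by omega)
  have h5 := (h2 (n + 1) (by omega) (by omega)).1
  rw [show 2 * (n + 1) - 1 = 2 * n + 1 by omega] at h5
  omega

theorem aux_r (n : ℕ) (σ : Equiv.Perm ℕ) (x : ℕ) (h1 : x ≠ 2 * n + 1) (h2 : x ≠ 2 * n + 2) :
    restrictMap n σ x = σ x := by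
  simp [restrictMap, Equiv.swap_apply_of_ne_of_ne h1 h2]

theorem aux_r1 (n : ℕ) (σ : Equiv.Perm ℕ) : restrictMap n σ (2 * n + 1) = σ (2 * n + 2) := by
  simp [restrictMap]

theorem aux_r2 (n : ℕ) (σ : Equiv.Perm ℕ) : restrictMap n σ (2 * n + 2) = σ (2 * n + 1) := by
  simp [restrictMap]

theorem aux_rr (n : ℕ) (σ : Equiv.Perm ℕ) : restrictMap n (restrictMap n σ) = σ := by
  simp [restrictMap, mul_assoc]

theorem aux_fix (n : ℕ) (σ : Equiv.Perm ℕ) (h : σ ∈ PD2Nlast n n) (x : ℕ)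
    (hx : x < 1 ∨ 2 * n < x) : restrictMap n σ x = x := by
  by_cases e1 : x = 2 * n + 1
  · rw [e1, aux_r1, h.2]
  by_cases e2 : x = 2 * n + 2
  · rw [e2, aux_r2, aux_top n σ h]
  rw [aux_r n σ x e1 e2]
  exact h.1.1 x (by omega)

theorem aux_symm (n : ℕ) (σ : Equiv.Perm ℕ) (x : ℕ) (h : σ.symm x ≤ 2 * n) :
    (restrictMap n σ).symm x = σ.symm x := by
  rw [Equiv.symm_apply_eq, aux_r n σ _ (by omega) (by omega), Equiv.apply_symm_apply]

theorem aux_maps (m : ℕ) (σ : Equiv.Perm ℕ) (h : σ ∈ PD2Nlast (m + 1) (m + 1)) :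
    restrictMap (m + 1) σ ∈ PD2N m := by
  have hf := aux_fix _ σ h
  refine ⟨fun x hx => hf x (by omega), ?_, ?_⟩
  · intro i h1 h2
    rw [aux_r _ _ _ (by omega) (by omega), aux_r _ _ _ (by omega) (by omega)]
    exact h.1.2.1 i h1 (by omega)
  · intro i h1 h2
    have a := aux_le_symm _ _ hf (2 * i) (by omega)
    have b := aux_le_symm _ _ hf (2 * i + 1) (by omega)
    rw [← aux_symm _ _ _ a, ← aux_symm _ _ _ b, aux_rr]
    exact h.1.2.2 i h1 (by omega)

theorem aux_inv (m : ℕ) (σ : Equiv.Perm ℕ) (h : σ ∈ PD2N m) :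
    restrictMap (m + 1) σ ∈ PD2Nlast (m + 1) (m + 1) := by
  obtain ⟨h1, h2, h3⟩ := h
  have t1 : restrictMap (m + 1) σ (2 * (m + 1) + 1) = 2 * (m + 1) + 2 := by
    rw [aux_r1, h1 _ (by omega)]
  have t2 : restrictMap (m + 1) σ (2 * (m + 1) + 2) = 2 * (m + 1) + 1 := by
    rw [aux_r2, h1 _ (by omega)]
  refine ⟨⟨?_, ?_, ?_⟩, t2⟩
  · intro x hx
    rw [aux_r _ _ _ (by omega) (by omega), h1 x (by omega)]
  · intro i hi hi'
    by_cases e : i = m + 1 + 1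
    · subst e
      rw [show 2 * (m + 1 + 1) - 1 = 2 * (m + 1) + 1 by omega,
        show 2 * (m + 1 + 1) = 2 * (m + 1) + 2 by omega, t1, t2]
      omega
    · rw [aux_r _ _ _ (by omega) (by omega), aux_r _ _ _ (by omega) (by omega)]
      exact h2 i hi (by omega)
  · intro i hi hi'
    have a := aux_le_symm _ _ h1 (2 * i) (by omega)
    rw [aux_symm _ _ _ (by omega)]
    by_cases e : i = m + 1
    · subst e
      rw [(Equiv.symm_apply_eq _).2 t2.symm]
      omega
    · have b := aux_le_symm _ _ h1 (2 * i + 1) (by omega)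
      rw [aux_symm _ _ _ (by omega)]
      exact h3 i hi (by omega)

theorem stmt1 (n : ℕ) (hn : 2 ≤ n) :
    (∀ σ ∈ PD2Nlast n n, (∀ x, 1 ≤ x → x ≤ 2 * n → restrictMap n σ x = σ x) ∧
      (∀ x, x < 1 ∨ 2 * n < x → restrictMap n σ x = x)) ∧
    Set.BijOn (restrictMap n) (PD2Nlast n n) (PD2N (n - 1)) ∧
    (PD2Nlast n n).ncard = (PD2N (n - 1)).ncard := by
  obtain ⟨m, rfl⟩ : ∃ m, n = m + 1 := ⟨n - 1, by omega⟩
  have hb : Set.BijOn (restrictMap (m + 1)) (PD2Nlast (m + 1) (m + 1)) (PD2N (m + 1 - 1)) := by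
    refine ⟨fun σ h => aux_maps m σ h, ?_, fun τ h => ⟨_, aux_inv m τ h, aux_rr _ _⟩⟩
    intro a _ b _ hab
    rw [← aux_rr (m + 1) a, hab, aux_rr]
  refine ⟨fun σ h => ⟨fun x _ hx => aux_r _ _ _ (by omega) (by omega), aux_fix _ σ h⟩, hb, ?_⟩
  rw [← hb.image_eq, Set.ncard_image_of_injOn hb.injOn]
end

section
/- For every n ≥ 1, the map σ ↦ σ^t is an involution of PD2N_n, and for all k, l ∈ [n] it restricts to a bijection from PD2N_{n,k} ∩ PD2N'_{n,l} onto PD2N_{n,l} ∩ PD2N'_{n,k}. Here, for σ ∈ PD2N_n with σ(1) = 2k and σ(2n+2) = 2l+1: if k = l then σ^t = σ, and if k ≠ l then σ^t is the composition of σ with the 4-cycle (2k, 2l, 2l+1, 2k+1) applied on the left. -/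
/-- The map σ ↦ σ^t : with `k, l` determined by `σ(1) = 2k` and `σ(2n+2) = 2l+1`,
if `k = l` then `σ^t = σ`, and otherwise `σ^t` is the composition of the 4-cycle
`(2k, 2l, 2l+1, 2k+1)` (applied on the left) with `σ`. -/
def tPerm (n : ℕ) (σ : Equiv.Perm ℕ) : Equiv.Perm ℕ :=
  let k := σ 1 / 2
  let l := (σ (2 * n + 2) - 1) / 2
  if k = l then σ
  else [2 * k, 2 * l, 2 * l + 1, 2 * k + 1].formPerm * σ

def cyc (k l x : ℕ) : ℕ :=
  if x = 2 * k then 2 * l else if x = 2 * l then 2 * l + 1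
  else if x = 2 * l + 1 then 2 * k + 1 else if x = 2 * k + 1 then 2 * k else x

theorem cyc_form (k l : ℕ) (h : k ≠ l) (x : ℕ) :
    [2 * k, 2 * l, 2 * l + 1, 2 * k + 1].formPerm x = cyc k l x := by
  simp only [List.formPerm_cons_cons, List.formPerm_singleton, mul_one, Equiv.Perm.mul_apply,
    Equiv.swap_apply_def, cyc]
  split_ifs <;> omega

theorem cyc_cyc (k l : ℕ) (h : k ≠ l) (x : ℕ) : cyc k l (cyc l k x) = x := by
  unfold cyc
  split_ifs <;> omega

theorem PD2N_ends {n : ℕ} (hn : 1 ≤ n) {σ : Equiv.Perm ℕ} (h : σ ∈ PD2N n) :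
    ∃ k l, 1 ≤ k ∧ k ≤ n ∧ 1 ≤ l ∧ l ≤ n ∧ σ 1 = 2 * k ∧ σ (2 * n + 2) = 2 * l + 1 := by
  obtain ⟨h1, h2, h3⟩ := h
  have fix : ∀ x, σ x < 1 ∨ 2 * n + 2 < σ x → σ x = x := fun x hx =>
    σ.injective (h1 _ hx)
  have a1 := (h2 1 le_rfl (by omega)).1
  have a2 := (h2 1 le_rfl (by omega)).2
  have b1 := (h2 (n+1) (by omega) (by omega)).1
  have b2 := (h2 (n+1) (by omega) (by omega)).2
  rw [show 2 * 1 - 1 = 1 from rfl] at a1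
  rw [show 2 * (n + 1) - 1 = 2 * n + 1 by omega] at b1
  rw [show 2 * (n + 1) = 2 * n + 2 by omega] at b2
  have f1 := fix 1
  have f2 := fix 2
  have f3 := fix (2 * n + 1)
  have f4 := fix (2 * n + 2)
  have n1 : σ 1 ≠ σ (2 * n + 1) := fun e => by have := σ.injective e; omega
  have n2 : σ 2 ≠ σ (2 * n + 2) := fun e => by have := σ.injective e; omega
  norm_num at a2
  refine ⟨σ 1 / 2, σ (2 * n + 2) / 2, by omega, by omega, by omega, by omega, ?_, ?_⟩
  · by_contra hc
    have h := h3 (σ 1 / 2) (by omega) (by omega)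
    rw [show 2 * (σ 1 / 2) + 1 = σ 1 by omega, Equiv.symm_apply_apply] at h
    have h0 : σ.symm (2 * (σ 1 / 2)) = 0 := by omega
    rw [Equiv.symm_apply_eq, h1 0 (by omega)] at h0
    omega
  · by_contra hc
    have h := h3 (σ (2 * n + 2) / 2) (by omega) (by omega)
    rw [show 2 * (σ (2 * n + 2) / 2) = σ (2 * n + 2) by omega, Equiv.symm_apply_apply] at h
    have h0 := h1 _ (Or.inr h)
    rw [Equiv.apply_symm_apply] at h0
    omega

theorem tPerm_main {n : ℕ} {σ : Equiv.Perm ℕ} (h : σ ∈ PD2N n) {k l : ℕ}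
    (hk : 1 ≤ k) (hkn : k ≤ n) (hl : 1 ≤ l) (hln : l ≤ n)
    (e1 : σ 1 = 2 * k) (e2 : σ (2 * n + 2) = 2 * l + 1) :
    tPerm n σ ∈ PD2N n ∧ tPerm n σ 1 = 2 * l ∧ tPerm n σ (2 * n + 2) = 2 * k + 1 ∧
      tPerm n (tPerm n σ) = σ := by
  have key : ∀ (τ : Equiv.Perm ℕ) (k l : ℕ), τ 1 = 2 * k → τ (2 * n + 2) = 2 * l + 1 →
      tPerm n τ = if k = l then τ else [2 * k, 2 * l, 2 * l + 1, 2 * k + 1].formPerm * τ := by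
    intro τ k l h1 h2
    unfold tPerm
    rw [h1, h2, show 2 * k / 2 = k by omega, show (2 * l + 1 - 1) / 2 = l by omega]
  by_cases hkl : k = l
  · subst hkl
    have ht : tPerm n σ = σ := by rw [key σ k k e1 e2, if_pos rfl]
    rw [ht, ht]
    exact ⟨h, e1, e2, rfl⟩
  have ht := key σ k l e1 e2
  rw [if_neg hkl] at ht
  have app : ∀ x, tPerm n σ x = cyc k l (σ x) := fun x => by
    rw [ht, Equiv.Perm.mul_apply, cyc_form k l hkl]
  have t1 : tPerm n σ 1 = 2 * l := by rw [app, e1]; simp [cyc]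
  have t2 : tPerm n σ (2 * n + 2) = 2 * k + 1 := by
    rw [app, e2]; unfold cyc; split_ifs <;> omega
  have sy : ∀ x, (tPerm n σ).symm x = σ.symm (cyc l k x) := fun x => by
    rw [Equiv.symm_apply_eq, app, Equiv.apply_symm_apply, cyc_cyc k l hkl]
  refine ⟨?_, t1, t2, ?_⟩
  · obtain ⟨h1, h2, h3⟩ := h
    have s1 : σ.symm (2 * k) = 1 := by rw [Equiv.symm_apply_eq, e1]
    have s2 : σ.symm (2 * l + 1) = 2 * n + 2 := by rw [Equiv.symm_apply_eq, e2]
    refine ⟨?_, ?_, ?_⟩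
    · intro x hx
      rw [app, h1 x hx]; unfold cyc; split_ifs <;> omega
    · intro i hi hi'
      obtain ⟨u, v⟩ := h2 i hi hi'
      rw [app, app]
      constructor
      · by_cases hq : σ (2 * i - 1) = 2 * l + 1
        · have := σ.injective (hq.trans e2.symm); omega
        by_cases hq : σ (2 * i - 1) = 2 * k
        · have := σ.injective (hq.trans e1.symm)
          unfold cyc; split_ifs <;> omega
        unfold cyc; split_ifs <;> omega
      · by_cases hq : σ (2 * i) = 2 * k
        · have := σ.injective (hq.trans e1.symm); omega
        by_cases hq : σ (2 * i) = 2 * l + 1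
        · have := σ.injective (hq.trans e2.symm)
          unfold cyc; split_ifs <;> omega
        unfold cyc; split_ifs <;> omega
    · intro i hi hi'
      rw [sy, sy]
      have pos : ∀ x, 1 ≤ x → x ≤ 2 * n + 2 → 1 ≤ σ.symm x ∧ σ.symm x ≤ 2 * n + 2 := by
        intro x hx hx'
        by_contra hc
        have := h1 (σ.symm x) (by omega)
        rw [Equiv.apply_symm_apply] at this
        omega
      by_cases hik : i = k
      · subst hik
        have c1 : cyc l i (2 * i) = 2 * i + 1 := by unfold cyc; split_ifs <;> omega
        have c2 : cyc l i (2 * i + 1) = 2 * l + 1 := by unfold cyc; split_ifs <;> omega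
        rw [c1, c2, s2]
        have := pos (2 * i + 1) (by omega) (by omega)
        have hne : σ.symm (2 * i + 1) ≠ 2 * n + 2 := by
          rw [← s2]; intro e; have := σ.symm.injective e; omega
        omega
      by_cases hil : i = l
      · subst hil
        have c1 : cyc i k (2 * i) = 2 * k := by unfold cyc; split_ifs <;> omega
        have c2 : cyc i k (2 * i + 1) = 2 * i := by unfold cyc; split_ifs <;> omega
        rw [c1, c2, s1]
        have := pos (2 * i) (by omega) (by omega)
        have hne : σ.symm (2 * i) ≠ 1 := by
          rw [← s1]; intro e; have := σ.symm.injective e; omega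
        omega
      have c1 : cyc l k (2 * i) = 2 * i := by unfold cyc; split_ifs <;> omega
      have c2 : cyc l k (2 * i + 1) = 2 * i + 1 := by unfold cyc; split_ifs <;> omega
      rw [c1, c2]
      exact h3 i hi hi'
  · ext x
    rw [key _ l k t1 t2, if_neg (Ne.symm hkl), Equiv.Perm.mul_apply, cyc_form l k (Ne.symm hkl),
      app, cyc_cyc l k (Ne.symm hkl)]

theorem stmt2 (n : ℕ) (hn : 1 ≤ n) :
    (∀ σ ∈ PD2N n, tPerm n σ ∈ PD2N n ∧ tPerm n (tPerm n σ) = σ) ∧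
    (∀ k l, 1 ≤ k → k ≤ n → 1 ≤ l → l ≤ n →
      Set.BijOn (tPerm n) (PD2Nfirst n k ∩ PD2Nlast n l)
        (PD2Nfirst n l ∩ PD2Nlast n k)) := by
  constructor
  · intro σ h
    obtain ⟨k, l, hk, hkn, hl, hln, e1, e2⟩ := PD2N_ends hn h
    have := tPerm_main h hk hkn hl hln e1 e2
    exact ⟨this.1, this.2.2.2⟩
  · intro k l hk hkn hl hln
    refine ⟨?_, ?_, ?_⟩
    · rintro σ ⟨⟨h, e1⟩, _, e2⟩
      have := tPerm_main h hk hkn hl hln e1 e2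
      exact ⟨⟨this.1, this.2.1⟩, this.1, this.2.2.1⟩
    · rintro σ ⟨⟨h, e1⟩, _, e2⟩ τ ⟨⟨h', e1'⟩, _, e2'⟩ e
      have a := (tPerm_main h hk hkn hl hln e1 e2).2.2.2
      have b := (tPerm_main h' hk hkn hl hln e1' e2').2.2.2
      rw [← a, ← b, e]
    · rintro σ ⟨⟨h, e1⟩, _, e2⟩
      have := tPerm_main h hl hln hk hkn e1 e2
      exact ⟨tPerm n σ, ⟨⟨this.1, this.2.1⟩, this.1, this.2.2.1⟩, this.2.2.2⟩
end

section
/- For every n ≥ 1, the map σ ↦ σ^r defined by σ^r(i) = 2n+3 − σ(2n+3−i) for all i ∈ [2n+2] is an involution of PD2N_n, and for all k, l ∈ [n] it restricts to a bijection from PD2N_{n,l} ∩ PD2N'_{n,k} onto PD2N_{n,n−k+1} ∩ PD2N'_{n,n+1−l}. -/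
/-- The involution of `ℕ` reversing the interval `[1, m]` (`x ↦ m + 1 - x` there). -/
def revInvol (m : ℕ) : Equiv.Perm ℕ :=
  Function.Involutive.toPerm (fun x => if 1 ≤ x ∧ x ≤ m then m + 1 - x else x)
    (fun x => by dsimp only; split_ifs <;> omega)

/-- The map σ ↦ σ^r, satisfying σ^r(i) = 2n+3 − σ(2n+3−i) for all i ∈ [2n+2]. -/
def rPerm (n : ℕ) (σ : Equiv.Perm ℕ) : Equiv.Perm ℕ :=
  revInvol (2 * n + 2) * σ * revInvol (2 * n + 2)

theorem revInvol_in {m x : ℕ} (h1 : 1 ≤ x) (h2 : x ≤ m) : revInvol m x = m + 1 - x := by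
  show (if 1 ≤ x ∧ x ≤ m then m + 1 - x else x) = _
  rw [if_pos ⟨h1, h2⟩]

theorem revInvol_out {m x : ℕ} (h : x < 1 ∨ m < x) : revInvol m x = x := by
  show (if 1 ≤ x ∧ x ≤ m then m + 1 - x else x) = _
  rw [if_neg (by omega)]

theorem revInvol_mul_self (m : ℕ) : revInvol m * revInvol m = 1 := by
  ext x
  show (revInvol m) (revInvol m x) = x
  exact (revInvol m).symm_apply_apply x

theorem rPerm_rPerm (n : ℕ) (σ : Equiv.Perm ℕ) : rPerm n (rPerm n σ) = σ := by
  unfold rPerm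
  have h := revInvol_mul_self (2 * n + 2)
  calc _ = (revInvol (2 * n + 2) * revInvol (2 * n + 2)) * σ *
        (revInvol (2 * n + 2) * revInvol (2 * n + 2)) := by simp only [mul_assoc]
    _ = σ := by rw [h]; simp

theorem rPerm_app (n : ℕ) (σ : Equiv.Perm ℕ) (x : ℕ) :
    rPerm n σ x = revInvol (2 * n + 2) (σ (revInvol (2 * n + 2) x)) := rfl

theorem rPerm_symm_app (n : ℕ) (σ : Equiv.Perm ℕ) (x : ℕ) :
    (rPerm n σ).symm x = revInvol (2 * n + 2) (σ.symm (revInvol (2 * n + 2) x)) := rfl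

theorem bnd {m : ℕ} {σ : Equiv.Perm ℕ} (h : ∀ x, x < 1 ∨ m < x → σ x = x) {x : ℕ}
    (h1 : 1 ≤ x) (h2 : x ≤ m) : 1 ≤ σ x ∧ σ x ≤ m := by
  by_contra hc
  have h3 := σ.injective (h (σ x) (by omega))
  omega

theorem bnd_symm {m : ℕ} {σ : Equiv.Perm ℕ} (h : ∀ x, x < 1 ∨ m < x → σ x = x) {x : ℕ}
    (h1 : 1 ≤ x) (h2 : x ≤ m) : 1 ≤ σ.symm x ∧ σ.symm x ≤ m := by
  by_contra hc
  have h3 := h (σ.symm x) (by omega)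
  rw [Equiv.apply_symm_apply] at h3
  omega

theorem rPerm_in {n : ℕ} {σ : Equiv.Perm ℕ} (h : ∀ x, x < 1 ∨ 2 * n + 2 < x → σ x = x) {x : ℕ}
    (h1 : 1 ≤ x) (h2 : x ≤ 2 * n + 2) : rPerm n σ x = 2 * n + 3 - σ (2 * n + 3 - x) := by
  have hb := bnd h (x := 2 * n + 3 - x) (by omega) (by omega)
  rw [rPerm_app, revInvol_in h1 h2, revInvol_in hb.1 hb.2]

theorem rPerm_symm_in {n : ℕ} {σ : Equiv.Perm ℕ}
    (h : ∀ x, x < 1 ∨ 2 * n + 2 < x → σ x = x) {x : ℕ}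
    (h1 : 1 ≤ x) (h2 : x ≤ 2 * n + 2) :
    (rPerm n σ).symm x = 2 * n + 3 - σ.symm (2 * n + 3 - x) := by
  have hb := bnd_symm h (x := 2 * n + 3 - x) (by omega) (by omega)
  rw [rPerm_symm_app, revInvol_in h1 h2, revInvol_in hb.1 hb.2]

theorem rPerm_mem {n : ℕ} {σ : Equiv.Perm ℕ} (hσ : σ ∈ PD2N n) : rPerm n σ ∈ PD2N n := by
  obtain ⟨h, h2, h3⟩ := hσ
  refine ⟨fun x hx => ?_, fun i hi hi' => ?_, fun i hi hi' => ?_⟩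
  · rw [rPerm_app, revInvol_out hx, h x hx, revInvol_out hx]
  · rw [rPerm_in h (by omega) (by omega), rPerm_in h (by omega) (by omega)]
    have h4 := h2 (n + 2 - i) (by omega) (by omega)
    have e1 : 2 * n + 3 - (2 * i - 1) = 2 * (n + 2 - i) := by omega
    have e2 : 2 * n + 3 - 2 * i = 2 * (n + 2 - i) - 1 := by omega
    rw [e1, e2]
    omega
  · rw [rPerm_symm_in h (by omega) (by omega), rPerm_symm_in h (by omega) (by omega)]
    have h4 := h3 (n + 1 - i) (by omega) (by omega)
    have e1 : 2 * n + 3 - (2 * i + 1) = 2 * (n + 1 - i) := by omega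
    have e2 : 2 * n + 3 - 2 * i = 2 * (n + 1 - i) + 1 := by omega
    have b := bnd_symm h (x := 2 * (n + 1 - i) + 1) (by omega) (by omega)
    rw [e1, e2]
    omega

theorem rPerm_mapsTo (n k l : ℕ) (hk : 1 ≤ k) (hk' : k ≤ n) (hl : 1 ≤ l) (hl' : l ≤ n) :
    Set.MapsTo (rPerm n) (PD2Nfirst n l ∩ PD2Nlast n k)
        (PD2Nfirst n (n - k + 1) ∩ PD2Nlast n (n + 1 - l)) := by
  rintro σ ⟨⟨hσ, h1⟩, ⟨_, h2⟩⟩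
  have e1 : 2 * n + 3 - 1 = 2 * n + 2 := by omega
  have e2 : 2 * n + 3 - (2 * n + 2) = 1 := by omega
  refine ⟨⟨rPerm_mem hσ, ?_⟩, ⟨rPerm_mem hσ, ?_⟩⟩
  · rw [rPerm_in hσ.1 (by omega) (by omega), e1, h2]; omega
  · rw [rPerm_in hσ.1 (by omega) (by omega), e2, h1]; omega

theorem stmt3 (n : ℕ) (hn : 1 ≤ n) :
    (∀ σ ∈ PD2N n, ∀ i, 1 ≤ i → i ≤ 2 * n + 2 →
      rPerm n σ i = 2 * n + 3 - σ (2 * n + 3 - i)) ∧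
    (∀ σ ∈ PD2N n, rPerm n σ ∈ PD2N n ∧ rPerm n (rPerm n σ) = σ) ∧
    (∀ k l, 1 ≤ k → k ≤ n → 1 ≤ l → l ≤ n →
      Set.BijOn (rPerm n) (PD2Nfirst n l ∩ PD2Nlast n k)
        (PD2Nfirst n (n - k + 1) ∩ PD2Nlast n (n + 1 - l))) := by
  refine ⟨fun σ hσ i h1 h2 => rPerm_in hσ.1 h1 h2,
    fun σ hσ => ⟨rPerm_mem hσ, rPerm_rPerm n σ⟩, fun k l hk hk' hl hl' => ?_⟩
  refine ⟨rPerm_mapsTo n k l hk hk' hl hl', fun a _ b _ hab => ?_, fun τ hτ => ?_⟩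
  · rw [← rPerm_rPerm n a, hab, rPerm_rPerm]
  · refine ⟨rPerm n τ, ?_, rPerm_rPerm n τ⟩
    have h := rPerm_mapsTo n (n + 1 - l) (n - k + 1) (by omega) (by omega) (by omega) (by omega) hτ
    have e1 : n - (n + 1 - l) + 1 = l := by omega
    have e2 : n + 1 - (n - k + 1) = k := by omega
    rwa [e1, e2] at h
end

section
/- For every n ≥ 1 and every k ∈ [n], the Kreweras triangle satisfies the symmetry h_{n,k} = h_{n,n−k+1}. -/
theorem stmt4
    (h : ℕ → ℕ → ℤ)
    (h11 : h 1 1 = 1)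
    (hrow1 : ∀ m, 2 ≤ m → h m 1 = ∑ i ∈ Finset.Icc 1 (m - 1), h (m - 1) i)
    (hrow2 : ∀ m, 2 ≤ m → h m 2 = 2 * h m 1 - h (m - 1) 1)
    (hrec : ∀ m k, 2 ≤ m → 3 ≤ k → k ≤ m →
      h m k = 2 * h m (k - 1) - h m (k - 2) - h (m - 1) (k - 1) - h (m - 1) (k - 2))
    (n k : ℕ) (hn : 1 ≤ n) (hk : 1 ≤ k) (hkn : k ≤ n) :
    h n k = h n (n - k + 1) := by
  obtain ⟨P, hP⟩ : ∃ P : ℕ → ℕ → ℤ, ∀ m k, P m k = ∑ i ∈ Finset.range k, h m (i + 1) :=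
    ⟨_, fun _ _ => rfl⟩
  have P0 : ∀ m, P m 0 = 0 := fun m => by simp [hP]
  have PS : ∀ m k, P m (k + 1) = P m k + h m (k + 1) := fun m k => by
    simp [hP, Finset.sum_range_succ]
  have R1 : ∀ m, 1 ≤ m → h (m + 1) 1 = P m m := fun m hm => by
    rw [hrow1 (m + 1) (by omega), hP, Finset.range_eq_Ico, Finset.sum_Ico_add' (fun i => h m i)]
    rfl
  have D : ∀ m, 1 ≤ m → ∀ j, j + 1 ≤ m →
      h (m + 1) (j + 2) - h (m + 1) (j + 1) = P m m - P m (j + 1) - P m j := by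
    intro m hm j
    induction j with
    | zero =>
      intro _
      have h1 := hrow2 (m + 1) (by omega)
      have h2 := R1 m hm
      have h3 := PS m 0
      have h4 := P0 m
      simp only [Nat.add_sub_cancel, Nat.zero_add] at *
      linarith
    | succ j ih =>
      intro hj
      have h1 := hrec (m + 1) (j + 3) (by omega) (by omega) (by omega)
      have h2 := ih (by omega)
      have h3 := PS m j
      have h4 := PS m (j + 1)
      have e1 : j + 3 - 1 = j + 2 := rfl
      have e2 : j + 3 - 2 = j + 1 := rfl
      rw [e1, e2, Nat.add_sub_cancel] at h1
      have e3 : j + 1 + 1 = j + 2 := rfl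
      have e4 : j + 1 + 2 = j + 3 := rfl
      simp only [e3, e4] at *
      linarith
  have main : ∀ m, ∀ a b, a + b = m → h (m + 1) (a + 1) = h (m + 1) (b + 1) := by
    intro m
    induction m with
    | zero =>
      intro a b hab
      obtain rfl : a = 0 := by omega
      obtain rfl : b = 0 := by omega
      rfl
    | succ m ih =>
      have B : ∀ a b, a + b = m + 1 → P (m + 1) (m + 1) = P (m + 1) a + P (m + 1) b := by
        intro a
        induction a with
        | zero =>
          intro b hb
          obtain rfl : b = m + 1 := by omega
          simp [P0]
        | succ a iha =>
          intro b hb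
          have h1 := iha (b + 1) (by omega)
          have h2 := ih a b (by omega)
          have h3 := PS (m + 1) a
          have h4 := PS (m + 1) b
          linarith
      have C : ∀ a b, a + b = m + 1 → h (m + 1 + 1) (a + 1) - h (m + 1 + 1) (b + 1)
          = h (m + 1 + 1) 1 - h (m + 1 + 1) (m + 1 + 1) := by
        intro a
        induction a with
        | zero =>
          intro b hb
          obtain rfl : b = m + 1 := by omega
          rfl
        | succ a iha =>
          intro b hb
          have h1 := iha (b + 1) (by omega)
          have h2 := D (m + 1) (by omega) a (by omega)
          have h3 := D (m + 1) (by omega) b (by omega)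
          have h4 := B (a + 1) b (by omega)
          have h5 := B a (b + 1) (by omega)
          have e3 : a + 1 + 1 = a + 2 := rfl
          have e4 : b + 1 + 1 = b + 2 := rfl
          rw [e4] at h1
          rw [e3]
          linarith
      intro a b hab
      have h1 := C a b hab
      have h2 := C b a (by omega)
      linarith
  have := main (n - 1) (k - 1) (n - k) (by omega)
  rwa [Nat.sub_add_cancel hn, Nat.sub_add_cancel hk] at this
end

section
/- For every n ≥ 2, the Kreweras triangle satisfies h_{n,n} = Σ_{k=1}^{n−1} h_{n−1,k}; equivalently, h_{n,n} = h_{n,1}. -/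
theorem kre_sym (a b : ℕ → ℤ) (N : ℕ) (ha : ∀ i j, i + j + 1 = N → a i = a j)
    (hb : ∀ k, k < N → b (k+1) - b k = (∑ i ∈ Finset.range N, a i)
      - (∑ i ∈ Finset.range (k+1), a i) - (∑ i ∈ Finset.range k, a i)) :
    ∀ i j, i + j = N → b i = b j := by
  have hP : ∀ k l, k + l = N → (∑ i ∈ Finset.range k, a i) + (∑ i ∈ Finset.range l, a i)
      = ∑ i ∈ Finset.range N, a i := by
    intro k
    induction k with
    | zero => intro l hl; have : l = N := by omega
              subst this; simp
    | succ k ih =>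
      intro l hl
      have h1 := ih (l+1) (by omega)
      rw [Finset.sum_range_succ] at h1 ⊢
      have := ha k l (by omega)
      linarith
  have hd : ∀ i j, i + j = N → b i - b j = b 0 - b N := by
    intro i
    induction i with
    | zero => intro j hj; have : j = N := by omega
              subst this; rfl
    | succ i ih =>
      intro j hj
      have h1 := ih (j+1) (by omega)
      have h2 := hb i (by omega)
      have h3 := hb j (by omega)
      have h4 := hP i (j+1) (by omega)
      have h5 := hP (i+1) j (by omega)
      linarith
  intro i j hij
  have h1 := hd i j hij
  have h2 := hd N 0 (by omega)
  linarith

theorem kre_sum (f : ℕ → ℤ) (N : ℕ) :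
    ∑ i ∈ Finset.Icc 1 N, f i = ∑ i ∈ Finset.range N, f (i+1) := by
  induction N with
  | zero => simp
  | succ N ih => rw [Finset.sum_Icc_succ_top (by omega), ih, Finset.sum_range_succ]

theorem stmt6
    (h : ℕ → ℕ → ℤ)
    (h11 : h 1 1 = 1)
    (hrow1 : ∀ m, 2 ≤ m → h m 1 = ∑ i ∈ Finset.Icc 1 (m - 1), h (m - 1) i)
    (hrow2 : ∀ m, 2 ≤ m → h m 2 = 2 * h m 1 - h (m - 1) 1)
    (hrec : ∀ m k, 2 ≤ m → 3 ≤ k → k ≤ m →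
      h m k = 2 * h m (k - 1) - h m (k - 2) - h (m - 1) (k - 1) - h (m - 1) (k - 2))
    (n : ℕ) (hn : 2 ≤ n) :
    h n n = (∑ k ∈ Finset.Icc 1 (n - 1), h (n - 1) k) ∧ h n n = h n 1 := by
  have key : ∀ N, ∀ i j, i + j = N → h (N+1) (i+1) = h (N+1) (j+1) := by
    intro N
    induction N with
    | zero => intro i j hij
              have h1 : i = 0 := by omega
              have h2 : j = 0 := by omega
              subst h1 h2; rfl
    | succ N ih =>
      apply kre_sym (fun i => h (N+1) (i+1)) (fun i => h (N+1+1) (i+1)) (N+1)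
      · intro i j hij
        exact ih i j (by omega)
      · intro k
        induction k with
        | zero =>
          intro _
          have h1 := hrow1 (N+2) (by omega)
          have h2 := hrow2 (N+2) (by omega)
          rw [kre_sum] at h1
          simp only [show N + 2 - 1 = N + 1 by omega] at h1 h2
          simp only [Finset.sum_range_one, Finset.sum_range_zero, zero_add, Nat.reduceAdd,
            show N + 1 + 1 = N + 2 by omega]
          linarith
        | succ k ihk =>
          intro hk
          have h1 := ihk (by omega)
          have h2 := hrec (N+2) (k+3) (by omega) (by omega) (by omega)
          simp only [show N + 2 - 1 = N + 1 by omega, show k + 3 - 1 = k + 2 by omega,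
            show k + 3 - 2 = k + 1 by omega] at h2
          rw [Finset.sum_range_succ _ (k+1)]
          rw [Finset.sum_range_succ _ k] at h1 ⊢
          simp only [show N + 1 + 1 = N + 2 by omega, show k + 1 + 1 = k + 2 by omega,
            show k + 2 + 1 = k + 3 by omega] at h1 ⊢
          linarith
  obtain ⟨m, rfl⟩ : ∃ m, n = m + 1 := ⟨n - 1, by omega⟩
  have h1 : h (m+1) (m+1) = h (m+1) 1 := key m m 0 (by omega)
  exact ⟨h1.trans (hrow1 _ hn), h1⟩
end

section
/- For every n ≥ 1 and all k, l ∈ [n], the map D ↦ D^t — obtained from D ∈ DC_{n,k} ∩ DC'_{n,l} by deleting the dots in the boxes (k, n+1) and (l, n) and placing dots in the boxes (l, n+1) and (k, n) — is a well-defined involution of DC_n that restricts to a bijection from DC_{n,k} ∩ DC'_{n,l} onto DC_{n,l} ∩ DC'_{n,k}. -/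
/-- `DC n` : Dellac configurations of size `n`, encoded as the finite set of the
positions `(j, i)` (column `j` from left to right, row `i` from bottom to top,
both 1-based) of the dots. Every row contains exactly one dot, every column
exactly two dots, and a dot in box `(j,i)` satisfies `j ≤ i ≤ j + n`. -/
def DC (n : ℕ) : Set (Finset (ℕ × ℕ)) :=
  {D | (∀ p ∈ D, 1 ≤ p.1 ∧ p.1 ≤ n ∧ p.1 ≤ p.2 ∧ p.2 ≤ p.1 + n) ∧
       (∀ i, 1 ≤ i → i ≤ 2 * n → (D.filter (fun p => p.2 = i)).card = 1) ∧
       (∀ j, 1 ≤ j → j ≤ n → (D.filter (fun p => p.1 = j)).card = 2)}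

/-- `DCup n k` : the Dellac configurations with a dot in box `(k, n+1)`. -/
def DCup (n k : ℕ) : Set (Finset (ℕ × ℕ)) := {D ∈ DC n | (k, n + 1) ∈ D}

/-- `DClow n l` : the Dellac configurations with a dot in box `(l, n)`. -/
def DClow (n l : ℕ) : Set (Finset (ℕ × ℕ)) := {D ∈ DC n | (l, n) ∈ D}

/-- The column of the (unique) dot of row `i` of `D`. -/
def colOf (D : Finset (ℕ × ℕ)) (i : ℕ) : ℕ :=
  D.sup (fun p => if p.2 = i then p.1 else 0)

/-- The map `D ↦ D^t` : with `k` (resp. `l`) the column of the dot of row `n+1`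
(resp. row `n`), delete the dots in boxes `(k, n+1)` and `(l, n)` and place dots
in boxes `(l, n+1)` and `(k, n)`. -/
def tMapD (n : ℕ) (D : Finset (ℕ × ℕ)) : Finset (ℕ × ℕ) :=
  ((D.erase (colOf D (n + 1), n + 1)).erase (colOf D n, n)) ∪
    {(colOf D n, n + 1), (colOf D (n + 1), n)}

theorem DC_row {n : ℕ} {D : Finset (ℕ × ℕ)} (hD : D ∈ DC n) {i : ℕ} (h1 : 1 ≤ i)
    (h2 : i ≤ 2 * n) : (colOf D i, i) ∈ D ∧ ∀ j, (j, i) ∈ D → j = colOf D i := by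
  obtain ⟨_, hr, _⟩ := hD
  obtain ⟨⟨a, b⟩, ha⟩ := Finset.card_eq_one.mp (hr i h1 h2)
  have hm : ∀ p : ℕ × ℕ, (p ∈ D ∧ p.2 = i) ↔ p = (a, b) := by
    intro p
    rw [← Finset.mem_filter (p := fun p : ℕ × ℕ => p.2 = i), ha, Finset.mem_singleton]
  obtain ⟨hab, hb⟩ := (hm (a, b)).2 rfl
  simp only at hb
  subst hb
  have hc : colOf D b = a := by
    unfold colOf
    apply le_antisymm
    · apply Finset.sup_le
      intro p hp
      split_ifs with h
      · rw [(hm p).1 ⟨hp, h⟩]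
      · exact Nat.zero_le _
    · have := Finset.le_sup (f := fun p : ℕ × ℕ => if p.2 = b then p.1 else 0) hab
      simpa using this
  rw [hc]
  refine ⟨hab, fun j hj => ?_⟩
  have := (hm (j, b)).1 ⟨hj, rfl⟩
  exact congrArg Prod.fst this

/-- exchange rows `n` and `n+1`. -/
def sig (n : ℕ) (p : ℕ × ℕ) : ℕ × ℕ := (p.1, Equiv.swap n (n + 1) p.2)

theorem sig_sig (n : ℕ) (p : ℕ × ℕ) : sig n (sig n p) = p := by
  simp [sig]

theorem mem_tMapD {n : ℕ} (hn : 1 ≤ n) {D : Finset (ℕ × ℕ)} (hD : D ∈ DC n) (p : ℕ × ℕ) :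
    p ∈ tMapD n D ↔ sig n p ∈ D := by
  obtain ⟨hk, hk'⟩ := DC_row hD (i := n + 1) (by omega) (by omega)
  obtain ⟨hl, hl'⟩ := DC_row hD (i := n) (by omega) (by omega)
  obtain ⟨j, i⟩ := p
  simp only [tMapD, sig, Finset.mem_union, Finset.mem_erase, Finset.mem_insert,
    Finset.mem_singleton, Prod.mk.injEq, ne_eq]
  generalize colOf D (n + 1) = k at *
  generalize colOf D n = l at *
  by_cases h1 : i = n
  · subst h1
    rw [Equiv.swap_apply_left]
    grind
  · by_cases h2 : i = n + 1
    · subst h2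
      rw [Equiv.swap_apply_right]
      grind
    · rw [Equiv.swap_apply_of_ne_of_ne h1 h2]
      grind

theorem tMapD_eq {n : ℕ} (hn : 1 ≤ n) {D : Finset (ℕ × ℕ)} (hD : D ∈ DC n) :
    tMapD n D = D.image (sig n) := by
  ext p
  rw [mem_tMapD hn hD, Finset.mem_image]
  constructor
  · intro h
    exact ⟨_, h, sig_sig n p⟩
  · rintro ⟨q, hq, rfl⟩
    rwa [sig_sig]

theorem sig_inj (n : ℕ) : Function.Injective (sig n) :=
  Function.LeftInverse.injective (sig_sig n)

theorem tMapD_mem {n : ℕ} (hn : 1 ≤ n) {D : Finset (ℕ × ℕ)} (hD : D ∈ DC n) :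
    tMapD n D ∈ DC n := by
  have e := tMapD_eq hn hD
  obtain ⟨hb, hr, hc⟩ := hD
  rw [e]
  refine ⟨?_, ?_, ?_⟩
  · intro p hp
    obtain ⟨⟨j, i⟩, hq, rfl⟩ := Finset.mem_image.mp hp
    have := hb _ hq
    simp only [sig, Equiv.swap_apply_def] at this ⊢
    split_ifs <;> omega
  · intro i h1 h2
    rw [Finset.filter_image, Finset.card_image_of_injective _ (sig_inj n)]
    rw [← hr (Equiv.swap n (n + 1) i)]
    · congr 1
      apply Finset.filter_congr
      intro p _
      simp only [sig]
      exact Equiv.apply_eq_iff_eq_symm_apply _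
    · rw [Equiv.swap_apply_def]; split_ifs <;> omega
    · rw [Equiv.swap_apply_def]; split_ifs <;> omega
  · intro j h1 h2
    rw [Finset.filter_image, Finset.card_image_of_injective _ (sig_inj n)]
    exact hc j h1 h2

theorem tMapD_invol {n : ℕ} (hn : 1 ≤ n) {D : Finset (ℕ × ℕ)} (hD : D ∈ DC n) :
    tMapD n (tMapD n D) = D := by
  ext p
  rw [mem_tMapD hn (tMapD_mem hn hD), mem_tMapD hn hD, sig_sig]

theorem tMapD_mapsTo {n : ℕ} (hn : 1 ≤ n) (k l : ℕ) :
    Set.MapsTo (tMapD n) (DCup n k ∩ DClow n l) (DCup n l ∩ DClow n k) := by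
  rintro D ⟨⟨hD, hk⟩, ⟨_, hl⟩⟩
  refine ⟨⟨tMapD_mem hn hD, ?_⟩, ⟨tMapD_mem hn hD, ?_⟩⟩
  · rw [mem_tMapD hn hD]; simpa [sig] using hl
  · rw [mem_tMapD hn hD]; simpa [sig] using hk

theorem stmt8 (n : ℕ) (hn : 1 ≤ n) :
    (∀ D ∈ DC n, tMapD n D ∈ DC n ∧ tMapD n (tMapD n D) = D) ∧
    (∀ k l, 1 ≤ k → k ≤ n → 1 ≤ l → l ≤ n →
      Set.BijOn (tMapD n) (DCup n k ∩ DClow n l) (DCup n l ∩ DClow n k)) := by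
  refine ⟨fun D hD => ⟨tMapD_mem hn hD, tMapD_invol hn hD⟩, fun k l _ _ _ _ => ?_⟩
  refine Set.InvOn.bijOn (f' := tMapD n) ⟨?_, ?_⟩ (tMapD_mapsTo hn k l) (tMapD_mapsTo hn l k)
  · exact fun D hD => tMapD_invol hn hD.1.1
  · exact fun D hD => tMapD_invol hn hD.1.1
end

section
/- For every n ≥ 1, the map D ↦ D^r obtained by rotating D through 180° (i.e., the dot set of D^r is {(n+1−j, 2n+1−i) : (j,i) a dot of D}) is an involution of DC_n, and for all k, l ∈ [n] it restricts to a bijection from DC_{n,k} ∩ DC'_{n,l} onto DC_{n,n+1−l} ∩ DC'_{n,n−k+1}. -/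
/-- The map `D ↦ D^r` : rotation of the configuration through 180°,
`(j, i) ↦ (n+1-j, 2n+1-i)` on the dots. -/
def rMapD (n : ℕ) (D : Finset (ℕ × ℕ)) : Finset (ℕ × ℕ) :=
  D.image (fun p => (n + 1 - p.1, 2 * n + 1 - p.2))

theorem rMapD_card_filter (n : ℕ) (D : Finset (ℕ × ℕ)) (hD : ∀ p ∈ D, 1 ≤ p.1 ∧ p.1 ≤ n ∧ p.1 ≤ p.2 ∧ p.2 ≤ p.1 + n)
    (P Q : ℕ × ℕ → Prop) [DecidablePred P] [DecidablePred Q]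
    (h : ∀ p ∈ D, P (n + 1 - p.1, 2 * n + 1 - p.2) ↔ Q p) :
    ((rMapD n D).filter P).card = (D.filter Q).card := by
  unfold rMapD
  rw [Finset.filter_image, Finset.card_image_of_injOn]
  · congr 1
    exact Finset.filter_congr h
  · rintro ⟨a, b⟩ ha ⟨c, d⟩ hc hac
    have h1 := hD _ (Finset.mem_filter.1 ha).1
    have h2 := hD _ (Finset.mem_filter.1 hc).1
    simp only [Prod.mk.injEq] at *
    omega

theorem rMapD_mem (n : ℕ) (D : Finset (ℕ × ℕ)) (hD : D ∈ DC n) : rMapD n D ∈ DC n := by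
  obtain ⟨h1, h2, h3⟩ := hD
  refine ⟨?_, ?_, ?_⟩
  · intro p hp
    obtain ⟨q, hq, rfl⟩ := Finset.mem_image.1 hp
    have := h1 q hq
    dsimp only
    omega
  · intro i hi hi'
    rw [← h2 (2 * n + 1 - i) (by omega) (by omega)]
    apply rMapD_card_filter n D h1
    intro p hp
    have := h1 p hp
    dsimp only
    omega
  · intro i hi hi'
    rw [← h3 (n + 1 - i) (by omega) (by omega)]
    apply rMapD_card_filter n D h1
    intro p hp
    have := h1 p hp
    dsimp only
    omega

theorem rMapD_invol (n : ℕ) (D : Finset (ℕ × ℕ)) (hD : D ∈ DC n) :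
    rMapD n (rMapD n D) = D := by
  obtain ⟨h1, -, -⟩ := hD
  unfold rMapD
  rw [Finset.image_image]
  conv_rhs => rw [← Finset.image_id (s := D)]
  apply Finset.image_congr
  rintro ⟨a, b⟩ hp
  have := h1 _ hp
  simp only [Function.comp, id, Prod.mk.injEq] at *
  omega

theorem rMapD_mapsTo (n k l : ℕ) (hk : 1 ≤ k) (hk' : k ≤ n) (hl : 1 ≤ l) (hl' : l ≤ n) :
    Set.MapsTo (rMapD n) (DCup n k ∩ DClow n l)
      (DCup n (n + 1 - l) ∩ DClow n (n - k + 1)) := by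
  rintro D ⟨⟨hD, h1⟩, ⟨-, h2⟩⟩
  refine ⟨⟨rMapD_mem n D hD, ?_⟩, ⟨rMapD_mem n D hD, ?_⟩⟩
  · refine Finset.mem_image.2 ⟨_, h2, Prod.ext ?_ ?_⟩ <;> dsimp only <;> omega
  · refine Finset.mem_image.2 ⟨_, h1, Prod.ext ?_ ?_⟩ <;> dsimp only <;> omega

theorem stmt9 (n : ℕ) (hn : 1 ≤ n) :
    (∀ D ∈ DC n, rMapD n D ∈ DC n ∧ rMapD n (rMapD n D) = D) ∧
    (∀ k l, 1 ≤ k → k ≤ n → 1 ≤ l → l ≤ n →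
      Set.BijOn (rMapD n) (DCup n k ∩ DClow n l)
        (DCup n (n + 1 - l) ∩ DClow n (n - k + 1))) := by
  refine ⟨fun D hD => ⟨rMapD_mem n D hD, rMapD_invol n D hD⟩, ?_⟩
  intro k l hk hk' hl hl'
  have hb := rMapD_mapsTo n (n + 1 - l) (n - k + 1) (by omega) (by omega) (by omega) (by omega)
  have e1 : n + 1 - (n - k + 1) = k := by omega
  have e2 : n - (n + 1 - l) + 1 = l := by omega
  rw [e1, e2] at hb
  exact Set.InvOn.bijOn (f' := rMapD n)
    ⟨fun D hD => rMapD_invol n D hD.1.1, fun D hD => rMapD_invol n D hD.1.1⟩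
    (rMapD_mapsTo n k l hk hk' hl hl') hb
end

section
/- For every n ≥ 1 and every k ∈ [n], #DC_{n,k} = #DC'_{n,k} = h_{n,k}; in particular #DC_n = Σ_{k=1}^n h_{n,k}. -/
namespace Kr
open MvPolynomial

noncomputable def e (n : ℕ) : ℕ →₀ ℕ := ∑ j ∈ Finset.range n, Finsupp.single j 2

lemma e_apply (n j : ℕ) : e n j = if j < n then 2 else 0 := by
  simp [e, Finsupp.finsetSum_apply, Finsupp.single_apply]

noncomputable def T (n : ℕ) : MvPolynomial ℕ ℤ →ₗ[ℤ] ℤ := MvPolynomial.lcoeff ℤ (e n)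

lemma T_apply (n : ℕ) (p : MvPolynomial ℕ ℤ) : T n p = coeff (e n) p := rfl

noncomputable def s (i : ℕ) : MvPolynomial ℕ ℤ := ∑ j ∈ Finset.range i, X j

lemma s_succ (i : ℕ) : s (i+1) = s i + X i := by
  simp [s, Finset.sum_range_succ]

lemma count (N n : ℕ) (V : ℕ → Finset ℕ) :
    (({D : Finset (ℕ × ℕ) | (∀ p ∈ D, (1 ≤ p.2 ∧ p.2 ≤ N) ∧ 1 ≤ p.1 ∧ p.1 ≤ n ∧ p.1 - 1 ∈ V p.2) ∧
       (∀ i, 1 ≤ i → i ≤ N → (D.filter (fun p => p.2 = i)).card = 1) ∧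
       (∀ j, 1 ≤ j → j ≤ n → (D.filter (fun p => p.1 = j)).card = 2)}.ncard : ℕ) : ℤ) =
    T n (∏ i ∈ Finset.Icc 1 N, ∑ j ∈ V i, X j) := by
  classical
  set I := {x // x ∈ Finset.Icc 1 N}
  have h1 : (∏ i ∈ Finset.Icc 1 N, ∑ j ∈ V i, (X j : MvPolynomial ℕ ℤ)) =
      ∑ φ ∈ Fintype.piFinset (fun i : I => V i.1), 
        monomial (∑ i : I, Finsupp.single (φ i) 1) (1:ℤ) := by
    rw [← Finset.prod_coe_sort]
    rw [Finset.prod_univ_sum]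
    refine Finset.sum_congr rfl fun φ _ => ?_
    rw [monomial_sum_one]
    rfl
  rw [h1, map_sum]
  simp only [T_apply, coeff_monomial]
  rw [Finset.sum_boole]
  norm_cast
  rw [← Set.ncard_coe_finset]
  let Φ : (I → ℕ) → Finset (ℕ × ℕ) := fun φ => Finset.univ.image (fun i : I => (φ i + 1, i.1))
  have hΦ : Function.Injective Φ := by
    intro φ ψ h
    funext i
    have : (φ i + 1, i.1) ∈ Φ ψ := by
      rw [← h]; exact Finset.mem_image_of_mem _ (Finset.mem_univ _)
    obtain ⟨k, -, hk⟩ := Finset.mem_image.1 this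
    have h2 := congrArg Prod.snd hk
    have h3 := congrArg Prod.fst hk
    simp only at h2 h3
    have : k = i := Subtype.ext h2
    subst this; omega
  have hrow : ∀ φ : I → ℕ, ∀ i, 1 ≤ i → i ≤ N → ((Φ φ).filter (fun p => p.2 = i)).card = 1 := by
    intro φ i hi hN
    rw [Finset.card_eq_one]
    refine ⟨(φ ⟨i, Finset.mem_Icc.2 ⟨hi, hN⟩⟩ + 1, i), ?_⟩
    ext p
    simp only [Φ, Finset.mem_filter, Finset.mem_image, Finset.mem_univ, true_and,
      Finset.mem_singleton]
    constructor
    · rintro ⟨⟨k, rfl⟩, rfl⟩; rfl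
    · rintro rfl; exact ⟨⟨_, rfl⟩, rfl⟩
  have hcol : ∀ φ : I → ℕ, ∀ c, ((Φ φ).filter (fun p => p.1 = c + 1)).card =
      (∑ i : I, Finsupp.single (φ i) 1 : ℕ →₀ ℕ) c := by
    intro φ c
    rw [Finset.filter_image, Finset.card_image_of_injective]
    · simp [Finsupp.finsetSum_apply, Finsupp.single_apply]
    · intro a b h
      exact Subtype.ext (congrArg Prod.snd h)
  rw [← Set.ncard_image_of_injective _ hΦ]
  congr 1
  ext D
  simp only [Set.mem_ofPred_eq, Set.mem_image, Finset.coe_filter, Fintype.mem_piFinset]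
  constructor
  · rintro ⟨ha, hb, hc⟩
    have : ∀ i : I, ∃ a : ℕ × ℕ, D.filter (fun p => p.2 = i.1) = {a} := fun i =>
      Finset.card_eq_one.1 (hb i.1 (Finset.mem_Icc.1 i.2).1 (Finset.mem_Icc.1 i.2).2)
    choose a hD using this
    have haD : ∀ i, a i ∈ D ∧ (a i).2 = i.1 := fun i => by
      have : a i ∈ D.filter (fun p => p.2 = i.1) := by rw [hD]; simp
      simpa using this
    have hDD : Φ (fun i => (a i).1 - 1) = D := by
      ext p
      simp only [Φ, Finset.mem_image, Finset.mem_univ, true_and]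
      constructor
      · rintro ⟨i, rfl⟩
        have h1 := ha _ (haD i).1
        have : ((a i).1 - 1 + 1, i.1) = a i := by
          ext
          · simp; omega
          · exact (haD i).2.symm
        rw [this]; exact (haD i).1
      · intro hp
        have h1 := ha _ hp
        refine ⟨⟨p.2, Finset.mem_Icc.2 h1.1⟩, ?_⟩
        have : p ∈ D.filter (fun q => q.2 = p.2) := by simp [hp]
        rw [hD ⟨p.2, Finset.mem_Icc.2 h1.1⟩, Finset.mem_singleton] at this
        rw [← this]
        ext
        · simp; omega
        · rfl
    refine ⟨_, ⟨?_, ?_⟩, hDD⟩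
    · intro i
      have := (ha _ (haD i).1).2.2.2
      rwa [(haD i).2] at this
    · ext c
      rw [← hcol, hDD, e_apply]
      split_ifs with h
      · exact hc _ (by omega) (by omega)
      · rw [Finset.card_eq_zero, Finset.filter_eq_empty_iff]
        intro p hp hpc
        have := ha p hp
        omega
  · rintro ⟨φ, ⟨h1, h2⟩, rfl⟩
    refine ⟨?_, hrow φ, ?_⟩
    · intro p hp
      obtain ⟨i, -, rfl⟩ := Finset.mem_image.1 hp
      refine ⟨Finset.mem_Icc.1 i.2, by simp, ?_, by simpa using h1 i⟩
      have h3 := hcol φ (φ i)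
      rw [h2, e_apply] at h3
      split_ifs at h3 with h4
      · simpa using h4
      · rw [Finset.card_eq_zero, Finset.filter_eq_empty_iff] at h3
        exact absurd rfl (h3 hp)
    · intro j hj hjn
      obtain ⟨c, rfl⟩ : ∃ c, j = c + 1 := ⟨j - 1, by omega⟩
      rw [hcol, h2, e_apply, if_pos (by omega)]


lemma T_swap (n m : ℕ) (hm : m + 1 < n) (p : MvPolynomial ℕ ℤ) :
    T n (rename (Equiv.swap m (m+1)) p) = T n p := by
  have : e n = (e n).mapDomain (Equiv.swap m (m+1)) := by
    ext j
    rw [Finsupp.mapDomain_equiv_apply, e_apply, e_apply, Equiv.symm_swap, Equiv.swap_apply_def]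
    split_ifs <;> first | rfl | omega
  rw [T_apply, T_apply]
  conv_lhs => rw [this]
  exact coeff_rename_mapDomain _ (Equiv.injective _) _ _

noncomputable def sg (m : ℕ) : MvPolynomial ℕ ℤ →ₐ[ℤ] MvPolynomial ℕ ℤ :=
  aeval (fun j => if j < m then X j else if j = m then X m + X (m+1) else X (j+1))

lemma sg_s_lt (m i : ℕ) (h : i ≤ m) : sg m (s i) = s i := by
  rw [s, map_sum]
  refine Finset.sum_congr rfl fun j hj => ?_
  rw [Finset.mem_range] at hj
  simp [sg, show j < m by omega]

lemma sg_s_ge (m i : ℕ) (h : m < i) : sg m (s i) = s (i+1) := by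
  induction i, h using Nat.le_induction with
  | base => 
    rw [s_succ, map_add, sg_s_lt _ _ le_rfl, s_succ, s_succ]
    simp [sg, add_assoc]
  | succ i hi ih =>
    rw [s_succ, map_add, ih, s_succ (i+1)]
    congr 1
    simp [sg, show ¬ i < m by omega, show i ≠ m by omega]

noncomputable def dl (m : ℕ) (j : ℕ) : ℕ := if j ≤ m then j else j + 1

lemma dl_inj (m : ℕ) : Function.Injective (dl m) := by
  intro a b h
  unfold dl at h
  split_ifs at h <;> omega

lemma sg_mono (m : ℕ) (d : ℕ →₀ ℕ) : ∃ g : ℕ →₀ ℕ, g m = 0 ∧ g (m+1) = 0 ∧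
    (∀ j, j < m → g j = d j) ∧ (∀ j, m < j → g (j+1) = d j) ∧
    sg m (monomial d 1) = monomial g 1 * (X m + X (m+1))^(d m) := by
  induction d using Finsupp.induction_linear with
  | zero => exact ⟨0, by simp⟩
  | add f g hf hg =>
    obtain ⟨a, a1, a2, a3, a4, a5⟩ := hf
    obtain ⟨b, b1, b2, b3, b4, b5⟩ := hg
    refine ⟨a + b, by simp [a1, b1], by simp [a2, b2], fun j hj => by simp [a3 j hj, b3 j hj], 
      fun j hj => by simp [a4 j hj, b4 j hj], ?_⟩
    have h1 : (monomial (f + g) (1:ℤ)) = monomial f 1 * monomial g 1 := by simp [monomial_mul]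
    have h2 : (monomial (a + b) (1:ℤ)) = monomial a 1 * monomial b 1 := by simp [monomial_mul]
    rw [h1, h2, map_mul, a5, b5, Finsupp.add_apply, pow_add]
    ring
  | single i c =>
    have h0 : sg m (monomial (Finsupp.single i c) 1) = (sg m (X i))^c := by
      rw [← map_pow, X_pow_eq_monomial]
    rw [h0]
    rcases lt_trichotomy i m with h | h | h
    · refine ⟨Finsupp.single i c, ?_, ?_, ?_, ?_, ?_⟩
      · simp [Finsupp.single_apply]; omega
      · simp [Finsupp.single_apply]; omega
      · intros; rfl
      · intro j hj; simp only [Finsupp.single_apply]; split_ifs <;> omega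
      · rw [Finsupp.single_eq_of_ne (by omega), ← X_pow_eq_monomial]
        simp [sg, h]
    · subst h
      refine ⟨0, rfl, rfl, ?_, ?_, ?_⟩
      · intro j hj; simp [Finsupp.single_apply]; omega
      · intro j hj; simp [Finsupp.single_apply]; omega
      · simp [sg]
    · refine ⟨Finsupp.single (i+1) c, ?_, ?_, ?_, ?_, ?_⟩
      · simp [Finsupp.single_apply]; omega
      · simp [Finsupp.single_apply]; omega
      · intro j hj; simp only [Finsupp.single_apply]; split_ifs <;> omega
      · intro j hj; simp only [Finsupp.single_apply]; split_ifs <;> omega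
      · rw [Finsupp.single_eq_of_ne (by omega), ← X_pow_eq_monomial]
        simp [sg, show ¬ i < m by omega, show i ≠ m by omega]

lemma merge' (n m : ℕ) (hm : m < n) (d : ℕ →₀ ℕ) :
    T (n+1) ((X m - X (m+1))^2 * sg m (monomial d 1)) = -2 * T n (monomial d 1) := by
  obtain ⟨g, g1, g2, g3, g4, g5⟩ := sg_mono m d
  rw [g5]
  by_cases hd : d m = 2
  · have h1 : (X m - X (m+1))^2 * (monomial g (1:ℤ) * (X m + X (m+1))^(d m)) =
        monomial (g + Finsupp.single m 4) 1 - (2:ℤ) • monomial (g + Finsupp.single m 2 + Finsupp.single (m+1) 2) 1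
         + monomial (g + Finsupp.single (m+1) 4) 1 := by
      have hmm : ∀ a b : ℕ →₀ ℕ, monomial (a + b) (1:ℤ) = monomial a 1 * monomial b 1 := by
        intro a b; simp [monomial_mul]
      simp only [hmm, ← X_pow_eq_monomial, hd, zsmul_eq_mul]
      push_cast
      ring
    rw [h1, map_add, map_sub, map_smul]
    simp only [T_apply, coeff_monomial]
    have hA : ¬ (g + Finsupp.single m 4 = e (n+1)) := by
      intro h
      have := DFunLike.congr_fun h m
      simp only [e_apply, Finsupp.add_apply, Finsupp.single_eq_same, g1, zero_add] at this
      split_ifs at this <;> omega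
    have hB : ¬ (g + Finsupp.single (m+1) 4 = e (n+1)) := by
      intro h
      have := DFunLike.congr_fun h (m+1)
      simp only [e_apply, Finsupp.add_apply, Finsupp.single_eq_same, g2, zero_add] at this
      split_ifs at this <;> omega
    rw [if_neg hA, if_neg hB]
    · have : g + Finsupp.single m 2 + Finsupp.single (m+1) 2 = e (n+1) ↔ d = e n := by
        constructor
        · intro h
          ext j
          rw [e_apply]
          rcases lt_trichotomy j m with hj | hj | hj
          · have := DFunLike.congr_fun h j
            simp [e_apply, Finsupp.single_apply, g3 j hj] at this
            split_ifs at * <;> omega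
          · subst hj; rw [hd, if_pos hm]
          · have := DFunLike.congr_fun h (j+1)
            simp [e_apply, Finsupp.single_apply, g4 j hj] at this
            split_ifs at * <;> omega
        · intro h
          ext j
          simp only [e_apply, Finsupp.add_apply, Finsupp.single_apply]
          rcases lt_trichotomy j m with hj | hj | hj
          · rw [g3 j hj, h, e_apply]; split_ifs <;> omega
          · subst hj; rw [g1]; split_ifs <;> omega
          · obtain ⟨c, rfl⟩ : ∃ c, j = c + 1 := ⟨j - 1, by omega⟩
            by_cases hc : c = m
            · subst hc; rw [g2]; split_ifs <;> omega
            · rw [g4 c (by omega), h, e_apply]; split_ifs <;> omega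
      simp only [this]
      split_ifs <;> simp
  · rw [T_apply, T_apply, coeff_monomial, if_neg]
    swap
    · rintro rfl; simp [e_apply, hm] at hd
    let w : ℕ → ℕ := fun j => if j = m ∨ j = m + 1 then 1 else 0
    have hX : IsWeightedHomogeneous w (X m : MvPolynomial ℕ ℤ) 1 := by
      have := isWeightedHomogeneous_X ℤ w m
      simpa [w] using this
    have hY : IsWeightedHomogeneous w (X (m+1) : MvPolynomial ℕ ℤ) 1 := by
      have := isWeightedHomogeneous_X ℤ w (m+1)
      simpa [w] using this
    have hg : IsWeightedHomogeneous w (monomial g (1:ℤ)) 0 := by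
      apply isWeightedHomogeneous_monomial
      rw [Finsupp.weight_apply, Finsupp.sum]
      apply Finset.sum_eq_zero
      intro j hj
      by_cases h : j = m ∨ j = m + 1
      · rcases h with rfl | rfl <;> simp [g1, g2]
      · simp [w, h]
    have hq := ((hX.sub hY).pow 2).mul (hg.mul ((hX.add hY).pow (d m)))
    rw [hq.coeff_eq_zero]
    · simp
    · rw [e, map_sum]
      simp only [Finsupp.weight_single, w]
      intro h
      have h2 : ∑ x ∈ Finset.range (n+1), 2 • (if x = m ∨ x = m+1 then 1 else 0) = 4 := by
        rw [← Finset.smul_sum, Finset.sum_boole]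
        have : Finset.filter (fun x => x = m ∨ x = m+1) (Finset.range (n+1)) = {m, m+1} := by
          ext x; simp; omega
        rw [this]; simp
      rw [h2] at h
      simp at h
      omega


lemma merge (n m : ℕ) (hm : m < n) (p : MvPolynomial ℕ ℤ) :
    T (n+1) ((X m - X (m+1))^2 * sg m p) = -2 * T n p := by
  induction p using MvPolynomial.induction_on' with
  | monomial u a =>
    have : monomial u a = a • monomial u (1:ℤ) := by simp [smul_monomial]
    rw [this, map_smul, mul_smul_comm, map_smul, merge' n m hm, map_smul]
    simp only [smul_eq_mul]; ring
  | add p q hp hq => rw [map_add, mul_add, map_add, hp, hq, map_add]; ring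

noncomputable def tu : MvPolynomial ℕ ℤ →ₐ[ℤ] MvPolynomial ℕ ℤ :=
  aeval (fun j => if j = 0 then 0 else X (j-1))

lemma tu_s (i : ℕ) : tu (s (i+1)) = s i := by
  rw [s, map_sum, Finset.sum_range_succ']
  simp [tu, s]

lemma tu_mono (d : ℕ →₀ ℕ) : ∃ g : ℕ →₀ ℕ, 
    (∀ j, g j = d (j+1)) ∧ tu (monomial d 1) = 0 ^ (d 0) * monomial g 1 := by
  induction d using Finsupp.induction_linear with
  | zero => exact ⟨0, by simp⟩
  | add f g hf hg =>
    obtain ⟨a, a1, a2⟩ := hf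
    obtain ⟨b, b1, b2⟩ := hg
    refine ⟨a + b, fun j => by simp [a1, b1], ?_⟩
    have h1 : (monomial (f + g) (1:ℤ)) = monomial f 1 * monomial g 1 := by simp [monomial_mul]
    have h2 : (monomial (a + b) (1:ℤ)) = monomial a 1 * monomial b 1 := by simp [monomial_mul]
    rw [h1, h2, map_mul, a2, b2, Finsupp.add_apply, pow_add]
    ring
  | single i c =>
    have h0 : tu (monomial (Finsupp.single i c) 1) = (tu (X i))^c := by
      rw [← map_pow, X_pow_eq_monomial]
    rw [h0]
    rcases i with _ | i
    · exact ⟨0, by simp, by simp [tu]⟩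
    · refine ⟨Finsupp.single i c, ?_, ?_⟩
      · intro j; simp [Finsupp.single_apply]
      · rw [← X_pow_eq_monomial]; simp [tu]

lemma drop (n : ℕ) (p : MvPolynomial ℕ ℤ) : T (n+1) (X 0 ^ 2 * p) = T n (tu p) := by
  induction p using MvPolynomial.induction_on' with
  | monomial u a =>
    have : monomial u a = a • monomial u (1:ℤ) := by simp [smul_monomial]
    rw [this, map_smul, mul_smul_comm, map_smul, map_smul]
    congr 1
    obtain ⟨g, g1, g2⟩ := tu_mono u
    rw [g2, X_pow_eq_monomial, monomial_mul, T_apply, T_apply, coeff_monomial]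
    by_cases h0 : u 0 = 0
    · rw [h0, pow_zero, one_mul (monomial g (1:ℤ)), coeff_monomial]
      have : Finsupp.single 0 2 + u = e (n+1) ↔ g = e n := by
        constructor
        · intro h
          ext j
          have := DFunLike.congr_fun h (j+1)
          simpa [e_apply, g1] using this
        · intro h
          ext j
          rcases j with _ | j
          · simp [e_apply, h0]
          · have := DFunLike.congr_fun h j
            simpa [e_apply, g1] using this
      simp [this]
    · rw [zero_pow h0, zero_mul, coeff_zero, if_neg]
      intro h
      have := DFunLike.congr_fun h 0
      simp [e_apply] at this
      exact h0 this
  | add p q hp hq => rw [map_add, mul_add, map_add, hp, hq, map_add]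

noncomputable def P (n : ℕ) : MvPolynomial ℕ ℤ :=
  ∏ i ∈ Finset.range (n-1), s (i+1) * (s n - s (i+1))

noncomputable def B (n k : ℕ) : ℤ := T n (X k * s n * P n)
noncomputable def S (n : ℕ) : ℤ := T n (s n * s n * P n)

lemma S_eq (n : ℕ) : S n = ∑ k ∈ Finset.range n, B n k := by
  unfold S B
  rw [← map_sum]
  congr 1
  rw [← Finset.sum_mul, ← Finset.sum_mul]; rfl

lemma B_zero (n : ℕ) : B (n+2) 0 = S (n+1) := by
  unfold B S P
  have : (X 0 * s (n+2) * ∏ i ∈ Finset.range (n+2-1), s (i+1) * (s (n+2) - s (i+1))) =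
    X 0 ^ 2 * (s (n+2) * ((s (n+2) - s 1) * ∏ i ∈ Finset.range n, s (i+2) * (s (n+2) - s (i+2)))) := by
    rw [show n + 2 - 1 = n + 1 by omega, Finset.prod_range_succ']
    have : s (0+1) = X 0 := by simp [s]
    rw [this]
    ring
  rw [this, drop, map_mul tu, map_mul tu, map_sub tu, map_prod tu]
  simp only [map_mul, map_sub, tu_s]
  have : s 0 = 0 := by simp [s]
  rw [this, sub_zero, mul_assoc]
  rfl

lemma B_one : B 1 0 = 1 := by
  have : X 0 * s 1 * P 1 = X 0 ^ 2 * 1 := by simp [s, P]; ring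
  rw [B, this, drop]
  simp [T_apply, e]

lemma swap_s (m i : ℕ) (h : i ≠ m + 1) : rename (Equiv.swap m (m+1)) (s i) = s i := by
  rw [s, map_sum]
  simp only [rename_X]
  by_cases hi : i ≤ m
  · refine Finset.sum_congr rfl fun j hj => ?_
    rw [Finset.mem_range] at hj
    rw [Equiv.swap_apply_of_ne_of_ne (by omega) (by omega)]
  · refine Finset.sum_equiv (Equiv.swap m (m+1)) ?_ (fun _ _ => rfl)
    intro j
    rw [Equiv.swap_apply_def]
    simp only [Finset.mem_range]
    split_ifs <;> omega

lemma B_diff (n m : ℕ) (hm : m < n) :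
    B (n+1) (m+1) - B (n+1) m = T n ((s n - s m - s (m+1)) * s n * P n) := by
  set R := ∏ i ∈ (Finset.range n).erase m, s (i+1) * (s (n+1) - s (i+1)) with hR
  have hP : P (n+1) = s (m+1) * (s (n+1) - s (m+1)) * R := by
    rw [P, hR, Nat.add_sub_cancel, Finset.mul_prod_erase _ (fun i => s (i+1) * (s (n+1) - s (i+1)))
      (Finset.mem_range.2 hm)]
  have hRs : rename (Equiv.swap m (m+1)) R = R := by
    rw [hR, map_prod]
    refine Finset.prod_congr rfl fun i hi => ?_
    have : i ≠ m := Finset.ne_of_mem_erase hi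
    rw [map_mul, map_sub, swap_s _ _ (by omega), swap_s _ _ (by omega)]
  have hRsg : sg m (P n) = R := by
    rw [hR, P, map_prod]
    refine Finset.prod_nbij (fun i => if i < m then i else i + 1) ?_ ?_ ?_ ?_
    · intro i hi
      simp only [Finset.mem_range, Finset.mem_erase] at *
      split_ifs <;> omega
    · intro a _ b _ h
      simp only at h
      split_ifs at h <;> omega
    · intro j hj
      simp only [Finset.coe_erase, Finset.coe_range, Set.mem_sdiff, Set.mem_Iio, Set.mem_singleton_iff] at hj
      by_cases h : j < m
      · exact ⟨j, by simp; omega, by simp [h]⟩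
      · exact ⟨j - 1, by simp; omega, by simp [show ¬ (j - 1 < m) by omega]; omega⟩
    · intro i hi
      rw [map_mul, map_sub, sg_s_ge m n hm]
      split_ifs with h
      · rw [sg_s_lt _ _ (by omega)]
      · rw [sg_s_ge _ _ (by omega)]
  set Q := (X (m+1) - X m) * s (n+1) * P (n+1) with hQ
  have h1 : B (n+1) (m+1) - B (n+1) m = T (n+1) Q := by
    rw [B, B, ← map_sub, hQ]; congr 1; ring
  have h2 : T (n+1) Q = T (n+1) (rename (Equiv.swap m (m+1)) Q) := (T_swap _ _ (by omega) _).symm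
  have h3 : Q + rename (Equiv.swap m (m+1)) Q = 
      - ((X m - X (m+1))^2 * sg m ((s n - s m - s (m+1)) * s n * P n)) := by
    rw [map_mul (sg m), map_mul (sg m), map_sub (sg m), map_sub (sg m), hRsg, sg_s_ge m n hm, sg_s_lt m m le_rfl, 
      sg_s_ge m (m+1) (by omega), hQ, hP]
    simp only [map_mul, map_sub, hRs, swap_s m (n+1) (by omega), s_succ (m+1), s_succ m, map_add, 
      swap_s m m (by omega), rename_X, Equiv.swap_apply_left, Equiv.swap_apply_right]
    ring
  have h4 := congrArg (T (n+1)) h3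
  rw [map_add, ← h2, map_neg, merge n m hm] at h4
  rw [h1]
  linarith

lemma B_two (n : ℕ) (hn : 1 ≤ n) : B (n+1) 1 = 2 * B (n+1) 0 - B n 0 := by
  have h := B_diff n 0 hn
  obtain ⟨n, rfl⟩ : ∃ c, n = c + 1 := ⟨n - 1, by omega⟩
  have h2 : T (n+1) ((s (n+1) - s 0 - s (0+1)) * s (n+1) * P (n+1)) = S (n+1) - B (n+1) 0 := by
    rw [S, B, ← map_sub]; congr 1
    have : s (0+1) = X 0 := by simp [s]
    rw [this]
    have : s 0 = 0 := by simp [s]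
    rw [this]
    ring
  rw [h2, ← B_zero] at h
  linarith

lemma B_rec (n m : ℕ) (hm : m + 1 < n) : 
    B (n+1) (m+2) = 2 * B (n+1) (m+1) - B (n+1) m - B n (m+1) - B n m := by
  have h1 := B_diff n m (by omega)
  have h2 := B_diff n (m+1) hm
  have h3 : T n ((s n - s m - s (m+1)) * s n * P n) - T n ((s n - s (m+1) - s (m+1+1)) * s n * P n)
    = B n (m+1) + B n m := by
    rw [B, B, ← map_sub, ← map_add]; congr 1
    rw [s_succ (m+1), s_succ m]
    ring
  rw [show m+2 = m+1+1 by rfl]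
  linarith

lemma prodsplit (N : ℕ) (g : ℕ → MvPolynomial ℕ ℤ) (hlow : ∀ i < N, g (i+1) = s (i+1))
    (hup : ∀ i < N, g (N+3+i) = s (N+1) - s (i+1)) :
    ∏ i ∈ Finset.Icc 1 (2*(N+1)), g i = g (N+1) * g (N+2) * P (N+1) := by
  have h1 : ∏ i ∈ Finset.Icc 1 (2*(N+1)), g i = ∏ i ∈ Finset.range ((N+1)+(N+1)), g (i+1) := by
    rw [Finset.range_eq_Ico, Finset.prod_Ico_add' g 0 _ 1]
    congr 1
    ext; simp; omega
  rw [h1, Finset.prod_range_add, Finset.prod_range_succ, Finset.prod_range_succ' _ N, P,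
    Nat.add_sub_cancel, Finset.prod_mul_distrib]
  have h2 : ∏ i ∈ Finset.range N, g (i+1) = ∏ i ∈ Finset.range N, s (i+1) := 
    Finset.prod_congr rfl fun i hi => hlow i (Finset.mem_range.1 hi)
  have h3 : ∏ i ∈ Finset.range N, g (N+1+(i+1)+1) = ∏ i ∈ Finset.range N, (s (N+1) - s (i+1)) := 
    Finset.prod_congr rfl fun i hi => by
      rw [← hup i (Finset.mem_range.1 hi)]; congr 1; omega
  rw [h2, h3]
  simp only [add_zero]
  ring

def V (n i : ℕ) : Finset ℕ := (Finset.range n).filter (fun j => j + 1 ≤ i ∧ i ≤ j + 1 + n)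

lemma V_low (n i : ℕ) (h : i ≤ n) : ∑ j ∈ V n i, (X j : MvPolynomial ℕ ℤ) = s i := by
  have : V n i = Finset.range i := by ext; simp [V]; omega
  rw [this]; rfl

lemma V_up (n i : ℕ) (h : i ≤ n) : ∑ j ∈ V n (n+1+i), (X j : MvPolynomial ℕ ℤ) = s n - s i := by
  have : V n (n+1+i) = Finset.Ico i n := by ext; simp [V]; omega
  rw [this, Finset.sum_Ico_eq_sub _ h]; rfl

lemma card_DC (n : ℕ) (hn : 1 ≤ n) : ((DC n).ncard : ℤ) = S n := by
  obtain ⟨N, rfl⟩ : ∃ c, n = c + 1 := ⟨n - 1, by omega⟩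
  have h1 := count (2*(N+1)) (N+1) (V (N+1))
  rw [prodsplit N] at h1
  · rw [V_low _ _ le_rfl, show N + 2 = N+1+1+0 by rfl, V_up _ _ (by omega)] at h1
    rw [S]
    have : s 0 = 0 := by simp [s]
    rw [this, sub_zero] at h1
    rw [← h1]
    congr 2
    ext D
    simp only [DC, Set.mem_ofPred_eq]
    refine and_congr (forall₂_congr fun p hp => ?_) Iff.rfl
    simp only [V, Finset.mem_filter, Finset.mem_range]
    omega
  · intro i hi; exact V_low _ _ (by omega)
  · intro i hi
    rw [show N + 3 + i = (N+1) + 1 + (i+1) by omega]; exact V_up _ _ (by omega)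

lemma card_row (n k r : ℕ) (hn : 1 ≤ n) (hk : 1 ≤ k) (hkn : k ≤ n) (hr : r = n ∨ r = n + 1) :
    (({D ∈ DC n | (k, r) ∈ D} : Set (Finset (ℕ × ℕ))).ncard : ℤ) = B n (k-1) := by
  obtain ⟨N, rfl⟩ : ∃ c, n = c + 1 := ⟨n - 1, by omega⟩
  have h1 := count (2*(N+1)) (N+1) (fun i => if i = r then {k-1} else V (N+1) i)
  rw [prodsplit N] at h1
  · have e1 : s 0 = 0 := by simp [s]
    have e2 := V_low (N+1) (N+1) le_rfl
    have e3 := V_up (N+1) 0 (by omega)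
    rw [e1, sub_zero] at e3
    have e4 : (∑ j ∈ if N + 1 = r then {k-1} else V (N+1) (N+1), (X j : MvPolynomial ℕ ℤ)) *
        (∑ j ∈ if N + 2 = r then {k-1} else V (N+1) (N+2), (X j : MvPolynomial ℕ ℤ)) 
        = X (k-1) * s (N+1) := by
      rcases hr with rfl | rfl
      · rw [if_pos rfl, if_neg (by omega), Finset.sum_singleton]
        congr 1
      · rw [if_pos rfl, if_neg (by omega), Finset.sum_singleton, e2, mul_comm]
    rw [e4] at h1
    rw [B, ← h1]
    congr 2
    ext D
    simp only [DC, Set.mem_ofPred_eq]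
    constructor
    · rintro ⟨⟨ha, hb, hc⟩, hD⟩
      refine ⟨fun p hp => ?_, hb, hc⟩
      have := ha p hp
      refine ⟨by omega, by omega, by omega, ?_⟩
      split_ifs with h
      · obtain ⟨a, h2⟩ := Finset.card_eq_one.1 (hb r (by omega) (by omega))
        have h3 : p ∈ D.filter (fun q => q.2 = r) := by simp [hp, h]
        have h4 : (k, r) ∈ D.filter (fun q => q.2 = r) := by simp [hD]
        rw [h2, Finset.mem_singleton] at h3 h4
        rw [h3, ← h4]; simp
      · simp only [V, Finset.mem_filter, Finset.mem_range]
        omega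
    · rintro ⟨ha, hb, hc⟩
      refine ⟨⟨fun p hp => ?_, hb, hc⟩, ?_⟩
      · have := ha p hp
        split_ifs at this with h
        · omega
        · simp only [V, Finset.mem_filter, Finset.mem_range] at this
          omega
      · obtain ⟨a, h2⟩ := Finset.card_eq_one.1 (hb r (by omega) (by omega))
        have h3 : a ∈ D.filter (fun q => q.2 = r) := by rw [h2]; simp
        rw [Finset.mem_filter] at h3
        have := ha a h3.1
        rw [if_pos h3.2, Finset.mem_singleton] at this
        have h5 : a = (k, r) := by
          ext
          · simp only; omega
          · exact h3.2
        rw [← h5]; exact h3.1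
  · intro i hi
    rw [if_neg (by omega)]; exact V_low _ _ (by omega)
  · intro i hi
    rw [if_neg (by omega), show N + 3 + i = (N+1) + 1 + (i+1) by omega]; exact V_up _ _ (by omega)

lemma sumIcc (n : ℕ) (f : ℕ → ℤ) : ∑ i ∈ Finset.Icc 1 n, f i = ∑ i ∈ Finset.range n, f (i+1) := by
  rw [Finset.range_eq_Ico, Finset.sum_Ico_add' f 0 _ 1]
  rfl

lemma h_eq (h : ℕ → ℕ → ℤ)
    (h11 : h 1 1 = 1)
    (hrow1 : ∀ m, 2 ≤ m → h m 1 = ∑ i ∈ Finset.Icc 1 (m - 1), h (m - 1) i)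
    (hrow2 : ∀ m, 2 ≤ m → h m 2 = 2 * h m 1 - h (m - 1) 1)
    (hrec : ∀ m k, 2 ≤ m → 3 ≤ k → k ≤ m →
      h m k = 2 * h m (k - 1) - h m (k - 2) - h (m - 1) (k - 1) - h (m - 1) (k - 2))
    (n : ℕ) : ∀ k ≤ n, h (n+1) (k+1) = B (n+1) k := by
  induction n with
  | zero => intro k hk; obtain rfl : k = 0 := by omega
            rw [B_one, h11]
  | succ n ih =>
    intro k
    induction k using Nat.strong_induction_on with
    | _ k ihk =>
    intro hk
    have h0 : h (n+1+1) 1 = B (n+1+1) 0 := by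
      rw [hrow1 _ (by omega), B_zero, S_eq, Nat.add_sub_cancel, sumIcc]
      exact Finset.sum_congr rfl fun i hi => ih i (by have := Finset.mem_range.1 hi; omega)
    rcases k with _ | _ | k
    · exact h0
    · rw [hrow2 _ (by omega), B_two _ (by omega), h0, Nat.add_sub_cancel, ih 0 (by omega)]
    · have a1 := ihk (k+1) (by omega) (by omega)
      have a2 := ihk k (by omega) (by omega)
      have a3 := ih (k+1) (by omega)
      have a4 := ih k (by omega)
      rw [hrec _ _ (by omega) (by omega) (by omega), B_rec _ _ (by omega), ← a1, ← a2, ← a3, ← a4]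
      rfl

end Kr

theorem stmt10
    (h : ℕ → ℕ → ℤ)
    (h11 : h 1 1 = 1)
    (hrow1 : ∀ m, 2 ≤ m → h m 1 = ∑ i ∈ Finset.Icc 1 (m - 1), h (m - 1) i)
    (hrow2 : ∀ m, 2 ≤ m → h m 2 = 2 * h m 1 - h (m - 1) 1)
    (hrec : ∀ m k, 2 ≤ m → 3 ≤ k → k ≤ m →
      h m k = 2 * h m (k - 1) - h m (k - 2) - h (m - 1) (k - 1) - h (m - 1) (k - 2))
    (n : ℕ) (hn : 1 ≤ n) :
    (∀ k, 1 ≤ k → k ≤ n →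
      ((DCup n k).ncard : ℤ) = h n k ∧ ((DClow n k).ncard : ℤ) = h n k) ∧
    ((DC n).ncard : ℤ) = ∑ k ∈ Finset.Icc 1 n, h n k := by

  have key : ∀ k, 1 ≤ k → k ≤ n → h n k = Kr.B n (k-1) := by
    intro k hk hkn
    have := Kr.h_eq h h11 hrow1 hrow2 hrec (n-1) (k-1) (by omega)
    rwa [Nat.sub_add_cancel hn, Nat.sub_add_cancel hk] at this
  refine ⟨fun k hk hkn => ⟨?_, ?_⟩, ?_⟩
  · rw [key k hk hkn]
    exact Kr.card_row n k (n+1) hn hk hkn (Or.inr rfl)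
  · rw [key k hk hkn]
    exact Kr.card_row n k n hn hk hkn (Or.inl rfl)
  · rw [Kr.card_DC n hn, Kr.S_eq, Kr.sumIcc]
    refine Finset.sum_congr rfl fun i hi => ?_
    rw [key (i+1) (by omega) (by have := Finset.mem_range.1 hi; omega)]
    rfl
end

section
/- For every n ≥ 1, H_{2n+1} = 2^n · #M_n, where M_n is the set of n-tuples ({u_l, v_l})_{l ∈ [n]} of unordered pairs (with repetition allowed) such that (u_l, v_l) ∈ [l]² for all l ∈ [n] and the multiset {u_1, v_1, …, u_n, v_n} contains the set [n]. In particular, 2^n divides H_{2n+1}. -/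
/-- `Mcal n` : Hetyei's model. An element is an `n`-tuple of unordered pairs
`{u_l, v_l}` (the entry of index `l : Fin n` being the pair `{u_{l+1}, v_{l+1}}`,
an unordered pair of elements of `[l+1]`), such that every element of `[n]`
occurs at least once among `u_1, v_1, …, u_n, v_n`. -/
def Mcal (n : ℕ) : Set (Fin n → Sym2 ℕ) :=
  {M | (∀ l : Fin n, ∀ x ∈ M l, 1 ≤ x ∧ x ≤ (l : ℕ) + 1) ∧
       (∀ m, 1 ≤ m → m ≤ n → ∃ l : Fin n, m ∈ M l)}

/-- The Seidel triangle: `seidel i j` is `g_{i,j}`. One has `g_{1,1} = 1`,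
`g_{i,j} = 0` outside the triangle (in particular whenever `i < j`), and inside
the triangle the recursions `g_{2p-1,j} = g_{2p-1,j-1} + g_{2p-2,j}` and
`g_{2p,j} = g_{2p-1,j} + g_{2p,j+1}` hold. -/
def seidel (i j : ℕ) : ℕ :=
  if j = 0 then 0
  else if i + 1 < 2 * j then 0
  else if i ≤ 1 then 1
  else if i % 2 = 1 then seidel i (j - 1) + seidel (i - 1) j
  else seidel (i - 1) j + seidel i (j + 1)
termination_by (i, if i % 2 = 1 then j else i + 1 - j)
decreasing_by
  all_goals simp_wf
  · right; split_ifs <;> omega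
  · left; omega
  · left; omega
  · right; split_ifs <;> omega

/-- The median Genocchi numbers `H_{2n+1} = g_{2n+2,1}`. -/
def medianGenocchi (n : ℕ) : ℕ := seidel (2 * n + 2) 1

open Polynomial in
/-- signed count -/
def gN : ℕ → ℕ → ℤ
  | 0, _ => 1
  | j + 1, s => ((s : ℤ) + 1) * (s + 2) * gN j (s + 1) - s * (s + 1) * gN j s

def gA : ℕ → ℤ
  | 0 => 1
  | n + 1 => gN n 0

open Polynomial in
noncomputable def gL : ℤ[X] →ₗ[ℤ] ℤ := (Polynomial.basisMonomials ℤ).constr ℤ gA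

open Polynomial in
theorem gL_pow (n : ℕ) : gL (X ^ n) = gA n := by
  have := (Polynomial.basisMonomials ℤ).constr_basis ℤ gA n
  rw [Polynomial.coe_basisMonomials] at this
  rw [← this, gL]
  simp only [Polynomial.monomial_one_right_eq_X_pow]

open Polynomial in
noncomputable def gB : ℕ → ℤ[X]
  | 0 => 1
  | m + 1 => (X + C ((m : ℤ) * (m + 1))) * gB m

open Polynomial Nat in
theorem gL_powB (s : ℕ) : ∀ j, gL (X ^ (j + 1) * gB s) = (s ! : ℤ) * ((s + 1)! : ℤ) * gN j s := by
  induction s with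
  | zero => intro j; simp [gB, gL_pow, gA]
  | succ s ih =>
    intro j
    have : (X : ℤ[X]) ^ (j + 1) * gB (s + 1)
        = X ^ (j + 1 + 1) * gB s + ((s : ℤ) * (s + 1)) • (X ^ (j + 1) * gB s) := by
      rw [gB, Polynomial.smul_eq_C_mul]; ring
    rw [this, map_add, map_smul, ih, ih, gN]
    push_cast [Nat.factorial_succ]
    simp only [smul_eq_mul]
    ring

open Polynomial Nat in
theorem gL_B (s : ℕ) : gL (gB s) = (s ! : ℤ) ^ 2 := by
  induction s with
  | zero => have := gL_pow 0; simpa [gB, gA] using this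
  | succ s ih =>
    have : gB (s + 1) = X ^ (0 + 1) * gB s + ((s : ℤ) * (s + 1)) • gB s := by
      rw [gB, Polynomial.smul_eq_C_mul]; ring
    rw [this, map_add, map_smul, gL_powB, ih, gN]
    push_cast [Nat.factorial_succ]
    simp only [smul_eq_mul]
    ring

open Polynomial Nat in
theorem gL_ker (m : ℕ) : gL ((X - C ((m : ℤ) + 1)) * gB m) = 0 := by
  have : (X - C ((m : ℤ) + 1)) * gB m = X ^ (0 + 1) * gB m - ((m : ℤ) + 1) • gB m := by
    rw [Polynomial.smul_eq_C_mul]; ring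
  rw [this, map_sub, map_smul, gL_powB, gL_B, gN]
  push_cast [Nat.factorial_succ]
  simp only [smul_eq_mul]
  ring

open Polynomial in
noncomputable def gphi : ℤ[X] →ₐ[ℤ] ℤ[X] := Polynomial.aeval (-(X * (X + 1)))

open Polynomial in
theorem gphi_inj (p : ℤ[X]) (h : gphi p = 0) : p = 0 := by
  have h' : p.comp (-(X * (X + 1))) = 0 := by
    rw [← h, gphi, Polynomial.aeval_def, Polynomial.comp]; rfl
  rw [Polynomial.comp_eq_zero_iff] at h'
  rcases h' with h' | ⟨_, h'⟩
  · exact h'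
  · exfalso
    have := congrArg (Polynomial.eval 1) h'
    simp at this

open Polynomial in
noncomputable def gC : ℕ → ℤ[X]
  | 0 => 1
  | m + 1 => (X - C (m : ℤ)) * (X + C ((m : ℤ) + 1)) * gC m

open Polynomial in
theorem gphi_X : gphi X = -(X * (X + 1)) := by simp [gphi]

open Polynomial in
theorem gphi_C (a : ℤ) : gphi (C a) = C a := by
  simp [gphi]

open Polynomial in
theorem gphi_B (m : ℕ) : gphi (gB m) = (-1) ^ m * gC m := by
  induction m with
  | zero => simp [gB, gC]
  | succ m ih =>
    rw [gB, gC, map_mul, map_add, gphi_X, gphi_C, ih]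
    simp only [map_mul, map_add, map_one]
    ring

open Polynomial in
theorem gker (k : ℕ) : ∀ m : ℕ, ∃ u : ℤ[X], gL u = 0 ∧ gphi u * (2 * X + 1) =
    X ^ (2 * k) * (X ^ 2 * (X - C (m : ℤ)) * gC m)
    + (X + 1) ^ (2 * k) * ((X + 1) ^ 2 * (X + C ((m : ℤ) + 1)) * gC m) := by
  induction k with
  | zero =>
    intro m
    refine ⟨((-1) ^ (m + 1) : ℤ) • ((X - C ((m : ℤ) + 1)) * gB m), ?_, ?_⟩
    · rw [map_smul, gL_ker, smul_zero]
    · rw [map_smul, map_mul, map_sub, gphi_X, gphi_C, gphi_B, Polynomial.smul_eq_C_mul]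
      simp only [map_add, map_one, map_pow, map_neg]
      have h : (-1 : ℤ[X]) ^ m * (-1) ^ m = 1 := by rw [← mul_pow]; simp
      linear_combination (gC m * (X * (X + 1) + C (m : ℤ) + 1) * (2 * X + 1)) * h
  | succ k ih =>
    intro m
    obtain ⟨u, hu, hu'⟩ := ih m
    obtain ⟨v, hv, hv'⟩ := ih (m + 1)
    refine ⟨v + (((m : ℤ) + 1) ^ 2) • u, ?_, ?_⟩
    · rw [map_add, map_smul, hu, hv]; simp
    · rw [map_add, map_smul, Polynomial.smul_eq_C_mul, add_mul, hv', mul_assoc (C _) (gphi u), hu', gC]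
      push_cast
      simp only [map_add, map_one, map_pow]
      ring

open Polynomial in
noncomputable def gQ (p : ℕ) : ℤ[X] :=
  ∑ c ∈ Finset.range (p + 1), (((-1) ^ c * ((p + c).choose (2 * c) : ℤ)) : ℤ) • X ^ (p - c)

open Polynomial in
noncomputable def gS (p : ℕ) : ℤ[X] :=
  ∑ c ∈ Finset.range (p + 1), (((-1) ^ c * ((p + c + 1).choose (2 * c + 1) : ℤ)) : ℤ) • X ^ (p - c)

open Polynomial in
theorem gQ_succ (p : ℕ) : gQ (p + 1) = X * gQ p - gS p := by
  unfold gQ gS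
  have e1 : ∑ c ∈ Finset.range (p + 1 + 1),
      (((-1) ^ c * ((p + 1 + c).choose (2 * c) : ℤ)) : ℤ) • (X : ℤ[X]) ^ (p + 1 - c)
      = ∑ c ∈ Finset.range (p + 1 + 1),
      (((-1) ^ c * ((p + c).choose (2 * c) : ℤ)) : ℤ) • (X : ℤ[X]) ^ (p + 1 - c)
      - ∑ c ∈ Finset.range (p + 1),
      (((-1) ^ c * ((p + c + 1).choose (2 * c + 1) : ℤ)) : ℤ) • X ^ (p - c) := by
    rw [Finset.sum_range_succ', Finset.sum_range_succ' _ (p + 1)]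
    have : ∀ a b c d : ℤ[X], a = b - d → a + c = b + c - d := by
      intro a b c d h; rw [h]; ring
    simp only [Nat.mul_zero, Nat.choose_zero_right]
    apply this
    rw [← Finset.sum_sub_distrib]
    apply Finset.sum_congr rfl
    intro c hc
    rw [Nat.add_sub_add_right, ← sub_smul]
    congr 1
    have : (p + 1 + (c + 1)).choose (2 * (c + 1))
        = (p + c + 1).choose (2 * c + 1) + (p + (c + 1)).choose (2 * (c + 1)) := by
      rw [show p + 1 + (c + 1) = (p + c + 1) + 1 by ring,
        show 2 * (c + 1) = (2 * c + 1) + 1 by ring, Nat.choose_succ_succ]; rfl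
    rw [this]; push_cast; ring
  rw [e1, Finset.sum_range_succ]
  congr 1
  rw [Nat.choose_eq_zero_of_lt (show p + (p + 1) < 2 * (p + 1) by omega)]
  simp only [Nat.cast_zero, mul_zero, zero_smul, add_zero]
  rw [Finset.mul_sum]
  apply Finset.sum_congr rfl
  intro c hc
  have := Finset.mem_range.1 hc
  rw [show p + 1 - c = (p - c) + 1 by omega, pow_succ', mul_smul_comm]

open Polynomial in
theorem gS_succ (p : ℕ) : gS (p + 1) = X * gS p + gQ (p + 1) := by
  unfold gQ gS
  have e1 : X * ∑ c ∈ Finset.range (p + 1),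
      (((-1) ^ c * ((p + c + 1).choose (2 * c + 1) : ℤ)) : ℤ) • (X : ℤ[X]) ^ (p - c)
      = ∑ c ∈ Finset.range (p + 1 + 1),
      (((-1) ^ c * ((p + c + 1).choose (2 * c + 1) : ℤ)) : ℤ) • (X : ℤ[X]) ^ (p + 1 - c) := by
    rw [Finset.sum_range_succ _ (p + 1),
      Nat.choose_eq_zero_of_lt (show p + (p + 1) + 1 < 2 * (p + 1) + 1 by omega)]
    simp only [Nat.cast_zero, mul_zero, zero_smul, add_zero]
    rw [Finset.mul_sum]
    apply Finset.sum_congr rfl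
    intro c hc
    have := Finset.mem_range.1 hc
    rw [show p + 1 - c = (p - c) + 1 by omega, pow_succ', mul_smul_comm]
  rw [e1, ← Finset.sum_add_distrib]
  apply Finset.sum_congr rfl
  intro c hc
  rw [← add_smul]
  congr 1
  rw [show p + 1 + c + 1 = (p + 1 + c) + 1 by ring, Nat.choose_succ_succ,
    show p + c + 1 = p + 1 + c by ring]
  push_cast; ring

open Polynomial in
theorem gphi_QS (p : ℕ) :
    gphi (gQ p) * (2 * X + 1) = (-1) ^ p * (X ^ (2 * p + 1) + (X + 1) ^ (2 * p + 1)) ∧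
    gphi (gS p) * (2 * X + 1) = (-1) ^ p * ((X + 1) ^ (2 * p + 2) - X ^ (2 * p + 2)) := by
  induction p with
  | zero => simp [gQ, gS]; constructor <;> ring
  | succ p ih =>
    obtain ⟨h1, h2⟩ := ih
    have h3 : gphi (gQ (p + 1)) * (2 * X + 1)
        = (-1) ^ (p + 1) * (X ^ (2 * (p + 1) + 1) + (X + 1) ^ (2 * (p + 1) + 1)) := by
      rw [gQ_succ, map_sub, map_mul, gphi_X]
      linear_combination (-(X * (X + 1))) * h1 - h2
    refine ⟨h3, ?_⟩
    rw [gS_succ, map_add, map_mul, gphi_X]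
    linear_combination (-(X * (X + 1))) * h2 + h3

open Polynomial in
theorem gL_Q (p : ℕ) : gL (gQ (p + 1)) = 0 := by
  obtain ⟨u, hu, hu'⟩ := gker p 0
  have h := (gphi_QS (p + 1)).1
  have hx : (2 * X + 1 : ℤ[X]) ≠ 0 := by
    intro h
    have := congrArg (Polynomial.eval 0) h
    simp at this
  have : gQ (p + 1) = ((-1) ^ (p + 1) : ℤ) • u := by
    rw [← sub_eq_zero]
    apply gphi_inj
    apply mul_right_cancel₀ hx
    rw [map_sub, map_smul, Polynomial.smul_eq_C_mul, sub_mul, h, mul_assoc, hu']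
    simp [gC]
    ring
  rw [this, map_smul, hu, smul_zero]

theorem gA_rec (p : ℕ) :
    ∑ c ∈ Finset.range (p + 1 + 1), ((-1) ^ c * ((p + 1 + c).choose (2 * c) : ℤ)) * gA (p + 1 - c)
      = 0 := by
  have := gL_Q p
  rw [gQ, map_sum] at this
  simpa only [map_smul, gL_pow, smul_eq_mul] using this

/-- odd rows -/
def gO (p j : ℕ) : ℤ :=
  ∑ c ∈ Finset.range (p + 1), ((-1) ^ c * ((j + c).choose (2 * c + 1) : ℤ)) * gA (p - c)

/-- even rows, index shifted by one: `gE p j` is `g_{2p,j+1}` -/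
def gE (p j : ℕ) : ℤ :=
  ∑ c ∈ Finset.range (p + 1), ((-1) ^ c * ((j + c).choose (2 * c) : ℤ)) * gA (p - c)

theorem gO_succ (p j : ℕ) : gO p (j + 1) = gO p j + gE p j := by
  unfold gO gE
  rw [← Finset.sum_add_distrib]
  apply Finset.sum_congr rfl
  intro c _
  rw [show j + 1 + c = (j + c) + 1 by ring, Nat.choose_succ_succ]
  push_cast; ring

theorem gO_zero (p : ℕ) : gO p 0 = 0 := by
  unfold gO
  apply Finset.sum_eq_zero
  intro c _
  rw [Nat.choose_eq_zero_of_lt (by omega)]; simp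

theorem gE_succ (p j : ℕ) : gE (p + 1) j = gO p (j + 1) + gE (p + 1) (j + 1) := by
  unfold gO gE
  rw [Finset.sum_range_succ', Finset.sum_range_succ' _ (p + 1), ← add_assoc,
    ← Finset.sum_add_distrib]
  simp only [Nat.mul_zero, Nat.choose_zero_right]
  congr 1
  apply Finset.sum_congr rfl
  intro c _
  rw [Nat.add_sub_add_right, show j + 1 + (c + 1) = (j + 1 + c) + 1 by ring,
    show 2 * (c + 1) = (2 * c + 1) + 1 by ring, Nat.choose_succ_succ,
    show j + (c + 1) = j + 1 + c by ring]
  push_cast; ring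

theorem gE_top (p : ℕ) : gE (p + 1) (p + 1) = 0 := gA_rec p

theorem gE_zero (p : ℕ) : gE p 0 = gA p := by
  unfold gE
  rw [Finset.sum_range_succ', Finset.sum_eq_zero]
  · simp
  · intro c _
    rw [Nat.choose_eq_zero_of_lt (by omega)]; simp

theorem seidel_even (p : ℕ) (h : ∀ j, j ≤ p + 1 → (seidel (2 * p + 1) j : ℤ) = gO p j) :
    ∀ d j, j + d = p + 1 → (seidel (2 * p + 2) (j + 1) : ℤ) = gE (p + 1) j := by
  intro d
  induction d with
  | zero =>
    intro j hj
    have : j = p + 1 := by omega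
    subst this
    rw [gE_top, seidel]
    rw [if_neg (by omega), if_pos (by omega)]; rfl
  | succ d ih =>
    intro j hj
    rw [gE_succ, ← ih (j + 1) (by omega), ← h (j + 1) (by omega), seidel]
    rw [if_neg (by omega), if_neg (by omega), if_neg (by omega), if_neg (by omega)]
    push_cast; rfl

theorem seidel_odd (p : ℕ) : ∀ j, j ≤ p + 1 → (seidel (2 * p + 1) j : ℤ) = gO p j := by
  induction p with
  | zero =>
    intro j hj
    interval_cases j
    · rw [gO_zero, seidel]; simp
    · rw [seidel]; simp [gO, gA]
  | succ p ih =>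
    intro j
    induction j with
    | zero => intro _; rw [gO_zero, seidel]; simp
    | succ j ihj =>
      intro hj
      rw [gO_succ, ← ihj (by omega), ← seidel_even p ih (p + 1 - j) j (by omega), seidel]
      rw [if_neg (by omega), if_neg (by omega), if_neg (by omega), if_pos (by omega)]
      push_cast; rfl

theorem median_eq (n : ℕ) : (medianGenocchi n : ℤ) = gN n 0 := by
  rw [medianGenocchi, seidel_even n (seidel_odd n) (n + 1) 0 (by omega), gE_zero]; rfl

/-! counting -/

theorem gN_sum (n : ℕ) : ∀ s : ℕ, gN n s = ∑ b : Fin n → Bool,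
    (∏ m, if b m then (1 : ℤ) else -1) *
    ∏ l : Fin n, (((s + ∑ i : Fin n, if i ≤ l ∧ b i then 1 else 0 : ℕ) : ℤ) *
      ((s + ∑ i : Fin n, if i ≤ l ∧ b i then 1 else 0 : ℕ) + 1)) := by
  induction n with
  | zero => intro s; simp [gN]
  | succ n ih =>
    intro s
    rw [← (Fin.consEquiv (fun _ : Fin (n + 1) => Bool)).sum_comp, Fintype.sum_prod_type]
    simp only [Fin.consEquiv_apply, Fintype.sum_bool, Fin.prod_univ_succ, Fin.sum_univ_succ,
      Fin.cons_zero, Fin.cons_succ]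
    simp only [Fin.zero_le, Fin.succ_le_succ_iff]
    simp only [Fin.le_zero_iff, Fin.succ_ne_zero, false_and, true_and, if_true, if_false,
      Finset.sum_const_zero, add_zero, Bool.false_eq_true, zero_add]
    rw [gN, ih (s + 1), ih s, Finset.mul_sum, Finset.mul_sum, sub_eq_add_neg,
      ← Finset.sum_neg_distrib]
    congr 1
    · apply Finset.sum_congr rfl
      intro b _
      simp only [← add_assoc]
      push_cast
      ring
    · apply Finset.sum_congr rfl
      intro b _
      ring

/-- allowed values at position `l` -/
def gAl (n : ℕ) (b : Fin n → Bool) (l : Fin n) : Finset ℕ :=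
  (Finset.univ.filter (fun i : Fin n => i ≤ l ∧ b i)).image (fun i : Fin n => (i : ℕ) + 1)

theorem gAl_card (n : ℕ) (b : Fin n → Bool) (l : Fin n) :
    (gAl n b l).card = ∑ i : Fin n, if i ≤ l ∧ b i then 1 else 0 := by
  rw [gAl, Finset.card_image_of_injective, Finset.card_filter]
  intro i j h
  exact Fin.ext (by simpa using h)

theorem two_choose (k : ℕ) : (2 : ℤ) * ((k + 1).choose 2 : ℤ) = k * (k + 1) := by
  have := Nat.triangle_succ k
  have h2 := Nat.choose_two_right (k + 1)
  have h3 : (k + 1) * (k + 1 - 1) = 2 * (k + 1).choose 2 := by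
    rw [h2, Nat.mul_div_cancel' (Nat.even_mul_pred_self (k+1)).two_dvd]
  simp only [Nat.add_sub_cancel] at h3
  have h4 : (((k + 1) * k : ℕ) : ℤ) = ((2 * (k + 1).choose 2 : ℕ) : ℤ) := by rw [h3]
  push_cast at h4
  linarith

theorem gcount (n : ℕ) : (2 : ℤ) ^ n * (Mcal n).ncard = gN n 0 := by
  classical
  set U : Finset (Fin n → Sym2 ℕ) :=
    Fintype.piFinset (fun l : Fin n => (gAl n (fun _ => true) l).sym2) with hU
  have hM : Mcal n = ((U.filter (fun M => ∀ m : Fin n, ∃ l, ((m : ℕ) + 1) ∈ M l) :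
      Finset (Fin n → Sym2 ℕ)) : Set (Fin n → Sym2 ℕ)) := by
    ext M
    simp only [Mcal, Set.mem_setOf_eq, Finset.coe_filter, hU, Fintype.mem_piFinset,
      Finset.mem_sym2_iff]
    apply and_congr
    · refine forall_congr' fun l => forall_congr' fun x => forall_congr' fun _ => ?_
      simp only [gAl, Finset.mem_image, Finset.mem_filter, Finset.mem_univ, true_and, and_true]
      constructor
      · rintro ⟨h1, h2⟩
        exact ⟨⟨x - 1, by omega⟩, by rw [Fin.le_def]; simp; omega, by simp; omega⟩
      · rintro ⟨i, hi, rfl⟩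
        rw [Fin.le_def] at hi
        omega
    · constructor
      · intro h m
        exact h _ (by omega) (by omega)
      · intro h m h1 h2
        have := h ⟨m - 1, by omega⟩
        simpa [Nat.sub_add_cancel h1] using this
  rw [hM, Set.ncard_coe_finset, Finset.card_filter]
  have key : ∀ M : Fin n → Sym2 ℕ,
      (((if ∀ m : Fin n, ∃ l, ((m : ℕ) + 1) ∈ M l then 1 else 0 : ℕ)) : ℤ)
      = ∑ b : Fin n → Bool, (∏ m, if b m then (1 : ℤ) else -1) *
        (if ∀ m : Fin n, b m = false → ∀ l, ((m : ℕ) + 1) ∉ M l then 1 else 0) := by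
    intro M
    have h1 : (((if ∀ m : Fin n, ∃ l, ((m : ℕ) + 1) ∈ M l then 1 else 0 : ℕ)) : ℤ)
        = ∏ m : Fin n, ∑ b : Bool, (if b then (1 : ℤ) else -1) *
          (if b = false → ∀ l, ((m : ℕ) + 1) ∉ M l then 1 else 0) := by
      simp only [Fintype.sum_bool]
      by_cases h : ∀ m : Fin n, ∃ l, ((m : ℕ) + 1) ∈ M l
      · rw [if_pos h, Finset.prod_eq_one]; · rfl
        intro m _
        obtain ⟨l, hl⟩ := h m
        have h0 : ¬ ∀ l, ((m : ℕ) + 1) ∉ M l := fun h => h l hl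
        simp [-not_forall, h0]
      · rw [if_neg h]
        push Not at h
        obtain ⟨m, hm⟩ := h
        rw [Finset.prod_eq_zero (Finset.mem_univ m)]; · rfl
        simp [hm]
    rw [h1, Finset.prod_univ_sum, Fintype.piFinset_univ]
    apply Finset.sum_congr rfl
    intro b _
    rw [Finset.prod_mul_distrib, Finset.prod_boole]
    simp
  push_cast
  have key' := fun M => key M
  push_cast at key'
  rw [Finset.sum_congr rfl (fun M _ => key' M), Finset.sum_comm, Finset.mul_sum, gN_sum]
  apply Finset.sum_congr rfl
  intro b _
  rw [← Finset.mul_sum, mul_left_comm]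
  congr 1
  have hc : ∑ M ∈ U, (if ∀ m : Fin n, b m = false → ∀ l, ((m : ℕ) + 1) ∉ M l then (1 : ℤ) else 0)
      = ((Fintype.piFinset (fun l : Fin n => (gAl n b l).sym2)).card : ℤ) := by
    rw [Finset.sum_boole]
    congr 2
    ext M
    simp only [hU, Finset.mem_filter, Fintype.mem_piFinset, Finset.mem_sym2_iff, gAl,
      Finset.mem_image, Finset.mem_univ, true_and, and_true]
    constructor
    · rintro ⟨h1, h2⟩ l x hx
      obtain ⟨i, hi, rfl⟩ := h1 l x hx
      refine ⟨i, ⟨hi, ?_⟩, rfl⟩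
      by_contra hb
      exact h2 i (by simpa using hb) l hx
    · intro h
      refine ⟨fun l x hx => ?_, fun m hm l hx => ?_⟩
      · obtain ⟨i, hi, rfl⟩ := h l x hx
        exact ⟨i, hi.1, rfl⟩
      · obtain ⟨i, hi, hi'⟩ := h l _ hx
        have : i = m := Fin.ext (by omega)
        subst this
        simp [hm] at hi
  rw [hc, Fintype.card_piFinset]
  push_cast
  rw [show (2 : ℤ) ^ n = ∏ _l : Fin n, 2 by simp, ← Finset.prod_mul_distrib]
  apply Finset.prod_congr rfl
  intro l _
  rw [Finset.card_sym2, two_choose, gAl_card]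
  push_cast
  simp

theorem stmt12 (n : ℕ) (hn : 1 ≤ n) :
    medianGenocchi n = 2 ^ n * (Mcal n).ncard ∧ 2 ^ n ∣ medianGenocchi n := by
  have h : medianGenocchi n = 2 ^ n * (Mcal n).ncard := by
    have h1 := median_eq n
    rw [← gcount n] at h1
    exact_mod_cast h1
  exact ⟨h, h ▸ Dvd.intro _ rfl⟩
end

section
/- For every n ≥ 1, the map (I_0, I_1, …, I_n) ↦ (I_1 \ I_0, I_2 \ I_1, …, I_n \ I_{n−1}) is a bijection from 𝓘_n onto 𝓢_n, and for all k, l ∈ [n] it sends 𝓘_{n,k} onto 𝓢_{n,k} and 𝓘'_{n,l} onto 𝓢'_{n,l}. -/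
/-- `Ical n` : Feigin's model. An element is a tuple `(I_0, …, I_n)` of subsets
of `[n]` (indexed by `Fin (n+1)`) with `#I_i = i` and `I_{i-1} \ {i} ⊆ I_i`. -/
def Ical (n : ℕ) : Set (Fin (n + 1) → Finset ℕ) :=
  {I | (∀ i : Fin (n + 1), I i ⊆ Finset.Icc 1 n ∧ (I i).card = (i : ℕ)) ∧
       (∀ j : Fin n, I j.castSucc \ {(j : ℕ) + 1} ⊆ I j.succ)}

/-- `I_i` for a natural number index `i ∈ [0, n]` (junk value `∅` outside). -/
def IvalAt (n : ℕ) (I : Fin (n + 1) → Finset ℕ) (i : ℕ) : Finset ℕ :=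
  if h : i ≤ n then I ⟨i, by omega⟩ else ∅

/-- `IcalFirst n k` : the `(I_0,…,I_n) ∈ Ical n` with `min {i : 1 ∈ I_i} = k`. -/
def IcalFirst (n k : ℕ) : Set (Fin (n + 1) → Finset ℕ) :=
  {I ∈ Ical n | sInf {i : ℕ | 1 ∈ IvalAt n I i} = k}

/-- `IcalLast n l` : the `(I_0,…,I_n) ∈ Ical n` with `min {i : n ∈ I_i} = l`. -/
def IcalLast (n l : ℕ) : Set (Fin (n + 1) → Finset ℕ) :=
  {I ∈ Ical n | sInf {i : ℕ | n ∈ IvalAt n I i} = l}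

/-- `S_j` for a (1-based) index `j ∈ [n]` (junk value `∅` outside). -/
def SvalAt (n : ℕ) (S : Fin n → Finset ℕ) (j : ℕ) : Finset ℕ :=
  if h : 1 ≤ j ∧ j ≤ n then S ⟨j - 1, by omega⟩ else ∅

/-- `S_i^{-1} = {j ∈ [n] : i ∈ S_j}`. -/
def Sinv (n : ℕ) (S : Fin n → Finset ℕ) (i : ℕ) : Finset ℕ :=
  (Finset.Icc 1 n).filter (fun j => i ∈ SvalAt n S j)

/-- `Scal n` : the set of tuples `(S_1, …, S_n)` of subsets of `[n]` (indexed by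
`Fin n`, the entry of index `j` being `S_{j+1}`) such that `#S_i ∈ {1,2}` and
`#S_i^{-1} ∈ {1,2}` for all `i ∈ [n]`, and whenever `#S_i = 2` there are
`i₁ < i < i₂` with `S_i^{-1} = {i₁, i₂}`. -/
def Scal (n : ℕ) : Set (Fin n → Finset ℕ) :=
  {S | (∀ j : Fin n, S j ⊆ Finset.Icc 1 n) ∧
       (∀ i, 1 ≤ i → i ≤ n →
         ((SvalAt n S i).card = 1 ∨ (SvalAt n S i).card = 2) ∧
         ((Sinv n S i).card = 1 ∨ (Sinv n S i).card = 2) ∧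
         ((SvalAt n S i).card = 2 →
           ∃ i₁ i₂, i₁ < i ∧ i < i₂ ∧ Sinv n S i = {i₁, i₂}))}

/-- `ScalFirst n k` : the `(S_1,…,S_n) ∈ Scal n` with `S_1^{-1} = {k}`. -/
def ScalFirst (n k : ℕ) : Set (Fin n → Finset ℕ) :=
  {S ∈ Scal n | Sinv n S 1 = {k}}

/-- `ScalLast n l` : the `(S_1,…,S_n) ∈ Scal n` with `S_n^{-1} = {l}`. -/
def ScalLast (n l : ℕ) : Set (Fin n → Finset ℕ) :=
  {S ∈ Scal n | Sinv n S n = {l}}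

/-- The map `(I_0, …, I_n) ↦ (I_1 \ I_0, …, I_n \ I_{n-1})`. -/
def ItoS (n : ℕ) (I : Fin (n + 1) → Finset ℕ) : Fin n → Finset ℕ :=
  fun j => I j.succ \ I j.castSucc

lemma aux_IvalAt (n : ℕ) (I : Fin (n + 1) → Finset ℕ) (i : Fin (n+1)) :
    IvalAt n I i = I i := by
  have := i.2
  unfold IvalAt
  rw [dif_pos (by omega)]

lemma aux_SvalAt (n : ℕ) (I : Fin (n + 1) → Finset ℕ) (i : ℕ) (hi : i < n) :
    SvalAt n (ItoS n I) (i+1) = IvalAt n I (i+1) \ IvalAt n I i := by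
  unfold SvalAt IvalAt ItoS
  rw [dif_pos (by omega), dif_pos (by omega), dif_pos (by omega)]
  rfl

lemma aux_SvalFin (n : ℕ) (S : Fin n → Finset ℕ) (i : Fin n) :
    SvalAt n S (i+1) = S i := by
  have := i.2
  unfold SvalAt
  rw [dif_pos (by omega)]
  rfl

lemma aux_mem_Sinv (n : ℕ) (S : Fin n → Finset ℕ) (x j : ℕ) :
    j ∈ Sinv n S x ↔ (1 ≤ j ∧ j ≤ n) ∧ x ∈ SvalAt n S j := by
  simp [Sinv]

lemma aux_mem_Sinv' (n : ℕ) (I : Fin (n + 1) → Finset ℕ) (x j : ℕ) :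
    j ∈ Sinv n (ItoS n I) x ↔
      (1 ≤ j ∧ j ≤ n) ∧ x ∈ IvalAt n I j ∧ x ∉ IvalAt n I (j-1) := by
  rw [aux_mem_Sinv]
  refine and_congr_right fun h => ?_
  obtain ⟨i, rfl⟩ : ∃ i, j = i + 1 := ⟨j-1, by omega⟩
  rw [aux_SvalAt n I i (by omega)]
  simp

/-- natural-index version of membership -/
structure Good (n : ℕ) (J : ℕ → Finset ℕ) : Prop where
  sub : ∀ i, i ≤ n → J i ⊆ Finset.Icc 1 n
  card : ∀ i, i ≤ n → (J i).card = i
  step : ∀ i, i < n → J i \ {i+1} ⊆ J (i+1)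

lemma aux_good {n : ℕ} {I : Fin (n + 1) → Finset ℕ} :
    I ∈ Ical n ↔ Good n (IvalAt n I) := by
  constructor
  · rintro ⟨h1, h2⟩
    refine ⟨fun i hi => ?_, fun i hi => ?_, fun i hi => ?_⟩
    · have := aux_IvalAt n I ⟨i, by omega⟩
      simp only at this
      rw [this]; exact (h1 _).1
    · have := aux_IvalAt n I ⟨i, by omega⟩
      simp only at this
      rw [this]; exact (h1 _).2
    · have a := aux_IvalAt n I ⟨i, by omega⟩
      have b := aux_IvalAt n I ⟨i+1, by omega⟩
      simp only at a b
      rw [a, b]; exact h2 ⟨i, hi⟩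
  · rintro ⟨h1, h2, h3⟩
    refine ⟨fun i => ?_, fun j => ?_⟩
    · rw [← aux_IvalAt n I i]
      exact ⟨h1 _ (by omega), h2 _ (by omega)⟩
    · rw [← aux_IvalAt n I j.castSucc, ← aux_IvalAt n I j.succ]
      exact h3 j j.2

namespace Good
variable {n : ℕ} {J : ℕ → Finset ℕ}

lemma zero (h : Good n J) : J 0 = ∅ := by
  have := h.card 0 (by omega)
  simpa using this

lemma top (h : Good n J) : J n = Finset.Icc 1 n := by
  apply Finset.eq_of_subset_of_card_le (h.sub n le_rfl)
  rw [h.card n le_rfl]; simp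

lemma cases (h : Good n J) (i : ℕ) (hi : i < n) :
    (i+1 ∈ J i ∧ i+1 ∉ J (i+1) ∧ (J (i+1) \ J i).card = 2) ∨
    (J i ⊆ J (i+1) ∧ (J (i+1) \ J i).card = 1) := by
  have c1 := h.card i (by omega)
  have c2 := h.card (i+1) (by omega)
  have e1 := Finset.card_sdiff_add_card_inter (J (i+1)) (J i)
  have e2 := Finset.card_sdiff_add_card_inter (J i) (J (i+1))
  rw [Finset.inter_comm] at e2
  have st := h.step i hi
  by_cases hx : i+1 ∈ J i ∧ i+1 ∉ J (i+1)
  · left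
    refine ⟨hx.1, hx.2, ?_⟩
    have : J i \ J (i+1) = {i+1} := by
      ext y
      have := @st y
      simp only [Finset.mem_sdiff, Finset.mem_singleton] at *
      grind
    rw [this, Finset.card_singleton] at e2
    omega
  · right
    have hs : J i ⊆ J (i+1) := by
      intro y hy
      have := @st y
      simp only [Finset.mem_sdiff, Finset.mem_singleton] at *
      grind
    refine ⟨hs, ?_⟩
    rw [Finset.sdiff_eq_empty_iff_subset.2 hs, Finset.card_empty] at e2
    omega

lemma mono (h : Good n J) {x a b : ℕ} (hab : a ≤ b) (hb : b ≤ n) (hx : x ∈ J a)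
    (hc : ¬ (a < x ∧ x ≤ b) ∨ J (x-1) ⊆ J x) : x ∈ J b := by
  induction b, hab using Nat.le_induction with
  | base => exact hx
  | succ b hab ih =>
    have h1 := ih (by omega) (hc.imp_left (by omega))
    by_cases hxb : x = b + 1
    · subst hxb
      rcases hc with hc | hc
      · omega
      · exact hc h1
    · exact h.step b (by omega) (by simp [h1, hxb])

lemma entry (_h : Good n J) {x a b : ℕ} (hab : a ≤ b) (hx : x ∉ J a) (hb : x ∈ J b) :
    ∃ j, a < j ∧ j ≤ b ∧ x ∈ J j ∧ x ∉ J (j-1) := by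
  induction b, hab using Nat.le_induction with
  | base => exact absurd hb hx
  | succ b hab ih =>
    by_cases hxb : x ∈ J b
    · obtain ⟨j, h1, h2, h3⟩ := ih hxb
      exact ⟨j, h1, by omega, h3⟩
    · exact ⟨b+1, by omega, le_rfl, hb, by simpa using hxb⟩

end Good

lemma aux_single {n : ℕ} {I : Fin (n + 1) → Finset ℕ} (h : I ∈ Ical n) {x : ℕ}
    (hx1 : 1 ≤ x) (hxn : x ≤ n) (hs : IvalAt n I (x-1) ⊆ IvalAt n I x) :
    Sinv n (ItoS n I) x = {sInf {i : ℕ | x ∈ IvalAt n I i}} := by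
  have g := aux_good.1 h
  have hne : n ∈ {i : ℕ | x ∈ IvalAt n I i} := by
    simp [g.top]; omega
  have hm := Nat.sInf_mem ⟨n, hne⟩
  have hle := Nat.sInf_le hne
  have hlt : ∀ m, m < sInf {i : ℕ | x ∈ IvalAt n I i} → x ∉ IvalAt n I m :=
    fun m hm => Nat.notMem_of_lt_sInf (s := {i : ℕ | x ∈ IvalAt n I i}) hm
  generalize sInf {i : ℕ | x ∈ IvalAt n I i} = k at *
  simp only [Set.mem_ofPred_eq] at hm hne
  have hk0 : k ≠ 0 := by
    rintro rfl
    simp [g.zero] at hm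
  ext j
  rw [aux_mem_Sinv', Finset.mem_singleton]
  constructor
  · rintro ⟨hj, h1, h2⟩
    by_contra hne
    rcases lt_or_gt_of_ne hne with hl | hl
    · exact hlt j hl h1
    · exact h2 (g.mono (by omega) (by omega) hm (Or.inr hs))
  · rintro rfl
    exact ⟨by omega, hm, hlt _ (by omega)⟩

lemma aux_double {n : ℕ} {I : Fin (n + 1) → Finset ℕ} (h : I ∈ Ical n) {x : ℕ}
    (hx1 : 1 ≤ x) (hxn : x ≤ n) (h1 : x ∈ IvalAt n I (x-1)) (h2 : x ∉ IvalAt n I x) :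
    ∃ i₁ i₂, i₁ < x ∧ x < i₂ ∧ Sinv n (ItoS n I) x = {i₁, i₂} := by
  have g := aux_good.1 h
  obtain ⟨a, ha1, ha2, ha3, ha4⟩ := g.entry (a := 0) (by omega) (by simp [g.zero]) h1
  obtain ⟨b, hb1, hb2, hb3, hb4⟩ := g.entry (b := n) hxn h2 (by simp [g.top]; omega)
  refine ⟨a, b, by omega, by omega, ?_⟩
  ext j
  rw [aux_mem_Sinv', Finset.mem_insert, Finset.mem_singleton]
  constructor
  · rintro ⟨hj, hj1, hj2⟩
    by_contra hne
    rcases lt_trichotomy j x with hl | hl | hl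
    · rcases lt_or_gt_of_ne (show j ≠ a by tauto) with hl' | hl'
      · exact ha4 (g.mono (by omega) (by omega) hj1 (Or.inl (by omega)))
      · exact hj2 (g.mono (by omega) (by omega) ha3 (Or.inl (by omega)))
    · subst hl; exact h2 hj1
    · rcases lt_or_gt_of_ne (show j ≠ b by tauto) with hl' | hl'
      · exact hb4 (g.mono (by omega) (by omega) hj1 (Or.inl (by omega)))
      · exact hj2 (g.mono (by omega) (by omega) hb3 (Or.inl (by omega)))
  · rintro (rfl | rfl)
    · exact ⟨by omega, ha3, ha4⟩
    · exact ⟨by omega, hb3, hb4⟩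

lemma aux_mapsTo {n : ℕ} {I : Fin (n + 1) → Finset ℕ} (h : I ∈ Ical n) :
    ItoS n I ∈ Scal n := by
  have g := aux_good.1 h
  refine ⟨fun j => Finset.sdiff_subset.trans (h.1 _).1, fun x hx1 hxn => ?_⟩
  obtain ⟨i, rfl⟩ : ∃ i, x = i + 1 := ⟨x-1, by omega⟩
  rw [aux_SvalAt n I i (by omega)]
  rcases g.cases i (by omega) with ⟨h1, h2, h3⟩ | ⟨h1, h2⟩
  · obtain ⟨a, b, ha, hb, hab⟩ := aux_double h hx1 hxn h1 h2
    refine ⟨Or.inr h3, Or.inr ?_, fun _ => ⟨a, b, ha, hb, hab⟩⟩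
    rw [hab, Finset.card_pair (by omega)]
  · refine ⟨Or.inl h2, Or.inl ?_, fun h => by omega⟩
    rw [aux_single h hx1 hxn h1, Finset.card_singleton]

lemma aux_inj {n : ℕ} : Set.InjOn (ItoS n) (Ical n) := by
  intro I hI I' hI' he
  have g := aux_good.1 hI
  have g' := aux_good.1 hI'
  have key : ∀ i, i ≤ n → IvalAt n I i = IvalAt n I' i := by
    intro i
    induction i with
    | zero => intro _; rw [g.zero, g'.zero]
    | succ i ih =>
      intro hi
      have e := ih (by omega)
      have s1 := aux_SvalAt n I i (by omega)
      have s2 := aux_SvalAt n I' i (by omega)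
      rw [he, s2] at s1
      have c := g.cases i (by omega)
      have c' := g'.cases i (by omega)
      have st := g.step i (by omega)
      have st' := g'.step i (by omega)
      rw [← s1] at c
      rw [← e] at c c' s1 st'
      generalize IvalAt n I i = A at *
      generalize IvalAt n I (i+1) = B at *
      generalize IvalAt n I' (i+1) = B' at *
      ext y
      have s1 := Finset.ext_iff.1 s1 y
      have st := @st y
      have st' := @st' y
      simp only [Finset.mem_sdiff, Finset.mem_singleton] at s1 st st'
      rcases c with ⟨a1, a2, a3⟩ | ⟨a1, a2⟩ <;> rcases c' with ⟨b1, b2, b3⟩ | ⟨b1, b2⟩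
      · by_cases hy : y = i+1
        · subst hy; exact ⟨fun q => absurd q a2, fun q => absurd q b2⟩
        · clear a1 a2 a3 b1 b2 b3
          by_cases hA : y ∈ A
          · exact ⟨fun _ => st' ⟨hA, hy⟩, fun _ => st ⟨hA, hy⟩⟩
          · simpa [hA, iff_comm] using s1
      · omega
      · omega
      · by_cases hA : y ∈ A
        · exact ⟨fun _ => b1 hA, fun _ => a1 hA⟩
        · simpa [hA, iff_comm] using s1
  funext i
  rw [← aux_IvalAt n I i, ← aux_IvalAt n I' i]
  exact key i (by omega)

lemma aux_cardeq {n : ℕ} {S : Fin n → Finset ℕ} (h : S ∈ Scal n) (x : ℕ)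
    (hx1 : 1 ≤ x) (hxn : x ≤ n) : (SvalAt n S x).card = (Sinv n S x).card := by
  have hle : ∀ x ∈ Finset.Icc 1 n, (SvalAt n S x).card ≤ (Sinv n S x).card := by
    intro x hx
    rw [Finset.mem_Icc] at hx
    obtain ⟨h1, h2, h3⟩ := h.2 x hx.1 hx.2
    rcases h1 with h1 | h1
    · omega
    · obtain ⟨a, b, ha, hb, hab⟩ := h3 h1
      rw [h1, hab, Finset.card_pair (by omega)]
  refine (Finset.sum_eq_sum_iff_of_le hle).1 ?_ x (by simp; omega)
  have := Finset.sum_card_bipartiteAbove_eq_sum_card_bipartiteBelow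
    (s := Finset.Icc 1 n) (t := Finset.Icc 1 n) (fun j x => x ∈ SvalAt n S j)
  refine Eq.trans (Finset.sum_congr rfl fun j hj => ?_) this
  congr 1
  rw [Finset.mem_Icc] at hj
  ext y
  simp only [Finset.mem_bipartiteAbove]
  refine ⟨fun hy => ⟨?_, hy⟩, fun hy => hy.2⟩
  unfold SvalAt at hy
  rw [dif_pos hj] at hy
  exact h.1 _ hy

/-- the inverse map -/
def auxK (n : ℕ) (S : Fin n → Finset ℕ) (i : ℕ) : Finset ℕ :=
  (Finset.Icc 1 n).filter (fun x => ∃ j ∈ Sinv n S x, j ≤ i ∧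
    ¬ ((SvalAt n S x).card = 2 ∧ j < x ∧ x ≤ i))

lemma aux_K {n : ℕ} {S : Fin n → Finset ℕ} (h : S ∈ Scal n) (x i : ℕ)
    (hx1 : 1 ≤ x) (hxn : x ≤ n) :
    ((SvalAt n S x).card = 1 ∧ ∃ k, (∀ j, j ∈ Sinv n S x ↔ j = k) ∧
      ∀ i, x ∈ auxK n S i ↔ k ≤ i) ∨
    ((SvalAt n S x).card = 2 ∧ ∃ a b, a < x ∧ x < b ∧ (∀ j, j ∈ Sinv n S x ↔ j = a ∨ j = b) ∧
      ∀ i, x ∈ auxK n S i ↔ (a ≤ i ∧ i < x) ∨ b ≤ i) := by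
  obtain ⟨h1, h2, h3⟩ := h.2 x hx1 hxn
  have hc := aux_cardeq h x hx1 hxn
  rcases h1 with h1 | h1
  · left
    refine ⟨h1, ?_⟩
    obtain ⟨k, hk⟩ := Finset.card_eq_one.1 (hc.symm.trans h1)
    refine ⟨k, by simp [hk], fun i => ?_⟩
    simp [auxK, hk, h1, hx1, hxn]
  · right
    refine ⟨h1, ?_⟩
    obtain ⟨a, b, ha, hb, hab⟩ := h3 h1
    refine ⟨a, b, ha, hb, by simp [hab], fun i => ?_⟩
    simp only [auxK, hab, h1, Finset.mem_filter, Finset.mem_Icc, Finset.mem_insert,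
      Finset.mem_singleton, true_and, exists_eq_or_imp, exists_eq_left]
    omega

lemma aux_K_diff {n : ℕ} {S : Fin n → Finset ℕ} (h : S ∈ Scal n) (i : ℕ) (hi : i < n) :
    auxK n S (i+1) \ auxK n S i = SvalAt n S (i+1) ∧
    auxK n S i \ auxK n S (i+1) = if (SvalAt n S (i+1)).card = 2 then {i+1} else ∅ := by
  have hsub : ∀ j x, x ∈ auxK n S j → 1 ≤ x ∧ x ≤ n := by
    intro j x hx
    exact Finset.mem_Icc.1 (Finset.mem_filter.1 hx).1
  have hS : ∀ x, x ∈ SvalAt n S (i+1) → 1 ≤ x ∧ x ≤ n := by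
    intro x hx
    have := aux_SvalFin n S ⟨i, hi⟩
    simp only at this
    rw [this] at hx
    exact Finset.mem_Icc.1 (h.1 _ hx)
  constructor
  · ext x
    rw [Finset.mem_sdiff]
    by_cases hx : 1 ≤ x ∧ x ≤ n
    · have hm := aux_mem_Sinv n S x (i+1)
      have hm' : i + 1 ∈ Sinv n S x ↔ x ∈ SvalAt n S (i+1) := by
        rw [hm]; exact and_iff_right (by omega)
      rw [← hm']
      rcases aux_K h x i hx.1 hx.2 with ⟨_, k, h1, h2⟩ | ⟨_, a, b, ha, hb, h1, h2⟩
      · rw [h1, h2, h2]; omega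
      · rw [h1, h2, h2]; omega
    · exact ⟨fun hh => absurd (hsub _ _ hh.1) hx, fun hh => absurd (hS _ hh) hx⟩
  · ext x
    rw [Finset.mem_sdiff]
    by_cases hx : 1 ≤ x ∧ x ≤ n
    · rcases aux_K h x i hx.1 hx.2 with ⟨hc, k, h1, h2⟩ | ⟨hc, a, b, ha, hb, h1, h2⟩
      · rw [h2, h2]
        split_ifs with h3
        · rw [Finset.mem_singleton]
          have : x ≠ i+1 := by rintro rfl; omega
          omega
        · simp; omega
      · rw [h2, h2]
        split_ifs with h3
        · rw [Finset.mem_singleton]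
          have := (h1 a).2 (Or.inl rfl)
          omega
        · have : x ≠ i+1 := by rintro rfl; omega
          simp; omega
    · refine ⟨fun hh => absurd (hsub _ _ hh.1) hx, fun hh => ?_⟩
      split_ifs at hh with h3
      · rw [Finset.mem_singleton] at hh; omega
      · simp at hh

lemma aux_K_good {n : ℕ} {S : Fin n → Finset ℕ} (h : S ∈ Scal n) : Good n (auxK n S) := by
  refine ⟨fun i _ => Finset.filter_subset _ _, fun i => ?_, fun i hi => ?_⟩
  · induction i with
    | zero =>
      intro _
      rw [Finset.card_eq_zero, Finset.eq_empty_iff_forall_notMem]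
      intro x hx
      obtain ⟨_, j, hj, hj0, _⟩ := Finset.mem_filter.1 hx
      rw [aux_mem_Sinv] at hj
      omega
    | succ i ih =>
      intro hi
      have c := ih (by omega)
      obtain ⟨d1, d2⟩ := aux_K_diff h i (by omega)
      have e1 := Finset.card_sdiff_add_card_inter (auxK n S (i+1)) (auxK n S i)
      have e2 := Finset.card_sdiff_add_card_inter (auxK n S i) (auxK n S (i+1))
      rw [Finset.inter_comm] at e2
      rw [d1] at e1
      rw [d2] at e2
      have := (h.2 (i+1) (by omega) hi).1
      split_ifs at e2 <;> simp at e2 <;> omega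
  · obtain ⟨d1, d2⟩ := aux_K_diff h i hi
    intro x hx
    rw [Finset.mem_sdiff] at hx
    by_contra hn
    have : x ∈ auxK n S i \ auxK n S (i+1) := Finset.mem_sdiff.2 ⟨hx.1, hn⟩
    rw [d2] at this
    split_ifs at this
    · exact hx.2 this
    · simp at this

lemma aux_surj {n : ℕ} {S : Fin n → Finset ℕ} (h : S ∈ Scal n) :
    ∃ I ∈ Ical n, ItoS n I = S := by
  have g := aux_K_good h
  refine ⟨fun i => auxK n S i, ⟨fun i => ⟨g.sub i (by omega), g.card i (by omega)⟩,
    fun j => g.step j j.2⟩, ?_⟩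
  funext j
  rw [← aux_SvalFin n S j, ← (aux_K_diff h j j.2).1]
  rfl

lemma aux_first {n : ℕ} {I : Fin (n + 1) → Finset ℕ} (hn : 1 ≤ n) (h : I ∈ Ical n) :
    Sinv n (ItoS n I) 1 = {sInf {i : ℕ | 1 ∈ IvalAt n I i}} := by
  apply aux_single h le_rfl hn
  simp [(aux_good.1 h).zero]

lemma aux_last {n : ℕ} {I : Fin (n + 1) → Finset ℕ} (hn : 1 ≤ n) (h : I ∈ Ical n) :
    Sinv n (ItoS n I) n = {sInf {i : ℕ | n ∈ IvalAt n I i}} := by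
  apply aux_single h hn le_rfl
  rw [(aux_good.1 h).top]
  exact (aux_good.1 h).sub _ (by omega)

theorem stmt13 (n : ℕ) (hn : 1 ≤ n) :
    Set.BijOn (ItoS n) (Ical n) (Scal n) ∧
    (∀ k, 1 ≤ k → k ≤ n → ItoS n '' IcalFirst n k = ScalFirst n k) ∧
    (∀ l, 1 ≤ l → l ≤ n → ItoS n '' IcalLast n l = ScalLast n l) := by
  refine ⟨⟨fun I hI => aux_mapsTo hI, aux_inj, fun S hS => aux_surj hS⟩, ?_, ?_⟩
  · intro k _ _
    ext S
    constructor
    · rintro ⟨I, ⟨hI, hk⟩, rfl⟩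
      exact ⟨aux_mapsTo hI, by rw [aux_first hn hI, hk]⟩
    · rintro ⟨hS, hk⟩
      obtain ⟨I, hI, rfl⟩ := aux_surj hS
      rw [aux_first hn hI] at hk
      exact ⟨I, ⟨hI, Finset.singleton_injective hk⟩, rfl⟩
  · intro k _ _
    ext S
    constructor
    · rintro ⟨I, ⟨hI, hk⟩, rfl⟩
      exact ⟨aux_mapsTo hI, by rw [aux_last hn hI, hk]⟩
    · rintro ⟨hS, hk⟩
      obtain ⟨I, hI, rfl⟩ := aux_surj hS
      rw [aux_last hn hI] at hk
      exact ⟨I, ⟨hI, Finset.singleton_injective hk⟩, rfl⟩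
end
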